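/- arXiv:1101.1939 — 3 statements merged into one kernel-verified Lean document; each statement's English description precedes it below -/
import Mathlib

section
/- Let K be a function field over a finite field 𝔽_q (i.e., a finite extension of the rational function field 𝔽_q(t)) and let E be an elliptic curve over K. Then the group E(K) of K-rational points is a finitely generated abelian group (the Mordell–Weil–Lang–Néron theorem). -/
section PartFA

/-- Data attached to a function field. -/
structure FFSetup (K : Type*) [Field K] (p : ℕ) where
  O1 : Subring K
  O2 : Subring K
  t : K
  t_ne : t ≠ 0
  t_mem : t ∈ O1
  tinv_mem : t⁻¹ ∈ O2
  ded1 : IsDedekindDomain O1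
  ded2 : IsDedekindDomain O2
  frac1 : IsFractionRing O1 K
  frac2 : IsFractionRing O2 K
  fin : ∀ L : ℕ, {y : K | y ∈ O1 ∧ y * t⁻¹ ^ L ∈ O2}.Finite
  bdd2 : ∀ y : K, ∃ L : ℕ, y * t⁻¹ ^ L ∈ O2
  D : Derivation ℤ K K
  bD1 : ∃ g : K, g ≠ 0 ∧ ∀ y ∈ O1, g * D y ∈ O1
  bD2 : ∃ g : K, g ≠ 0 ∧ ∀ y ∈ O2, g * D y ∈ O2
  powD : ∀ μ : K, μ ≠ 0 → ∃ m < p, ∃ α : K, α ≠ 0 ∧ D^[m] μ = α ^ p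
  kerD : ∀ y : K, D y = 0 → ∃ z, y = z ^ p
  H1 : ∃ C : ℕ, ∀ y : K, ∃ r ∈ O1, (y - r) * t⁻¹ ^ C ∈ O2
  cl : Finite (ClassGroup O1)

namespace FFSetup

variable {K : Type*} [Field K] {p : ℕ} (S : FFSetup K p)

/-- The Riemann–Roch space of `L` times the pole divisor of `t`. -/
def V (L : ℕ) (y : K) : Prop := y ∈ S.O1 ∧ y * S.t⁻¹ ^ L ∈ S.O2

variable {S}

lemma V.mul {L M : ℕ} {x y : K} (hx : S.V L x) (hy : S.V M y) : S.V (L + M) (x * y) := by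
  refine ⟨mul_mem hx.1 hy.1, ?_⟩
  have := mul_mem hx.2 hy.2
  rwa [show x * S.t⁻¹ ^ L * (y * S.t⁻¹ ^ M) = x * y * S.t⁻¹ ^ (L + M) by ring] at this

lemma V.add {L : ℕ} {x y : K} (hx : S.V L x) (hy : S.V L y) : S.V L (x + y) :=
  ⟨add_mem hx.1 hy.1, by rw [add_mul]; exact add_mem hx.2 hy.2⟩

lemma V.neg {L : ℕ} {x : K} (hx : S.V L x) : S.V L (-x) :=
  ⟨neg_mem hx.1, by rw [neg_mul]; exact neg_mem hx.2⟩

lemma V.sub {L : ℕ} {x y : K} (hx : S.V L x) (hy : S.V L y) : S.V L (x - y) := by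
  rw [sub_eq_add_neg]; exact hx.add hy.neg

lemma V.mono {L M : ℕ} (h : L ≤ M) {x : K} (hx : S.V L x) : S.V M x := by
  refine ⟨hx.1, ?_⟩
  obtain ⟨k, rfl⟩ := Nat.exists_eq_add_of_le h
  rw [pow_add, ← mul_assoc]
  exact mul_mem hx.2 (pow_mem S.tinv_mem _)

lemma V.zero (L : ℕ) : S.V L 0 := ⟨zero_mem _, by rw [zero_mul]; exact zero_mem _⟩

lemma V.one (L : ℕ) : S.V L 1 :=
  V.mono (Nat.zero_le L) ⟨one_mem _, by rw [pow_zero, mul_one]; exact one_mem _⟩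

lemma V.pow {L : ℕ} {x : K} (hx : S.V L x) (n : ℕ) : S.V (n * L) (x ^ n) := by
  induction n with
  | zero => simpa using V.one (S := S) 0
  | succ n ih => rw [pow_succ, Nat.succ_mul]; exact ih.mul hx

lemma V.natCast {L : ℕ} {x : K} (n : ℕ) (hx : S.V L x) : S.V L (n * x) := by
  induction n with
  | zero => simpa using V.zero (S := S) L
  | succ n ih => push_cast; rw [add_mul, one_mul]; exact ih.add hx

lemma V.sum {L : ℕ} {ι : Type*} (s : Finset ι) (f : ι → K) (h : ∀ i ∈ s, S.V L (f i)) :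
    S.V L (∑ i ∈ s, f i) := by
  classical
  induction s using Finset.induction_on with
  | empty => simpa using V.zero (S := S) L
  | insert a s ha ih =>
    rw [Finset.sum_insert ha]
    exact (h a (by simp)).add (ih fun i hi => h i (by simp [hi]))

/-- monic polynomials over `O` have roots in `O`. -/
lemma mem_of_isIntegral {O : Subring K} [IsDedekindDomain O] [IsFractionRing O K] {x : K}
    (h : IsIntegral O x) : x ∈ O := by
  obtain ⟨y, hy⟩ := (IsIntegrallyClosed.isIntegral_iff (R := O) (K := K)).1 h
  rw [← hy]; exact y.2

lemma mem_of_pow {O : Subring K} [IsDedekindDomain O] [IsFractionRing O K] {x : K} {n : ℕ}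
    (hn : n ≠ 0) (h : x ^ n ∈ O) : x ∈ O := by
  apply mem_of_isIntegral
  refine IsIntegral.of_pow (Nat.pos_of_ne_zero hn) ?_
  exact isIntegral_algebraMap (R := O) (A := K) (x := ⟨_, h⟩)

lemma mem_of_quad {O : Subring K} [IsDedekindDomain O] [IsFractionRing O K] {x e f : K}
    (he : e ∈ O) (hf : f ∈ O) (h : x ^ 2 + e * x = f) : x ∈ O := by
  apply mem_of_isIntegral
  refine ⟨Polynomial.X ^ 2 + Polynomial.C (⟨e, he⟩ : O) * Polynomial.X
    - Polynomial.C (⟨f, hf⟩ : O), ?_, ?_⟩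
  · rw [add_sub_assoc]
    refine Polynomial.monic_X_pow_add ?_
    compute_degree!
  · simp only [Polynomial.eval₂_add, Polynomial.eval₂_sub, Polynomial.eval₂_mul,
      Polynomial.eval₂_pow, Polynomial.eval₂_X, Polynomial.eval₂_C]
    change x ^ 2 + e * x - f = 0
    rw [h, sub_self]

lemma V.of_pow {L n : ℕ} (hn : n ≠ 0) {x : K} (h : S.V (n * L) (x ^ n)) : S.V L x := by
  have := S.ded1; have := S.ded2; have := S.frac1; have := S.frac2
  refine ⟨mem_of_pow hn h.1, mem_of_pow hn ?_⟩
  rw [mul_pow, ← pow_mul, mul_comm L]; exact h.2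

lemma V.of_quad {L : ℕ} {x e f : K} (he : S.V L e) (hf : S.V (2 * L) f)
    (h : x ^ 2 + e * x = f) : S.V L x := by
  have := S.ded1; have := S.ded2; have := S.frac1; have := S.frac2
  refine ⟨mem_of_quad he.1 hf.1 h, mem_of_quad he.2 hf.2 ?_⟩
  rw [← h]; ring

variable (S)

lemma exists_clear1 (y : K) : ∃ g : K, g ≠ 0 ∧ g ∈ S.O1 ∧ g * y ∈ S.O1 := by
  have := S.ded1; have := S.frac1
  obtain ⟨a, b, hb, rfl⟩ := IsFractionRing.div_surjective (A := S.O1) y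
  refine ⟨b, ?_, b.2, ?_⟩
  · simpa using nonZeroDivisors.ne_zero hb
  · have hb' : (b : K) ≠ 0 := by simpa using nonZeroDivisors.ne_zero hb
    change (b : K) * ((a : K) / (b : K)) ∈ S.O1
    rw [mul_div_cancel₀ _ hb']; exact a.2

lemma exists_clear (s : Finset K) :
    ∃ γ : K, γ ≠ 0 ∧ ∃ C : ℕ, S.V C γ ∧ ∀ a ∈ s, S.V C (γ * a) := by
  classical
  induction s using Finset.induction_on with
  | empty => exact ⟨1, one_ne_zero, 0, V.one 0, by simp⟩
  | insert a s ha ih =>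
    obtain ⟨γ, hγ, C, h1, h2⟩ := ih
    obtain ⟨g, hg, hg1, hg2⟩ := S.exists_clear1 a
    obtain ⟨M, hM⟩ := S.bdd2 g
    obtain ⟨N, hN⟩ := S.bdd2 (g * a)
    have hgV : S.V (M + N) g := V.mono (Nat.le_add_right M N) ⟨hg1, hM⟩
    have hgaV : S.V (M + N) (g * a) := V.mono (Nat.le_add_left N M) ⟨hg2, hN⟩
    refine ⟨γ * g, mul_ne_zero hγ hg, C + (M + N), h1.mul hgV, fun b hb => ?_⟩
    rcases Finset.mem_insert.1 hb with rfl | hb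
    · rw [mul_assoc]; exact h1.mul hgaV
    · rw [mul_right_comm]; exact (h2 b hb).mul hgV

lemma finite_of_bdd {G1 G2 : K} (h1 : G1 ≠ 0) (h2 : G2 ≠ 0) :
    {m : K | G1 * m ∈ S.O1 ∧ G2 * m ∈ S.O2}.Finite := by
  obtain ⟨g, hg, hg1, hg2⟩ := S.exists_clear1 G1⁻¹
  obtain ⟨L, hL⟩ := S.bdd2 (g * G2⁻¹)
  refine ((S.fin L).preimage (f := fun m => g * m) ?_).subset ?_
  · intro a _ b _ h; exact mul_left_cancel₀ hg h
  · rintro m ⟨hm1, hm2⟩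
    refine ⟨?_, ?_⟩
    · have := mul_mem hg2 hm1
      rwa [show g * G1⁻¹ * (G1 * m) = g * m by field_simp] at this
    · have := mul_mem hL hm2
      change g * m * S.t⁻¹ ^ L ∈ S.O2
      rwa [show g * G2⁻¹ * S.t⁻¹ ^ L * (G2 * m) = g * m * S.t⁻¹ ^ L by field_simp] at this

lemma D_pow [CharP K p] (b y : K) : S.D (b ^ p * y) = b ^ p * S.D y := by
  rw [Derivation.leibniz, Derivation.leibniz_pow]
  simp

lemma exists_D_bdd [hp : Fact p.Prime] [CharP K p] : ∃ b : K, b ≠ 0 ∧ ∃ C : ℕ, ∀ L y, S.V L y →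
    S.V (L + C) (b ^ p * S.D y) := by
  obtain ⟨g1, hg1, h1⟩ := S.bD1
  obtain ⟨g2, hg2, h2⟩ := S.bD2
  obtain ⟨g, hg, hgO, hgg⟩ := S.exists_clear1 g1⁻¹
  -- g * D y ∈ O1
  have e1 : ∀ y ∈ S.O1, g * S.D y ∈ S.O1 := fun y hy => by
    have := mul_mem hgg (h1 y hy)
    rwa [show g * g1⁻¹ * (g1 * S.D y) = g * S.D y by field_simp] at this
  have e1' : ∀ y ∈ S.O1, g ^ p * S.D y ∈ S.O1 := fun y hy => by
    rw [← pow_sub_one_mul hp.out.ne_zero g, mul_assoc]; exact mul_mem (pow_mem hgO _) (e1 y hy)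
  obtain ⟨M, hM⟩ := S.bdd2 (g ^ p * g2⁻¹)
  obtain ⟨N, hN⟩ := S.bdd2 (g ^ p * S.t⁻¹ * S.D S.t)
  refine ⟨g, hg, M + N, fun L y hy => ⟨e1' y hy.1, ?_⟩⟩
  have ht := S.t_ne
  have key : g ^ p * S.D y * S.t⁻¹ ^ (L + (M + N)) =
      (g ^ p * g2⁻¹ * S.t⁻¹ ^ M) * S.t⁻¹ ^ N * (g2 * S.D (y * S.t⁻¹ ^ L)) +
      (L : K) * ((g ^ p * S.t⁻¹ * S.D S.t * S.t⁻¹ ^ N) * S.t⁻¹ ^ M * (y * S.t⁻¹ ^ L)) := by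
    have e : S.D y = S.D (y * S.t⁻¹ ^ L) * S.t ^ L + (y * S.t⁻¹ ^ L) * (L * S.t ^ L * S.t⁻¹ * S.D S.t) := by
      conv_lhs => rw [show y = (y * S.t⁻¹ ^ L) * S.t ^ L by
        rw [mul_assoc, ← mul_pow, inv_mul_cancel₀ ht, one_pow, mul_one]]
      rw [Derivation.leibniz, Derivation.leibniz_pow]
      rcases L with _ | L
      · simp
      · simp only [smul_eq_mul, nsmul_eq_mul, Nat.add_sub_cancel]
        rw [pow_succ S.t L]
        field_simp
        ring
    have hu : S.t ^ L * S.t⁻¹ ^ L = 1 := by rw [← mul_pow, mul_inv_cancel₀ ht, one_pow]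
    have hg : g2⁻¹ * g2 = 1 := inv_mul_cancel₀ hg2
    rw [e]
    generalize S.D (y * S.t⁻¹ ^ L) = d
    rw [pow_add, pow_add]
    linear_combination (g ^ p * S.t⁻¹ ^ M * S.t⁻¹ ^ N * (d + y * S.t⁻¹ ^ L * L * S.t⁻¹ * S.D S.t)) * hu
      - (g ^ p * S.t⁻¹ ^ M * S.t⁻¹ ^ N * d) * hg
  rw [key]
  refine add_mem (mul_mem (mul_mem hM (pow_mem S.tinv_mem _)) (h2 _ hy.2))
    (mul_mem (natCast_mem _ _) (mul_mem (mul_mem hN (pow_mem S.tinv_mem _)) hy.2))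

lemma D_iter_pow [CharP K p] (m : ℕ) (b y : K) : S.D^[m] (b ^ p * y) = b ^ p * S.D^[m] y := by
  induction m generalizing y with
  | zero => rfl
  | succ m ih => rw [Function.iterate_succ_apply, D_pow, ih, Function.iterate_succ_apply]

/-- power lemma -/
lemma power1 [hp : Fact p.Prime] [CharP K p] : ∃ C : ℕ, ∀ L L' : ℕ, ∀ μ X Z : K, μ ≠ 0 →
    S.V L (μ * X ^ p) → S.V L (μ * Z ^ p) → L + C ≤ p * L' →
    ∃ α : K, α ≠ 0 ∧ S.V L' (α * X) ∧ S.V L' (α * Z) := by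
  obtain ⟨b, hb, C, hC⟩ := S.exists_D_bdd
  have hit : ∀ m L y, S.V L y → S.V (L + m * C) ((b ^ m) ^ p * S.D^[m] y) := by
    intro m
    induction m with
    | zero => intro L y hy; simpa using hy
    | succ m ih =>
      intro L y hy
      have := hC _ _ (ih L y hy)
      rw [D_pow, ← mul_assoc, ← mul_pow, ← pow_succ', ← Function.iterate_succ_apply' (f := S.D)] at this
      rwa [show L + (m + 1) * C = L + m * C + C by ring]
  refine ⟨p * C, fun L L' μ X Z hμ hX hZ hL => ?_⟩
  obtain ⟨m, hm, α, hα, h⟩ := S.powD μ hμ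
  have key : ∀ X, S.V L (μ * X ^ p) → S.V L' (b ^ m * α * X) := by
    intro X hX
    apply V.of_pow hp.out.ne_zero
    have := hit m L _ hX
    rw [mul_comm μ, D_iter_pow, h] at this
    rw [show (b ^ m * α * X) ^ p = (b ^ m) ^ p * (X ^ p * α ^ p) by ring]
    refine V.mono (le_trans ?_ hL) this
    gcongr
  exact ⟨b ^ m * α, mul_ne_zero (pow_ne_zero _ hb) hα, key X hX, key Z hZ⟩

lemma power_k [hp : Fact p.Prime] [CharP K p] (k : ℕ) : ∃ C : ℕ, ∀ L L' : ℕ, ∀ μ X Z : K, μ ≠ 0 →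
    S.V L (μ * X ^ (p ^ k)) → S.V L (μ * Z ^ (p ^ k)) → L + C ≤ p ^ k * L' →
    ∃ α : K, α ≠ 0 ∧ S.V L' (α * X) ∧ S.V L' (α * Z) := by
  induction k with
  | zero =>
    refine ⟨0, fun L L' μ X Z hμ hX hZ hL => ⟨μ, hμ, ?_, ?_⟩⟩
    · exact V.mono (by simpa using hL) (by simpa using hX)
    · exact V.mono (by simpa using hL) (by simpa using hZ)
  | succ k ih =>
    obtain ⟨C, hC⟩ := ih
    obtain ⟨C1, hC1⟩ := S.power1
    refine ⟨C1 + p * C + p * p, fun L L' μ X Z hμ hX hZ hL => ?_⟩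
    rw [pow_succ, pow_mul] at hX hZ
    have hp0 := hp.out.pos
    obtain ⟨α, hα, h1, h2⟩ := hC1 L ((L + C1) / p + 1) μ _ _ hμ hX hZ (by
      have := Nat.div_add_mod (L + C1) p
      have := Nat.mod_lt (L + C1) hp0
      nlinarith)
    refine hC _ L' α X Z hα h1 h2 ?_
    rw [pow_succ] at hL
    have := Nat.div_mul_le_self (L + C1) p
    have h3 : ((L + C1) / p + 1 + C) * p ≤ (p ^ k * L') * p := by nlinarith [hp.out.two_le]
    exact Nat.le_of_mul_le_mul_right h3 hp0

end FFSetup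

end PartFA

section PartFB

/-- Abstract descent. -/
theorem descent_fg {G : Type*} [AddCommGroup G] (H : ℕ → G → Prop)
    (ex : ∀ P, ∃ L, H L P) (fin : ∀ L, {P | H L P}.Finite)
    (h2 : ∀ Q, ∃ C, ∀ L P, H L P → H (2 * L + C) (P + Q))
    (h3 : ∃ C, ∀ M N P, H M (P + P) → M + C ≤ 4 * N → H N P)
    (h4 : ∃ s : Finset G, ∀ P, ∃ Q ∈ s, ∃ P', P = P' + P' + Q) : AddGroup.FG G := by
  classical
  choose C2 hC2 using h2
  obtain ⟨C3, hC3⟩ := h3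
  obtain ⟨s, hs⟩ := h4
  set B := s.sup (fun Q => C2 (-Q)) + C3 + 10 with hB
  have hfin : (⋃ L ∈ Finset.range (B + 1), {P | H L P}).Finite :=
    Set.Finite.biUnion (Finset.finite_toSet _) (fun L _ => fin L)
  set T := s ∪ hfin.toFinset with hT
  rw [AddGroup.fg_def]
  refine ⟨T, ?_⟩
  rw [eq_top_iff]
  have key : ∀ L P, H L P → P ∈ AddSubgroup.closure (T : Set G) := by
    intro L
    induction L using Nat.strong_induction_on with
    | _ L ih =>
      intro P hP
      by_cases hL : L ≤ B
      · apply AddSubgroup.subset_closure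
        simp only [hT, Finset.coe_union, Set.Finite.coe_toFinset]
        right
        simp only [Set.mem_iUnion]
        exact ⟨L, Finset.mem_range.2 (by omega), hP⟩
      · obtain ⟨Q, hQ, P', hP'⟩ := hs P
        have h1 := hC2 (-Q) L P hP
        rw [hP', add_neg_cancel_right] at h1
        have hle : C2 (-Q) ≤ s.sup (fun Q => C2 (-Q)) := Finset.le_sup (f := fun Q => C2 (-Q)) hQ
        have h2 := hC3 _ (L - 1) P' h1 (by omega)
        have h3 := ih (L - 1) (by omega) P' h2
        rw [hP']
        refine add_mem (add_mem h3 h3) (AddSubgroup.subset_closure ?_)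
        simp [hT, hQ]
  intro P _
  obtain ⟨L, hL⟩ := ex P
  exact key L P hL

namespace FFSetup

open WeierstrassCurve.Affine

variable {K : Type*} [Field K] {p : ℕ} (S : FFSetup K p) {W : WeierstrassCurve K}

/-- Height of a point is at most `L`. -/
def HB (L : ℕ) : W.toAffine.Point → Prop
  | .zero => True
  | .some x _ _ => ∃ c : K, c ≠ 0 ∧ S.V L c ∧ S.V L (c * x)

variable {S}

lemma HB_zero (L : ℕ) : S.HB L (0 : W.toAffine.Point) := trivial

lemma HB.mono {L M : ℕ} (h : L ≤ M) {P : W.toAffine.Point} (hP : S.HB L P) : S.HB M P := by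
  rcases P with _ | ⟨x, y, hxy⟩
  · trivial
  · obtain ⟨c, hc, h1, h2⟩ := hP
    exact ⟨c, hc, h1.mono h, h2.mono h⟩

lemma HB_ex (P : W.toAffine.Point) : ∃ L, S.HB L P := by
  rcases P with _ | ⟨x, y, hxy⟩
  · exact ⟨0, trivial⟩
  · obtain ⟨γ, hγ, C, h1, h2⟩ := S.exists_clear {x}
    exact ⟨C, γ, hγ, h1, h2 x (by simp)⟩

lemma HB_fin (L : ℕ) : {P : W.toAffine.Point | S.HB L P}.Finite := by
  classical
  set F : Set K := {y | S.V L y} with hF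
  have hFf : F.Finite := S.fin L
  have hT : (insert ![1, 0] ((fun ab : K × K => ![ab.1 / ab.2, 1]) '' (F ×ˢ F))).Finite :=
    ((hFf.prod hFf).image _).insert _
  refine (hT.preimage' (f := fun P : W.toAffine.Point => P.xRep) ?_).subset ?_
  · intro b _
    by_cases hb : ∃ P : W.toAffine.Point, P.xRep = b
    · obtain ⟨P, rfl⟩ := hb
      refine (Set.toFinite {P, -P}).subset ?_
      intro Q hQ
      exact Point.eq_or_eq_neg_of_xRep_eq_xRep hQ
    · convert Set.finite_empty
      ext Q
      simp only [Set.mem_preimage, Set.mem_singleton_iff, Set.mem_empty_iff_false, iff_false]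
      exact fun h => hb ⟨Q, h⟩
  · intro P hP
    rcases P with _ | ⟨x, y, hxy⟩
    · left; rfl
    · right
      obtain ⟨c, hc, h1, h2⟩ := hP
      refine ⟨(c * x, c), ⟨h2, h1⟩, ?_⟩
      simp [hc]

/-- translation by a fixed point. -/
lemma HB_add [DecidableEq K] (Q : W.toAffine.Point) :
    ∃ C, ∀ L P, S.HB L P → S.HB (2 * L + C) (P + Q) := by
  rcases Q with _ | ⟨x0, y0, hQ⟩
  · exact ⟨0, fun L P h => by
      have e : P + Point.zero = P := add_zero P
      rw [e]; exact HB.mono (L := L) (by omega) h⟩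
  obtain ⟨C1, hC1⟩ := HB_ex (S := S) (Point.some x0 y0 hQ)
  obtain ⟨C2, hC2⟩ := HB_ex (S := S) (Point.some x0 y0 hQ + Point.some x0 y0 hQ)
  obtain ⟨γ, hγ, C, h1, h2⟩ := S.exists_clear {W.a₁, W.a₂, W.a₃, W.a₄, W.a₆, x0,
    W.a₄ - W.a₁ * y0 + 2 * x0 * W.a₂ + x0 ^ 2,
    W.a₆ + y0 ^ 2 + W.a₁ * x0 * y0 - W.a₂ * x0 ^ 2 - x0 ^ 3, 2 * y0 + W.a₁ * x0 + W.a₃}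
  refine ⟨C1 + C2 + 2 * C, fun L P hP => ?_⟩
  rcases P with _ | ⟨x, y, hxy⟩
  · change S.HB _ (0 + _)
    rw [zero_add]; exact hC1.mono (by omega)
  by_cases hx : x = x0
  · rcases (Point.X_eq_iff (h₁ := hxy) (h₂ := hQ)).1 hx with h | h
    · rw [h]; exact hC2.mono (by omega)
    · rw [h, neg_add_cancel]; trivial
  rw [Point.add_of_X_ne hx]
  obtain ⟨c, hc, hc1, hc2⟩ := hP
  have hx' : x - x0 ≠ 0 := sub_ne_zero.2 hx
  have eP := (W.toAffine.equation_iff x y).1 hxy.1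
  have eQ := (W.toAffine.equation_iff x0 y0).1 hQ.1
  have hs : S.V (2 * L + C) (γ * c ^ 2 * y) := by
    refine V.of_quad (e := γ * W.a₁ * ((c * x) * c) + γ * W.a₃ * (c * c))
      (f := γ * γ * (c * (c * x) ^ 3) + γ * (γ * W.a₂) * (c ^ 2 * (c * x) ^ 2) +
        γ * (γ * W.a₄) * (c ^ 3 * (c * x)) + γ * (γ * W.a₆) * (c ^ 4)) ?_ ?_ ?_
    · have a := ((h2 W.a₁ (by simp)).mul (hc2.mul hc1))
      have b := ((h2 W.a₃ (by simp)).mul (hc1.mul hc1))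
      exact V.mono (by omega) (a.add b)
    · refine V.mono (L := C + C + 4 * L) (by omega) ?_
      refine ((V.add ?_ ?_).add ?_).add ?_
      · exact V.mono (by omega) ((h1.mul h1).mul (hc1.mul (hc2.pow 3)))
      · exact V.mono (by omega) ((h1.mul (h2 W.a₂ (by simp))).mul ((hc1.pow 2).mul (hc2.pow 2)))
      · exact V.mono (by omega) ((h1.mul (h2 W.a₄ (by simp))).mul ((hc1.pow 3).mul hc2))
      · exact V.mono (by omega) ((h1.mul (h2 W.a₆ (by simp))).mul (hc1.pow 4))
    · linear_combination (γ ^ 2 * c ^ 4) * eP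
  refine ⟨γ ^ 2 * (c * x - x0 * c) ^ 2, ?_, ?_, ?_⟩
  · refine mul_ne_zero (pow_ne_zero _ hγ) (pow_ne_zero _ ?_)
    rw [show c * x - x0 * c = c * (x - x0) by ring]
    exact mul_ne_zero hc hx'
  · rw [show γ ^ 2 * (c * x - x0 * c) ^ 2 = (γ * (c * x) - γ * x0 * c) ^ 2 by ring]
    refine V.mono (L := 2 * (C + L)) (by omega) (V.pow ?_ 2)
    exact (h1.mul hc2).sub ((h2 x0 (by simp)).mul hc1)
  · have hsl : W.toAffine.slope x x0 y y0 = (y - y0) / (x - x0) := slope_of_X_ne hx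
    have e : γ ^ 2 * (c * x - x0 * c) ^ 2 *
        W.toAffine.addX x x0 (W.toAffine.slope x x0 y y0) =
        γ * (γ * x0 * (c * x) ^ 2 + γ * (W.a₄ - W.a₁ * y0 + 2 * x0 * W.a₂ + x0 ^ 2) * ((c * x) * c)
        + γ * (W.a₆ + y0 ^ 2 + W.a₁ * x0 * y0 - W.a₂ * x0 ^ 2 - x0 ^ 3) * (c * c))
        - γ * (2 * y0 + W.a₁ * x0 + W.a₃) * (γ * c ^ 2 * y) := by
      rw [hsl, addX]
      field_simp
      linear_combination eP
    rw [e]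
    refine V.sub (V.mono (L := C + (C + 2 * L)) (by omega) (h1.mul ((V.add ?_ ?_).add ?_))) ?_
    · exact V.mono (by omega) ((h2 x0 (by simp)).mul (hc2.pow 2))
    · exact V.mono (by omega) ((h2 _ (by simp)).mul (hc2.mul hc1))
    · exact V.mono (by omega) ((h2 _ (by simp)).mul (hc1.mul hc1))
    · exact V.mono (by omega) ((h2 _ (by simp)).mul hs)

lemma V_quartic {N C : ℕ} {γ X Z : K} (hX : S.V N X) (hZ : S.V N Z) (c : Fin 5 → K)
    (hc : ∀ i, S.V C (γ * c i)) : S.V (C + 4 * N) (γ * (c 0 * X ^ 4 + c 1 * (X ^ 3 * Z)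
      + c 2 * (X ^ 2 * Z ^ 2) + c 3 * (X * Z ^ 3) + c 4 * Z ^ 4)) := by
  simp only [mul_add, ← mul_assoc]
  simp only [mul_assoc γ _ _]
  refine (((V.add ?_ ?_).add ?_).add ?_).add ?_
  · rw [← mul_assoc]; exact V.mono (by omega) ((hc 0).mul (hX.pow 4))
  · rw [mul_assoc (c 1), ← mul_assoc]; exact V.mono (by omega) ((hc 1).mul ((hX.pow 3).mul hZ))
  · rw [mul_assoc (c 2), ← mul_assoc]
    exact V.mono (by omega) ((hc 2).mul ((hX.pow 2).mul (hZ.pow 2)))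
  · rw [mul_assoc (c 3), ← mul_assoc]; exact V.mono (by omega) ((hc 3).mul (hX.mul (hZ.pow 3)))
  · rw [← mul_assoc]; exact V.mono (by omega) ((hc 4).mul (hZ.pow 4))

end FFSetup

/-- numerator of duplication -/
def dupN {K : Type*} [Field K] (W : WeierstrassCurve K) (X Z : K) : K :=
  X ^ 4 - W.b₄ * X ^ 2 * Z ^ 2 - 2 * W.b₆ * X * Z ^ 3 - W.b₈ * Z ^ 4

/-- denominator of duplication -/
def dupD {K : Type*} [Field K] (W : WeierstrassCurve K) (X Z : K) : K :=
  4 * X ^ 3 * Z + W.b₂ * X ^ 2 * Z ^ 2 + 2 * W.b₄ * X * Z ^ 3 + W.b₆ * Z ^ 4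

lemma dup_bezout {K : Type*} [Field K] (W : WeierstrassCurve K) :
    ∃ c d e f : Fin 5 → K, ∀ X Z : K,
    W.Δ * X ^ 8 = (c 0 * X ^ 4 + c 1 * (X ^ 3 * Z)
      + c 2 * (X ^ 2 * Z ^ 2) + c 3 * (X * Z ^ 3) + c 4 * Z ^ 4) * dupN W X Z
      + (d 0 * X ^ 4 + d 1 * (X ^ 3 * Z)
      + d 2 * (X ^ 2 * Z ^ 2) + d 3 * (X * Z ^ 3) + d 4 * Z ^ 4) * dupD W X Z ∧
    W.Δ * Z ^ 8 = (e 0 * X ^ 4 + e 1 * (X ^ 3 * Z)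
      + e 2 * (X ^ 2 * Z ^ 2) + e 3 * (X * Z ^ 3) + e 4 * Z ^ 4) * dupN W X Z
      + (f 0 * X ^ 4 + f 1 * (X ^ 3 * Z)
      + f 2 * (X ^ 2 * Z ^ 2) + f 3 * (X * Z ^ 3) + f 4 * Z ^ 4) * dupD W X Z := by
  refine ⟨![-W.b₂ ^ 2 * W.b₈ + 9 * W.b₂ * W.b₄ * W.b₆ - 8 * W.b₄ ^ 3 - 27 * W.b₆ ^ 2,
    2 * (2 * W.b₂ * W.b₄ * W.b₈ - 2 * W.b₄ ^ 2 * W.b₆ - 10 * W.b₆ * W.b₈),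
    (-W.b₂ * W.b₆ * W.b₈ + W.b₄ * W.b₆ ^ 2) + 4 * (3 * W.b₄ ^ 2 * W.b₈ - 3 * W.b₄ * W.b₆ ^ 2),
    2 * (3 * W.b₄ * W.b₆ * W.b₈ - 3 * W.b₆ ^ 3), 0],
    ![-W.b₂ * W.b₄ * W.b₈ + W.b₄ ^ 2 * W.b₆ + 5 * W.b₆ * W.b₈,
    2 * (2 * W.b₂ * W.b₆ * W.b₈ - 2 * W.b₄ * W.b₆ ^ 2 - 10 * W.b₈ ^ 2),
    (-W.b₂ * W.b₈ ^ 2 + W.b₄ * W.b₆ * W.b₈) + 4 * (3 * W.b₄ * W.b₆ * W.b₈ - 3 * W.b₆ ^ 3),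
    2 * (3 * W.b₄ * W.b₈ ^ 2 - 3 * W.b₆ ^ 2 * W.b₈), 0],
    ![0, 0, -48, -8 * W.b₂, W.b₂ ^ 2 - 32 * W.b₄],
    ![0, 12, -W.b₂, -10 * W.b₄, W.b₂ * W.b₄ - 27 * W.b₆], fun X Z => ?_⟩
  have hb := W.b_relation
  simp only [Matrix.cons_val, dupN, dupD, WeierstrassCurve.Δ]
  constructor
  · grind only
  · grind only

namespace FFSetup

open WeierstrassCurve.Affine

variable {K : Type*} [Field K] {p : ℕ} {S : FFSetup K p} {W : WeierstrassCurve K}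

lemma dup_formula [DecidableEq K] (M : ℕ) (x y : K) (h : W.toAffine.Nonsingular x y)
    (hΔ : W.Δ ≠ 0)
    (hP : S.HB M (Point.some x y h + Point.some x y h)) :
    ∃ μ : K, μ ≠ 0 ∧ S.V M (μ * dupN W x 1) ∧ S.V M (μ * dupD W x 1) := by
  have e := (W.toAffine.equation_iff x y).1 h.1
  have hD : dupD W x 1 = (2 * y + W.a₁ * x + W.a₃) ^ 2 := by
    simp only [dupD, WeierstrassCurve.b₂, WeierstrassCurve.b₄, WeierstrassCurve.b₆]
    linear_combination (-4) * e
  by_cases hy : y = W.toAffine.negY x y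
  · have h0 : dupD W x 1 = 0 := by
      rw [hD, show 2 * y + W.a₁ * x + W.a₃ = y - W.toAffine.negY x y by rw [negY]; ring,
        ← hy]; ring
    have h1 : dupN W x 1 ≠ 0 := by
      intro h1
      obtain ⟨c, d, e, f, H⟩ := dup_bezout W
      have := (H x 1).2
      rw [h0, h1] at this
      simp at this
      exact hΔ this
    refine ⟨(dupN W x 1)⁻¹, inv_ne_zero h1, ?_, ?_⟩
    · rw [inv_mul_cancel₀ h1]; exact V.one _
    · rw [h0, mul_zero]; exact V.zero _
  · rw [Point.add_self_of_Y_ne hy] at hP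
    obtain ⟨c, hc, h1, h2⟩ := hP
    have hy0 : 2 * y + W.a₁ * x + W.a₃ ≠ 0 := by
      intro h0; apply hy; rw [negY]; linear_combination h0
    have hsl : W.toAffine.slope x x y y =
        (3 * x ^ 2 + 2 * W.a₂ * x + W.a₄ - W.a₁ * y) / (2 * y + W.a₁ * x + W.a₃) := by
      rw [slope_of_Y_ne rfl hy, negY]; congr 1; ring
    have hD0 : dupD W x 1 ≠ 0 := by rw [hD]; exact pow_ne_zero _ hy0
    refine ⟨c / dupD W x 1, div_ne_zero hc hD0, ?_, ?_⟩
    · convert h2 using 1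
      rw [div_mul_eq_mul_div, mul_div_assoc]
      congr 1
      rw [div_eq_iff hD0, hD, hsl, addX]
      obtain ⟨d, hd⟩ : ∃ d, d = 2 * y + W.a₁ * x + W.a₃ := ⟨_, rfl⟩
      rw [← hd] at hy0 ⊢
      field_simp
      clear hsl hD hD0 h1 h2
      simp only [dupN, WeierstrassCurve.b₂, WeierstrassCurve.b₄, WeierstrassCurve.b₆, WeierstrassCurve.b₈]
      grind only
    · rwa [div_mul_cancel₀ _ hD0]

lemma HB_dup [DecidableEq K] [hp : Fact p.Prime] [CharP K p] (hΔ : W.Δ ≠ 0) :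
    ∃ C, ∀ M N (P : W.toAffine.Point), S.HB M (P + P) → M + C ≤ 4 * N → S.HB N P := by
  obtain ⟨c, d, e, f, H⟩ := dup_bezout W
  obtain ⟨γ, hγ, C, h1, h2⟩ := S.exists_clear
    (Finset.univ.image c ∪ Finset.univ.image d ∪ Finset.univ.image e ∪ Finset.univ.image f)
  obtain ⟨C', hC'⟩ := S.power_k 3
  set m := p ^ 3 with hm
  have hm8 : 8 ≤ m := by
    have := Nat.pow_le_pow_left hp.out.two_le 3
    simpa using this
  refine ⟨C + C' + m, fun M N P hP hN => ?_⟩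
  rcases P with _ | ⟨x, y, hxy⟩
  · trivial
  obtain ⟨μ, hμ, hμN, hμD⟩ := dup_formula M x y hxy hΔ hP
  classical
  have hex := HB_ex (S := S) (Point.some x y hxy)
  by_contra hcon
  set N0 := Nat.find hex with hN0
  have hlt : N < N0 := by
    by_contra hle
    exact hcon ((Nat.find_spec hex).mono (not_lt.1 hle))
  obtain ⟨l, hl, hl1, hl2⟩ := Nat.find_spec hex
  rw [← hN0] at hl1 hl2
  have hhN : dupN W (l * x) l = l ^ 4 * dupN W x 1 := by simp only [dupN]; ring
  have hhD : dupD W (l * x) l = l ^ 4 * dupD W x 1 := by simp only [dupD]; ring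
  set ν := μ / l ^ 4 with hν
  have hν0 : ν ≠ 0 := div_ne_zero hμ (pow_ne_zero _ hl)
  have hνN : S.V M (ν * dupN W (l * x) l) := by
    rw [hhN, hν]; convert hμN using 1; field_simp
  have hνD : S.V M (ν * dupD W (l * x) l) := by
    rw [hhD, hν]; convert hμD using 1; field_simp
  obtain ⟨HX, HZ⟩ := H (l * x) l
  have q1 : S.V (C + 4 * N0 + M) (γ * ν * W.Δ * (l * x) ^ 8) := by
    have := ((V_quartic hl2 hl1 c (fun i => h2 _ (by simp))).mul hνN).add
      ((V_quartic hl2 hl1 d (fun i => h2 _ (by simp))).mul hνD)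
    convert this using 1
    linear_combination (γ * ν) * HX
  have q2 : S.V (C + 4 * N0 + M) (γ * ν * W.Δ * l ^ 8) := by
    have := ((V_quartic hl2 hl1 e (fun i => h2 _ (by simp))).mul hνN).add
      ((V_quartic hl2 hl1 f (fun i => h2 _ (by simp))).mul hνD)
    convert this using 1
    linear_combination (γ * ν) * HZ
  have ee : 4 * N0 + (m - 8) * N0 + 4 * N0 = m * N0 := by
    obtain ⟨k, hk⟩ := Nat.exists_eq_add_of_le hm8
    rw [hk, Nat.add_sub_cancel_left]; ring
  have hm1 : m * (N0 - 1) + m = m * N0 := by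
    obtain ⟨k, hk⟩ := Nat.exists_eq_succ_of_ne_zero (show N0 ≠ 0 by omega)
    rw [hk]; simp; ring
  obtain ⟨α, hα, r1, r2⟩ := hC' (C + 4 * N0 + M + (m - 8) * N0) (N0 - 1) (γ * ν * W.Δ) (l * x) l
    (mul_ne_zero (mul_ne_zero hγ hν0) hΔ)
    (by
      have := q1.mul (hl2.pow (m - 8))
      rwa [mul_assoc _ ((l * x) ^ 8), ← pow_add, Nat.add_sub_cancel' hm8] at this)
    (by
      have := q2.mul (hl1.pow (m - 8))
      rwa [mul_assoc _ (l ^ 8), ← pow_add, Nat.add_sub_cancel' hm8] at this)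
    (by omega)
  refine Nat.find_min hex (m := N0 - 1) (by omega) ⟨α * l, mul_ne_zero hα hl, r2, ?_⟩
  rwa [mul_assoc]

/-- weak Mordell–Weil implies Mordell–Weil -/
theorem fg_of_weak [DecidableEq K] [hp : Fact p.Prime] [CharP K p] (S : FFSetup K p) (hΔ : W.Δ ≠ 0)
    (h4 : ∃ s : Finset W.toAffine.Point, ∀ P, ∃ Q ∈ s, ∃ P', P = P' + P' + Q) :
    AddGroup.FG W.toAffine.Point :=
  descent_fg S.HB HB_ex HB_fin HB_add (HB_dup hΔ) h4

end FFSetup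

end PartFB

section PartFC

open IsDedekindDomain

/-- finitely many classes modulo squares -/
def FinCls {K : Type*} [Field K] (A : Set Kˣ) : Prop :=
  ∃ T : Set Kˣ, T.Finite ∧ ∀ a ∈ A, ∃ τ ∈ T, ∃ c : Kˣ, a = τ * c ^ 2

lemma FinCls.pigeon {K : Type*} [Field K] {ι : Type*} [Finite ι] {A B : Set Kˣ}
    (R : Kˣ → ι → Prop) (hR : ∀ a ∈ A, ∃ i, R a i)
    (h : ∀ a ∈ A, ∀ b ∈ A, ∀ i, R a i → R b i → a / b ∈ B) (hB : FinCls B) : FinCls A := by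
  classical
  obtain ⟨T, hT, hT'⟩ := hB
  have hrep : ∀ i, ∃ r : Kˣ, (∃ a ∈ A, R a i) → r ∈ A ∧ R r i := by
    intro i
    by_cases hi : ∃ a ∈ A, R a i
    · obtain ⟨a, ha⟩ := hi; exact ⟨a, fun _ => ha⟩
    · exact ⟨1, fun h => (hi h).elim⟩
  choose rep hrep using hrep
  refine ⟨Set.image2 (· * ·) T (Set.range rep), hT.image2 _ (Set.finite_range _), fun a ha => ?_⟩
  obtain ⟨i, hi⟩ := hR a ha
  obtain ⟨h1, h2⟩ := hrep i ⟨a, ha, hi⟩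
  obtain ⟨τ, hτ, c, hc⟩ := hT' _ (h a ha _ h1 i hi h2)
  refine ⟨τ * rep i, ⟨τ, hτ, _, ⟨i, rfl⟩, rfl⟩, c, ?_⟩
  rw [div_eq_iff_eq_mul] at hc
  rw [hc]; exact mul_right_comm _ _ _

lemma FinCls.mul_sq {K : Type*} [Field K] {A : Set Kˣ} (h : FinCls A) :
    FinCls {a | ∃ u ∈ A, ∃ c : Kˣ, a = u * c ^ 2} := by
  obtain ⟨T, hT, h⟩ := h
  refine ⟨T, hT, ?_⟩
  rintro _ ⟨u, hu, c, rfl⟩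
  obtain ⟨τ, hτ, d, rfl⟩ := h u hu
  exact ⟨τ, hτ, d * c, by rw [mul_pow, mul_assoc]⟩

/-- ideal square roots -/
lemma exists_sqrt_ideal {R : Type*} [CommRing R] [IsDedekindDomain R] {r : R} (hr : r ≠ 0)
    (h : ∀ v : HeightOneSpectrum R, ∃ n : ℤ, v.intValuation r = WithZero.exp n ^ 2) :
    ∃ J : Ideal R, J ^ 2 = Ideal.span {r} := by
  set I : Ideal R := Ideal.span {r} with hI
  have hI0 : I ≠ 0 := by rw [hI, Ne, Ideal.zero_eq_bot, Ideal.span_singleton_eq_bot]; exact hr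
  have hev : ∀ v : HeightOneSpectrum R, ∃ k : ℕ,
      (Associates.mk v.asIdeal).count (Associates.mk I).factors = k * 2 := by
    intro v
    obtain ⟨n, hn⟩ := h v
    rw [v.intValuation_if_neg hr, ← WithZero.exp_nsmul, WithZero.exp_inj] at hn
    simp only [nsmul_eq_mul] at hn
    rw [← hI] at hn
    push_cast at hn
    refine ⟨(-n).toNat, ?_⟩
    omega
  choose k hk using hev
  refine ⟨∏ᶠ v : HeightOneSpectrum R, v.asIdeal ^ (k v), ?_⟩
  rw [finprod_pow]
  · conv_rhs => rw [← Ideal.finprod_heightOneSpectrum_factorization hI0]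
    refine finprod_congr fun v => ?_
    rw [HeightOneSpectrum.maxPowDividing, hk v, pow_mul]
  · refine (Ideal.finite_factors hI0).subset ?_
    intro v hv
    by_contra hcon
    apply hv
    have h0 : (Associates.mk v.asIdeal).count (Associates.mk I).factors = 0 := by
      by_contra h0
      apply hcon
      exact (Associates.mk_le_mk_iff_dvd).1 ((Associates.le_of_count_ne_zero (by simpa using hI0)
        v.associates_irreducible h0))
    have : k v = 0 := by have := hk v; omega
    simp [this]

section ded

variable {K : Type*} [Field K] (R : Type*) [CommRing R] [IsDedekindDomain R] [Algebra R K]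
  [IsFractionRing R K]

/-- even valuation outside a set `T` -/
def EvenOut (T : Set (HeightOneSpectrum R)) : Set Kˣ :=
  {a | ∀ v ∉ T, ∃ n : ℤ, v.valuation K (a : K) = WithZero.exp n ^ 2}

lemma val_exp (v : HeightOneSpectrum R) (a : Kˣ) : ∃ n : ℤ, v.valuation K (a : K) = WithZero.exp n :=
  ⟨_, (v.valuationOfNeZero_eq a).symm⟩

variable {R}

lemma EvenOut.finCls_of_empty {T : Set (HeightOneSpectrum R)} (hT : T.Finite)
    (h : FinCls (EvenOut (K := K) R ∅)) : FinCls (EvenOut (K := K) R T) := by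
  classical
  have : Finite T := hT
  refine FinCls.pigeon (ι := T → Bool)
    (fun a f => ∀ v : T, ∃ n : ℤ, v.1.valuation K (a : K) =
      WithZero.exp n ^ 2 * (if f v then WithZero.exp 1 else 1)) ?_ ?_ h
  · intro a ha
    have : ∀ v : T, ∃ b : Bool, ∃ n : ℤ, v.1.valuation K (a : K) =
      WithZero.exp n ^ 2 * (if b then WithZero.exp 1 else 1) := by
      intro v
      obtain ⟨n, hn⟩ := val_exp R v.1 a
      rcases Int.even_or_odd' n with ⟨m, rfl | rfl⟩
      · refine ⟨false, m, ?_⟩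
        rw [hn, ← WithZero.exp_nsmul]; simp
      · refine ⟨true, m, ?_⟩
        rw [hn, ← WithZero.exp_nsmul, WithZero.exp_add]; simp
    choose f hf using this
    exact ⟨f, hf⟩
  · intro a ha b hb f hfa hfb v _
    have key : ∃ (n m : ℤ) (z : WithZero (Multiplicative ℤ)), z ≠ 0 ∧
        v.valuation K (a : K) = WithZero.exp n ^ 2 * z ∧
        v.valuation K (b : K) = WithZero.exp m ^ 2 * z := by
      by_cases hv : v ∈ T
      · obtain ⟨n, hn⟩ := hfa ⟨v, hv⟩
        obtain ⟨m, hm⟩ := hfb ⟨v, hv⟩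
        refine ⟨n, m, _, ?_, hn, hm⟩
        split_ifs <;> simp
      · obtain ⟨n, hn⟩ := ha v hv
        obtain ⟨m, hm⟩ := hb v hv
        exact ⟨n, m, 1, one_ne_zero, by simpa using hn, by simpa using hm⟩
    obtain ⟨n, m, z, hz, hn, hm⟩ := key
    refine ⟨n - m, ?_⟩
    rw [Units.val_div_eq_div_val, map_div₀, hn, hm, mul_div_mul_right _ _ hz, ← div_pow,
      WithZero.exp_sub]

lemma EvenOut.finCls_empty [Finite (ClassGroup R)]
    (h : FinCls (Set.range (Units.map (algebraMap R K : R →* K)))) :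
    FinCls (EvenOut (K := K) R ∅) := by
  refine FinCls.pigeon (ι := ClassGroup R)
    (fun a k => ∃ r d : R, ∃ J : nonZeroDivisors (Ideal R), r ≠ 0 ∧ d ≠ 0 ∧
      (a : K) * (algebraMap R K d) ^ 2 = algebraMap R K r ∧
      (J : Ideal R) ^ 2 = Ideal.span {r} ∧ ClassGroup.mk0 J = k) ?_ ?_ h.mul_sq
  · intro a ha
    obtain ⟨n, d, hd, hnd⟩ := IsFractionRing.div_surjective (A := R) (a : K)
    have hd0 : d ≠ 0 := nonZeroDivisors.ne_zero hd
    have hd' : algebraMap R K d ≠ 0 := by simpa using hd0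
    have hn' : algebraMap R K n ≠ 0 := by
      intro h0; rw [h0, zero_div] at hnd; exact a.ne_zero hnd.symm
    have hn0 : n ≠ 0 := by rintro rfl; simp at hn'
    have hr : (a : K) * (algebraMap R K d) ^ 2 = algebraMap R K (n * d) := by
      rw [← hnd, map_mul]; field_simp
    obtain ⟨J, hJ⟩ := exists_sqrt_ideal (r := n * d) (mul_ne_zero hn0 hd0) (by
      intro v
      obtain ⟨m, hm⟩ := ha v (by simp)
      obtain ⟨e, he⟩ := val_exp R v (Units.mk0 _ hd')
      refine ⟨m + e, ?_⟩
      rw [← v.valuation_of_algebraMap (K := K)]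
      change v.valuation K (algebraMap R K (n * d)) = _
      rw [← hr, map_mul, map_pow, hm]
      rw [Units.val_mk0] at he
      rw [he, WithZero.exp_add, mul_pow])
    have hJ0 : J ∈ nonZeroDivisors (Ideal R) := by
      rw [mem_nonZeroDivisors_iff_ne_zero]
      rintro rfl
      rw [zero_pow two_ne_zero, eq_comm, Ideal.zero_eq_bot, Ideal.span_singleton_eq_bot] at hJ
      exact mul_ne_zero hn0 hd0 hJ
    exact ⟨_, n * d, d, ⟨J, hJ0⟩, mul_ne_zero hn0 hd0, hd0, hr, hJ, rfl⟩
  · rintro a ha b hb k ⟨r, d, J, hr, hd, had, hJ, hk⟩ ⟨r', d', J', hr', hd', hbd, hJ', hk'⟩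
    rw [← hk', ClassGroup.mk0_eq_mk0_iff] at hk
    obtain ⟨x, y, hx, hy, hxy⟩ := hk
    have h2 : Ideal.span {x ^ 2 * r} = Ideal.span {y ^ 2 * r'} := by
      rw [← Ideal.span_singleton_mul_span_singleton, ← Ideal.span_singleton_mul_span_singleton,
        ← Ideal.span_singleton_pow, ← Ideal.span_singleton_pow, ← hJ, ← hJ', ← mul_pow, hxy, mul_pow]
    rw [Ideal.span_singleton_eq_span_singleton] at h2
    obtain ⟨u, hu⟩ := h2.symm
    have hinj := IsFractionRing.injective R K
    have hne : ∀ z : R, z ≠ 0 → algebraMap R K z ≠ 0 := fun z hz => by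
      rwa [Ne, map_eq_zero_iff _ hinj]
    refine ⟨_, ⟨u, rfl⟩, Units.mk0 _ (hne y hy) * Units.mk0 _ (hne d' hd') /
      (Units.mk0 _ (hne x hx) * Units.mk0 _ (hne d hd)), ?_⟩
    have hx' := hne x hx
    have hy' := hne y hy
    have hdd := hne d hd
    have hdd' := hne d' hd'
    have hu' := congrArg (algebraMap R K) hu
    simp only [map_mul, map_pow] at hu'
    rw [← had, ← hbd] at hu'
    ext
    simp only [Units.val_div_eq_div_val, Units.val_mul, Units.val_pow_eq_pow_val, Units.val_mk0,
      Units.coe_map, MonoidHom.coe_coe]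
    have hb0 := b.ne_zero
    field_simp
    linear_combination -hu'

end ded

end PartFC

section PartFC2

open IsDedekindDomain

namespace FFSetup

variable {K : Type*} [Field K] {p : ℕ} (S : FFSetup K p)

instance : IsDedekindDomain S.O1 := S.ded1
instance : IsDedekindDomain S.O2 := S.ded2
instance : IsFractionRing S.O1 K := S.frac1
instance : IsFractionRing S.O2 K := S.frac2
instance : Finite (ClassGroup S.O1) := S.cl

lemma fin_places2 : Finite (HeightOneSpectrum S.O2) := by
  have h0 : (Ideal.span {(⟨S.t⁻¹, S.tinv_mem⟩ : S.O2)}) ≠ 0 := by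
    rw [Ne, Ideal.zero_eq_bot, Ideal.span_singleton_eq_bot]
    intro h
    exact inv_ne_zero S.t_ne (congrArg Subtype.val h)
  have hf := Ideal.finite_factors h0
  rw [← Set.finite_univ_iff]
  refine hf.subset ?_
  intro v _
  by_contra hv
  have hv' : v.valuation K (S.t⁻¹) = 1 := by
    have : v.valuation K (algebraMap S.O2 K ⟨S.t⁻¹, S.tinv_mem⟩) = 1 := by
      refine le_antisymm (v.valuation_le_one _) (not_lt.1 fun h => hv ?_)
      exact (v.valuation_lt_one_iff_dvd _).1 h
    exact this
  obtain ⟨y, hy⟩ := v.valuation_surjective K (WithZero.exp 1)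
  obtain ⟨L, hL⟩ := S.bdd2 y
  have := v.valuation_le_one (K := K) (⟨_, hL⟩ : S.O2)
  change v.valuation K (y * S.t⁻¹ ^ L) ≤ 1 at this
  rw [map_mul, map_pow, hv', one_pow, mul_one, hy, ← WithZero.exp_zero, WithZero.exp_le_exp] at this
  omega

lemma units_fg : Module.Finite ℤ (Additive (S.O1)ˣ) := by
  have := S.fin_places2
  let f : Additive (S.O1)ˣ →+ (HeightOneSpectrum S.O2 → ℤ) :=
    AddMonoidHom.mk' (fun u v => Multiplicative.toAdd (v.valuationOfNeZero
      (Units.map (algebraMap S.O1 K : S.O1 →* K) u.toMul))) (by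
        intro a b; ext v; simp)
  let g := f.toIntLinearMap
  have hker : Finite (LinearMap.ker g) := by
    have hV : Finite {y : K | S.V 0 y} := S.fin 0
    refine Finite.of_injective (β := {y : K | S.V 0 y})
      (fun u => ⟨((u.1.toMul : S.O1) : K), ?_⟩) ?_
    · refine ⟨(u.1.toMul : S.O1).2, ?_⟩
      rw [pow_zero, mul_one]
      have h1 := u.2
      rw [LinearMap.mem_ker] at h1
      obtain ⟨y, hy⟩ := HeightOneSpectrum.mem_integers_of_valuation_le_one (R := S.O2) (K := K)
        ((u.1.toMul : S.O1) : K) (by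
        intro v
        have h2 := congrFun h1 v
        change Multiplicative.toAdd (v.valuationOfNeZero
          (Units.map (algebraMap S.O1 K : S.O1 →* K) u.1.toMul)) = 0 at h2
        have h3 := v.valuationOfNeZero_eq (Units.map (algebraMap S.O1 K : S.O1 →* K) u.1.toMul)
        rw [toAdd_eq_zero] at h2
        rw [h2] at h3
        exact h3.symm.le)
      rw [← hy]; exact y.2
    · intro a b hab
      have h1 := congrArg Subtype.val hab
      exact Subtype.ext (Units.ext (Subtype.ext h1))
  constructor
  refine Submodule.fg_of_fg_map_of_fg_inf_ker g ?_ ?_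
  · exact IsNoetherian.noetherian _
  · rw [top_inf_eq]
    exact Module.Finite.iff_fg.1 inferInstance

lemma finCls_units : FinCls (Set.range (Units.map (algebraMap S.O1 K : S.O1 →* K))) := by
  have hfg := S.units_fg
  let H : Submodule ℤ (Additive (S.O1)ˣ) := LinearMap.range (LinearMap.lsmul ℤ (Additive (S.O1)ˣ) 2)
  have hfin : Finite (Additive (S.O1)ˣ ⧸ H) := by
    apply Module.finite_of_fg_torsion
    intro x
    obtain ⟨x, rfl⟩ := Submodule.Quotient.mk_surjective _ x
    refine ⟨⟨2, by simp⟩, ?_⟩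
    change (2 : ℤ) • (Submodule.Quotient.mk x : Additive (S.O1)ˣ ⧸ H) = 0
    rw [← Submodule.Quotient.mk_smul, Submodule.Quotient.mk_eq_zero]
    exact ⟨x, rfl⟩
  refine FinCls.pigeon (ι := Additive (S.O1)ˣ ⧸ H) (B := {a | ∃ c : Kˣ, a = c ^ 2})
    (fun a i => ∃ u, a = Units.map (algebraMap S.O1 K : S.O1 →* K) u ∧
      Submodule.Quotient.mk (Additive.ofMul u) = i) ?_ ?_ ?_
  · rintro _ ⟨u, rfl⟩; exact ⟨_, u, rfl, rfl⟩
  · rintro _ - _ - i ⟨u, rfl, hu⟩ ⟨w, rfl, hw⟩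
    rw [← hw, Submodule.Quotient.eq] at hu
    obtain ⟨c, hc⟩ := hu
    refine ⟨Units.map (algebraMap S.O1 K : S.O1 →* K) c.toMul, ?_⟩
    rw [← map_div, ← map_pow]
    congr 1
    have := congrArg Additive.toMul hc
    simp only [LinearMap.lsmul_apply] at this
    rw [show u / w = Additive.toMul ((2 : ℤ) • c) from this.symm, toMul_zsmul]
    rfl
  · exact ⟨{1}, Set.finite_singleton _, by rintro _ ⟨c, rfl⟩; exact ⟨1, rfl, c, by simp⟩⟩

lemma finCls_even {T : Set (HeightOneSpectrum S.O1)} (hT : T.Finite) :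
    FinCls (EvenOut (K := K) S.O1 T) :=
  EvenOut.finCls_of_empty hT (EvenOut.finCls_empty S.finCls_units)

/-- The classes of `x - e₁`. -/
lemma finCls_x (S : FFSetup K p) (e₁ e₂ e₃ : K) (h12 : e₁ ≠ e₂) (h13 : e₁ ≠ e₃) :
    FinCls {a : Kˣ | ∃ x y : K, a = x - e₁ ∧ y ^ 2 = (x - e₁) * (x - e₂) * (x - e₃)
      ∧ y ≠ 0} := by
  set T : Set (HeightOneSpectrum S.O1) := HeightOneSpectrum.Support S.O1 e₁ ∪
    HeightOneSpectrum.Support S.O1 e₂ ∪ HeightOneSpectrum.Support S.O1 e₃ ∪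
    HeightOneSpectrum.Support S.O1 (e₁ - e₂)⁻¹ ∪ HeightOneSpectrum.Support S.O1 (e₁ - e₃)⁻¹ with hT
  have hTf : T.Finite := (((((HeightOneSpectrum.Support.finite _ _).union
    (HeightOneSpectrum.Support.finite _ _)).union (HeightOneSpectrum.Support.finite _ _)).union
    (HeightOneSpectrum.Support.finite _ _)).union (HeightOneSpectrum.Support.finite _ _))
  obtain ⟨T', hT', h⟩ := S.finCls_even hTf
  refine ⟨T', hT', fun a ha => h a ?_⟩
  obtain ⟨x, y, hax, hxy, hy0⟩ := ha
  intro v hv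
  simp only [hT, Set.mem_union, not_or] at hv
  obtain ⟨⟨⟨⟨v1, v2⟩, v3⟩, v4⟩, v5⟩ := hv
  replace v1 : v.valuation K e₁ ≤ 1 := not_lt.1 v1
  replace v2 : v.valuation K e₂ ≤ 1 := not_lt.1 v2
  replace v3 : v.valuation K e₃ ≤ 1 := not_lt.1 v3
  replace v4 : v.valuation K (e₁ - e₂)⁻¹ ≤ 1 := not_lt.1 v4
  replace v5 : v.valuation K (e₁ - e₃)⁻¹ ≤ 1 := not_lt.1 v5
  have unit : ∀ e e' : K, e ≠ e' → v.valuation K e ≤ 1 → v.valuation K e' ≤ 1 →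
      v.valuation K (e - e')⁻¹ ≤ 1 → v.valuation K (e - e') = 1 := by
    intro e e' hne h1 h2 h3
    refine le_antisymm (Valuation.map_sub_le _ h1 h2) ?_
    rw [map_inv₀, inv_le_one₀] at h3
    · exact h3
    · exact (Valuation.pos_iff _).2 (sub_ne_zero.2 hne)
  have u12 := unit e₁ e₂ h12 v1 v2 v4
  have u13 := unit e₁ e₃ h13 v1 v3 v5
  obtain ⟨m, hm⟩ := val_exp S.O1 v (Units.mk0 y hy0)
  rw [Units.val_mk0] at hm
  have hv := congrArg (v.valuation K) hxy
  simp only [map_mul, map_pow] at hv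
  rw [hax]
  rcases lt_or_ge 1 (v.valuation K x) with hx | hx
  · have hsub : ∀ e, v.valuation K e ≤ 1 → v.valuation K (x - e) = v.valuation K x := fun e he =>
      Valuation.map_sub_eq_of_lt_left _ (he.trans_lt hx)
    rw [hsub e₁ v1, hsub e₂ v2, hsub e₃ v3] at hv
    rw [hsub e₁ v1]
    have hx0 : x ≠ 0 := by rintro rfl; simp at hx
    obtain ⟨n, hn⟩ := val_exp S.O1 v (Units.mk0 x hx0)
    rw [Units.val_mk0] at hn
    refine ⟨m - n, ?_⟩
    rw [hm, hn] at hv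
    rw [hn, WithZero.exp_sub, div_pow, hv]
    field_simp
  · rcases (Valuation.map_sub_le _ hx v1).lt_or_eq with h | h
    · have e2 : v.valuation K (x - e₂) = 1 := by
        rw [show x - e₂ = (x - e₁) + (e₁ - e₂) by ring,
          Valuation.map_add_eq_of_lt_right _ (by rw [u12]; exact h), u12]
      have e3 : v.valuation K (x - e₃) = 1 := by
        rw [show x - e₃ = (x - e₁) + (e₁ - e₃) by ring,
          Valuation.map_add_eq_of_lt_right _ (by rw [u13]; exact h), u13]
      refine ⟨m, ?_⟩
      rw [e2, e3, mul_one, mul_one] at hv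
      rw [← hv, hm]
    · exact ⟨0, by rw [h]; simp⟩

end FFSetup

open WeierstrassCurve.Affine

/-- general pigeonhole -/
lemma weak_of_label {G : Type*} [AddCommGroup G] {ι : Type*} [Finite ι] (B : Set G) (hB : B.Finite)
    (R : G → ι → Prop) (hR : ∀ P, P ∉ B → ∃ i, R P i)
    (h : ∀ P Q i, R P i → R Q i → ∃ P', P - Q = P' + P') :
    ∃ s : Finset G, ∀ P, ∃ Q ∈ s, ∃ P', P = P' + P' + Q := by
  classical
  have hrep : ∀ i, ∃ r : G, (∃ a, R a i) → R r i := by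
    intro i
    by_cases hi : ∃ a, R a i
    · obtain ⟨a, ha⟩ := hi; exact ⟨a, fun _ => ha⟩
    · exact ⟨0, fun h => (hi h).elim⟩
  choose rep hrep using hrep
  refine ⟨hB.toFinset ∪ (Set.finite_range rep).toFinset, fun P => ?_⟩
  by_cases hP : P ∈ B
  · exact ⟨P, by simp [hP], 0, by simp⟩
  · obtain ⟨i, hi⟩ := hR P hP
    obtain ⟨P', hP'⟩ := h P (rep i) i hi (hrep i ⟨P, hi⟩)
    exact ⟨rep i, by simp, P', by rw [← hP', sub_add_cancel]⟩

section split

variable {K : Type*} [Field K] [DecidableEq K] {W : WeierstrassCurve K}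

lemma halve (hΔ : W.Δ ≠ 0) (h20 : (2 : K) ≠ 0) {e₁ e₂ e₃ : K} (h12 : e₁ ≠ e₂) (h13 : e₁ ≠ e₃)
    (h23 : e₂ ≠ e₃) (a1 : W.a₁ = 0) (a3 : W.a₃ = 0) (a2 : W.a₂ = -(e₁ + e₂ + e₃))
    (a4 : W.a₄ = e₁ * e₂ + e₁ * e₃ + e₂ * e₃) (a6 : W.a₆ = -(e₁ * e₂ * e₃))
    {x y r₁ r₂ r₃ : K} (h : W.toAffine.Nonsingular x y) (h1 : x - e₁ = r₁ ^ 2)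
    (h2 : x - e₂ = r₂ ^ 2) (h3 : x - e₃ = r₃ ^ 2) : ∃ Q, Point.some x y h = Q + Q := by
  have e := (W.toAffine.equation_iff x y).1 h.1
  have hy2 : y ^ 2 = (r₁ * r₂ * r₃) ^ 2 := by
    rw [mul_pow, mul_pow, ← h1, ← h2, ← h3]
    rw [a1, a3, a2, a4, a6] at e
    linear_combination e
  obtain ⟨s, hs1, hy⟩ : ∃ s : K, x - e₁ = s ^ 2 ∧ y = s * r₂ * r₃ := by
    rcases sq_eq_sq_iff_eq_or_eq_neg.1 hy2 with h | h
    · exact ⟨r₁, h1, h⟩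
    · exact ⟨-r₁, by rw [h1]; ring, by rw [h]; ring⟩
  clear hy2 h1
  obtain rfl : e₁ = x - s ^ 2 := by rw [← hs1]; ring
  obtain rfl : e₂ = x - r₂ ^ 2 := by rw [← h2]; ring
  obtain rfl : e₃ = x - r₃ ^ 2 := by rw [← h3]; ring
  have n12 : s + r₂ ≠ 0 := fun h0 => h12 (by linear_combination (r₂ - s) * h0)
  have n13 : s + r₃ ≠ 0 := fun h0 => h13 (by linear_combination (r₃ - s) * h0)
  have n23 : r₂ + r₃ ≠ 0 := fun h0 => h23 (by linear_combination (r₃ - r₂) * h0)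
  set X := x + s * r₂ + s * r₃ + r₂ * r₃ with hX
  set Y := (s + r₂) * (s + r₃) * (r₂ + r₃) with hY
  have hY0 : Y ≠ 0 := mul_ne_zero (mul_ne_zero n12 n13) n23
  have hQ : W.toAffine.Nonsingular X Y := by
    rw [← W.toAffine.equation_iff_nonsingular_of_Δ_ne_zero hΔ, equation_iff, a1, a2, a3, a4, a6]
    rw [hX, hY]; ring
  have hne : Y ≠ W.toAffine.negY X Y := by
    rw [negY, a1, a3]
    intro h0
    have : 2 * Y = 0 := by linear_combination h0
    exact (mul_ne_zero h20 hY0) this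
  have hsl : W.toAffine.slope X X Y Y = s + r₂ + r₃ := by
    rw [slope_of_Y_ne rfl hne, div_eq_iff (sub_ne_zero.2 hne), negY, a1, a2, a3, a4, hX, hY]
    ring
  refine ⟨Point.some X Y hQ, ?_⟩
  rw [Point.add_self_of_Y_ne hne]
  have ex : x = W.toAffine.addX X X (W.toAffine.slope X X Y Y) := by
    rw [hsl, addX, a1, a2, hX]; ring
  have ey : y = W.toAffine.addY X X Y (W.toAffine.slope X X Y Y) := by
    rw [addY, negAddY, ← ex, hsl, negY, a1, a3, hX, hY, hy]; ring
  rw [Point.some.injEq]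
  exact ⟨ex, ey⟩

theorem weak_split {p : ℕ} (S : FFSetup K p)
    (hΔ : W.Δ ≠ 0) (h20 : (2 : K) ≠ 0) {e₁ e₂ e₃ : K} (h12 : e₁ ≠ e₂) (h13 : e₁ ≠ e₃)
    (h23 : e₂ ≠ e₃) (a1 : W.a₁ = 0) (a3 : W.a₃ = 0) (a2 : W.a₂ = -(e₁ + e₂ + e₃))
    (a4 : W.a₄ = e₁ * e₂ + e₁ * e₃ + e₂ * e₃) (a6 : W.a₆ = -(e₁ * e₂ * e₃)) :
    ∃ s : Finset W.toAffine.Point, ∀ P, ∃ Q ∈ s, ∃ P', P = P' + P' + Q := by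
  obtain ⟨T1, hT1, H1⟩ := S.finCls_x e₁ e₂ e₃ h12 h13
  obtain ⟨T2, hT2, H2⟩ := S.finCls_x e₂ e₁ e₃ h12.symm h23
  obtain ⟨T3, hT3, H3⟩ := S.finCls_x e₃ e₁ e₂ h13.symm h23.symm
  have := hT1.to_subtype
  have := hT2.to_subtype
  have := hT3.to_subtype
  have heq : ∀ x y, W.toAffine.Nonsingular x y → y ^ 2 = (x - e₁) * (x - e₂) * (x - e₃) := by
    intro x y h
    have e := (W.toAffine.equation_iff x y).1 h.1
    rw [a1, a3, a2, a4, a6] at e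
    linear_combination e
  refine weak_of_label (ι := T1 × T2 × T3)
    ({P | ∃ x h, P = Point.some x 0 h} ∪ {0}) (Set.Finite.union ?_ (Set.finite_singleton _))
    (fun P i => ∃ x y h, P = Point.some x y h ∧ y ≠ 0 ∧
      (∃ c : Kˣ, x - e₁ = (i.1 : Kˣ) * c ^ 2) ∧ (∃ c : Kˣ, x - e₂ = (i.2.1 : Kˣ) * c ^ 2) ∧
      (∃ c : Kˣ, x - e₃ = (i.2.2 : Kˣ) * c ^ 2)) ?_ ?_
  · have : Set.Finite {P : W.toAffine.Point | ∃ x ∈ ({e₁, e₂, e₃} : Set K), ∃ h, P = Point.some x 0 h} := by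
      have := Set.Finite.biUnion (t := fun x => {P : W.toAffine.Point | ∃ h, P = Point.some x 0 h})
        (Set.toFinite ({e₁, e₂, e₃} : Set K)) (fun x _ => by
          refine Set.Subsingleton.finite ?_
          rintro _ ⟨h, rfl⟩ _ ⟨h', rfl⟩; rfl)
      refine this.subset ?_
      rintro P ⟨x, hx, h⟩
      exact Set.mem_biUnion hx h
    refine this.subset ?_
    rintro P ⟨x, h, rfl⟩
    refine ⟨x, ?_, h, rfl⟩
    have := heq x 0 h
    simp only [ne_eq, OfNat.ofNat_ne_zero, not_false_eq_true, zero_pow, zero_eq_mul, mul_eq_zero, sub_eq_zero] at this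
    simp only [Set.mem_insert_iff, Set.mem_singleton_iff]
    tauto
  · intro P hP
    rcases P with _ | ⟨x, y, h⟩
    · exact (hP (Or.inr rfl)).elim
    have hy : y ≠ 0 := by
      rintro rfl; exact hP (Or.inl ⟨x, h, rfl⟩)
    have e := heq x y h
    have hprod : (x - e₁) * (x - e₂) * (x - e₃) ≠ 0 := by rw [← e]; exact pow_ne_zero _ hy
    have n3 := right_ne_zero_of_mul hprod
    have n2 := right_ne_zero_of_mul (left_ne_zero_of_mul hprod)
    have n1 := left_ne_zero_of_mul (left_ne_zero_of_mul hprod)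
    obtain ⟨τ1, t1, c1, hc1⟩ := H1 (Units.mk0 _ n1) ⟨x, y, rfl, e, hy⟩
    obtain ⟨τ2, t2, c2, hc2⟩ := H2 (Units.mk0 _ n2) ⟨x, y, rfl, by rw [e]; ring, hy⟩
    obtain ⟨τ3, t3, c3, hc3⟩ := H3 (Units.mk0 _ n3) ⟨x, y, rfl, by rw [e]; ring, hy⟩
    refine ⟨⟨⟨τ1, t1⟩, ⟨τ2, t2⟩, ⟨τ3, t3⟩⟩, x, y, h, rfl, hy, ⟨c1, ?_⟩, ⟨c2, ?_⟩, ⟨c3, ?_⟩⟩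
    · simpa using congrArg Units.val hc1
    · simpa using congrArg Units.val hc2
    · simpa using congrArg Units.val hc3
  · rintro _ _ ⟨⟨τ1, t1⟩, ⟨τ2, t2⟩, ⟨τ3, t3⟩⟩ ⟨x, y, h, rfl, hy, ⟨c1, hc1⟩, ⟨c2, hc2⟩, ⟨c3, hc3⟩⟩
      ⟨x', y', h', rfl, hy', ⟨d1, hd1⟩, ⟨d2, hd2⟩, ⟨d3, hd3⟩⟩
    simp only at hc1 hc2 hc3 hd1 hd2 hd3
    by_cases hx : x = x'
    · rcases (Point.X_eq_iff (h₁ := h) (h₂ := h')).1 hx with h0 | h0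
      · exact ⟨0, by rw [h0]; simp⟩
      · exact ⟨-Point.some x' y' h', by rw [h0, sub_eq_add_neg]⟩
    · rw [sub_eq_add_neg, Point.neg_some, Point.add_of_X_ne hx]
      have key : ∀ e : K, (e = e₁ ∨ e = e₂ ∨ e = e₃) → ∀ τ c d : Kˣ, x - e = τ * c ^ 2 → x' - e = τ * d ^ 2 →
          ∃ r : K, W.toAffine.addX x x' (W.toAffine.slope x x' y (W.toAffine.negY x' y')) - e = r ^ 2 := by
        intro e he τ c d h1 h2
        have hxx : x - x' ≠ 0 := sub_ne_zero.2 hx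
        have hτ := τ.ne_zero
        have hc := c.ne_zero
        have hd := d.ne_zero
        have E := heq x y h
        have E' := heq x' y' h'
        have n1 : x - e ≠ 0 := by rw [h1]; exact mul_ne_zero hτ (pow_ne_zero _ hc)
        have n2 : x' - e ≠ 0 := by rw [h2]; exact mul_ne_zero hτ (pow_ne_zero _ hd)
        set l := (y + y') / (x - x') with hl
        have hsl : W.toAffine.slope x x' y (W.toAffine.negY x' y') = l := by
          rw [slope_of_X_ne hx, negY, a1, a3, hl]; congr 1; ring
        have hlx : l * (x - x') = y + y' := by rw [hl]; field_simp
        refine ⟨(l * (e - x) + y) / (τ * c * d), ?_⟩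
        have hm : (τ * c * d : K) ^ 2 = (x - e) * (x' - e) := by rw [h1, h2]; ring
        rw [hsl, div_pow, hm, eq_div_iff (mul_ne_zero n1 n2), addX, a1, a2]
        have hx3 : (x - x') ≠ 0 := hxx
        have : ∀ z : K, z * (x - x') = 0 → z = 0 := fun z hz =>
          (mul_eq_zero.1 hz).resolve_right hxx
        rw [← sub_eq_zero]
        apply this
        rcases he with rfl | rfl | rfl <;>
        linear_combination (-(e - x')) * E + (e - x) * E' + (e - x) * (l * (x - x') - y + y') * hlx
      obtain ⟨r1, hr1⟩ := key e₁ (Or.inl rfl) τ1 c1 d1 hc1 hd1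
      obtain ⟨r2, hr2⟩ := key e₂ (Or.inr (Or.inl rfl)) τ2 c2 d2 hc2 hd2
      obtain ⟨r3, hr3⟩ := key e₃ (Or.inr (Or.inr rfl)) τ3 c3 d3 hc3 hd3
      exact halve hΔ h20 h12 h13 h23 a1 a3 a2 a4 a6 _ hr1 hr2 hr3

end split

end PartFC2

section PartFD

open IsDedekindDomain WeierstrassCurve.Affine

section mlocal

variable {K : Type*} [Field K]

lemma val_D_le {O : Subring K} [IsDedekindDomain O] [IsFractionRing O K] (v : HeightOneSpectrum O)
    (D : Derivation ℤ K K) {g : K} (hg : ∀ y ∈ O, g * D y ∈ O) {y : K} (hy : v.valuation K y ≤ 1) :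
    v.valuation K (g * D y) ≤ 1 := by
  obtain ⟨n, ⟨s, hs⟩, e⟩ := v.exists_primeCompl_mul_eq_of_integer y hy
  have hint : ∀ z ∈ O, v.valuation K z ≤ 1 := fun z hz => v.valuation_le_one (K := K) (⟨z, hz⟩ : O)
  have hs1 : v.valuation K (s : K) = 1 := by
    have h1 := hint s s.2
    refine le_antisymm h1 (not_lt.1 fun h => hs ?_)
    exact Ideal.dvd_span_singleton.1 ((v.valuation_lt_one_iff_dvd (K := K) s).1 h)
  change y * (s : K) = n at e
  have e2 := congrArg D e
  rw [Derivation.leibniz] at e2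
  simp only [smul_eq_mul] at e2
  have e3 : s * (g * D y) = g * D n - y * (g * D s) := by linear_combination g * e2
  have : v.valuation K (s * (g * D y)) ≤ 1 := by
    rw [e3]
    refine Valuation.map_sub_le _ (hint _ (hg _ n.2)) ?_
    rw [map_mul]
    exact mul_le_one' hy (hint _ (hg _ s.2))
  rwa [map_mul, hs1, one_mul] at this

lemma m_local [CharP K 2] {O : Subring K} [IsDedekindDomain O] [IsFractionRing O K]
    (v : HeightOneSpectrum O)
    (D : Derivation ℤ K K) {g : K} (hg : ∀ y ∈ O, g * D y ∈ O) (W : WeierstrassCurve K)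
    (h1 : v.valuation K W.a₁ ≤ 1) (h2 : v.valuation K W.a₂ ≤ 1) (h3 : v.valuation K W.a₃ ≤ 1)
    (h4 : v.valuation K W.a₄ ≤ 1) (h6 : v.valuation K W.a₆ ≤ 1) {X Y m : K}
    (e : Y ^ 2 + W.a₁ * X * Y + W.a₃ * Y = X ^ 3 + W.a₂ * X ^ 2 + W.a₄ * X + W.a₆)
    (dX : D X = m * (W.a₁ * X + W.a₃)) (dY : D Y = m * (X ^ 2 + W.a₄ + W.a₁ * Y)) :
    v.valuation K (g * W.Δ * m) ≤ 1 := by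
  have t2 : (2 : K) = 0 := CharTwo.two_eq_zero
  have hmul : ∀ {a b : K}, v.valuation K a ≤ 1 → v.valuation K b ≤ 1 → v.valuation K (a * b) ≤ 1 :=
    fun ha hb => by rw [map_mul]; exact mul_le_one' ha hb
  have hadd : ∀ {a b : K}, v.valuation K a ≤ 1 → v.valuation K b ≤ 1 → v.valuation K (a + b) ≤ 1 :=
    fun ha hb => Valuation.map_add_le _ ha hb
  have hpow : ∀ {a : K} (n : ℕ), v.valuation K a ≤ 1 → v.valuation K (a ^ n) ≤ 1 :=
    fun n ha => by rw [map_pow]; exact pow_le_one' ha n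
  rcases le_or_gt (v.valuation K X) 1 with hX | hX
  · have hA : v.valuation K (W.a₁ * X + W.a₃) ≤ 1 := hadd (hmul h1 hX) h3
    have hY : v.valuation K Y ≤ 1 := by
      by_contra hY
      push Not at hY
      have hr : v.valuation K (X ^ 3 + W.a₂ * X ^ 2 + W.a₄ * X + W.a₆) ≤ 1 :=
        hadd (hadd (hadd (hpow 3 hX) (hmul h2 (hpow 2 hX))) (hmul h4 hX)) h6
      have : v.valuation K (Y * (Y + (W.a₁ * X + W.a₃))) ≤ 1 := by
        rw [← e] at hr; convert hr using 2; ring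
      rw [map_mul, Valuation.map_add_eq_of_lt_left _ (hA.trans_lt hY)] at this
      exact absurd this (not_le.2 (one_lt_mul'' hY hY))
    have hB : v.valuation K (X ^ 2 + W.a₄ + W.a₁ * Y) ≤ 1 := hadd (hadd (hpow 2 hX) h4) (hmul h1 hY)
    have k1 := val_D_le v D hg hX
    have k2 := val_D_le v D hg hY
    rw [dX] at k1
    rw [dY] at k2
    set A := W.a₁ * X + W.a₃ with hAd
    set B := X ^ 2 + W.a₄ + W.a₁ * Y with hBd
    have id : g * W.Δ * m = (g * (m * A)) * (W.a₁ ^ 4 * (W.a₁ * B + (W.a₂ + X) * A) + A ^ 3 + W.a₁ ^ 3 * A ^ 2)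
        + (g * (m * B)) * (W.a₁ ^ 4 * B) := by
      have hd : W.Δ = A * (W.a₁ ^ 4 * (W.a₁ * B + (W.a₂ + X) * A) + A ^ 3 + W.a₁ ^ 3 * A ^ 2)
        + B * (W.a₁ ^ 4 * B) := by
        have hc := W.variableChange_Δ ⟨1, X, 0, Y⟩
        simp only [inv_one, Units.val_one, one_pow, one_mul] at hc
        rw [← hc]
        simp only [WeierstrassCurve.Δ, WeierstrassCurve.b₂, WeierstrassCurve.b₄,
          WeierstrassCurve.b₆, WeierstrassCurve.b₈, WeierstrassCurve.variableChange_a₁,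
          WeierstrassCurve.variableChange_a₂, WeierstrassCurve.variableChange_a₃,
          WeierstrassCurve.variableChange_a₄, WeierstrassCurve.variableChange_a₆, inv_one,
          Units.val_one, one_pow, one_mul]
        have e0 : W.a₆ + X * W.a₄ + X ^ 2 * W.a₂ + X ^ 3 - Y * W.a₃ - Y ^ 2 - X * Y * W.a₁ = 0 := by
          linear_combination -e
        rw [e0]
        have q1 : W.a₃ + X * W.a₁ + 2 * Y = A := by rw [t2, hAd]; ring
        have q2 : W.a₄ - 0 * W.a₃ + 2 * X * W.a₂ - (Y + X * 0) * W.a₁ + 3 * X ^ 2 - 2 * 0 * Y = B := by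
          linear_combination (X * W.a₂ - W.a₁ * Y + X ^ 2) * t2
        rw [q1, q2, show W.a₂ - 0 * W.a₁ + 3 * X - 0 ^ 2 = W.a₂ + X by linear_combination X * t2]
        rw [show (4 : K) = 2 * 2 by norm_num, show (8 : K) = 2 * 4 by norm_num,
          show (27 : K) = 2 * 13 + 1 by norm_num, show (9 : K) = 2 * 4 + 1 by norm_num, t2]
        ring_nf
        linear_combination (-A ^ 4 - A ^ 2 * W.a₁ ^ 4 * X - A ^ 2 * W.a₁ ^ 4 * W.a₂) * t2
      rw [hd]; ring
    rw [id]
    refine hadd (hmul k1 ?_) (hmul k2 (hmul (hpow 4 h1) hB))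
    exact hadd (hadd (hmul (hpow 4 h1) (hadd (hmul h1 hB) (hmul (hadd h2 hX) hA))) (hpow 3 hA))
      (hmul (hpow 3 h1) (hpow 2 hA))
  · have hX0 : X ≠ 0 := by rintro rfl; simp at hX
    set ξ := v.valuation K X with hξ
    set η := v.valuation K Y with hη
    have l1 : 1 < ξ ^ 2 := one_lt_pow₀ hX two_ne_zero
    have l3 : ξ ^ 2 < ξ ^ 3 := pow_lt_pow_right₀ hX (by norm_num)
    have l4 : ξ ≤ ξ ^ 2 := le_self_pow₀ hX.le two_ne_zero
    have hle : ∀ {a b : K}, v.valuation K a ≤ 1 → v.valuation K (a * b) ≤ v.valuation K b := by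
      intro a b ha; rw [map_mul]; exact mul_le_of_le_one_left' ha
    have hR : v.valuation K (X ^ 3 + W.a₂ * X ^ 2 + W.a₄ * X + W.a₆) = ξ ^ 3 := by
      rw [add_assoc, add_assoc, Valuation.map_add_eq_of_lt_left, map_pow]
      rw [map_pow]
      refine lt_of_le_of_lt ?_ l3
      refine Valuation.map_add_le _ ?_ (Valuation.map_add_le _ ?_ ?_)
      · exact (hle h2).trans (map_pow _ _ _).le
      · exact (hle h4).trans l4
      · exact h6.trans l1.le
    have hXY : ξ < η := by
      by_contra hcon
      push Not at hcon
      have : v.valuation K (Y ^ 2 + W.a₁ * X * Y + W.a₃ * Y) ≤ ξ ^ 2 := by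
        refine Valuation.map_add_le _ (Valuation.map_add_le _ ?_ ?_) ?_
        · rw [map_pow]; exact pow_le_pow_left' hcon 2
        · rw [mul_assoc]
          refine (hle h1).trans ?_
          rw [map_mul, sq]; exact mul_le_mul_right hcon _
        · exact ((hle h3).trans hcon).trans l4
      rw [e, hR] at this
      exact absurd this (not_le.2 l3)
    have hη1 : 1 < η := hX.trans hXY
    have hη0 : 0 < η := zero_lt_one.trans hη1
    have hL : v.valuation K (Y ^ 2 + W.a₁ * X * Y + W.a₃ * Y) = η ^ 2 := by
      rw [add_assoc, Valuation.map_add_eq_of_lt_left, map_pow]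
      rw [map_pow]
      refine Valuation.map_add_lt _ ?_ ?_
      · rw [mul_assoc]
        refine (hle h1).trans_lt ?_
        rw [map_mul, sq]; exact mul_lt_mul_of_pos_right hXY hη0
      · refine (hle h3).trans_lt ?_
        exact lt_self_pow₀ hη1 (by norm_num)
    have hηξ : η ^ 2 = ξ ^ 3 := by rw [← hL, e, hR]
    have hY0 : Y ≠ 0 := by rintro rfl; simp [hη] at hη0
    have hw : v.valuation K (X / Y) ≤ 1 := by
      rw [map_div₀]; exact (div_le_one₀ hη0).2 hXY.le
    have k := val_D_le v D hg hw
    have hDw : D (X / Y) * Y ^ 2 = m * (X ^ 3 + (W.a₃ * Y + W.a₄ * X)) := by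
      have h := congrArg D (show (X / Y) * Y = X by field_simp)
      rw [Derivation.leibniz, dX, dY] at h
      simp only [smul_eq_mul] at h
      have h' : Y * (X / Y) = X := by field_simp
      linear_combination Y * h - (m * (X ^ 2 + W.a₄ + W.a₁ * Y)) * h' - (m * X * (X ^ 2 + W.a₄)) * t2
    have hv : v.valuation K (X ^ 3 + (W.a₃ * Y + W.a₄ * X)) = ξ ^ 3 := by
      rw [Valuation.map_add_eq_of_lt_left, map_pow]
      rw [map_pow]
      refine Valuation.map_add_lt _ ((hle h3).trans_lt ?_) ((hle h4).trans_lt (l4.trans_lt l3))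
      change η < ξ ^ 3
      rw [← hηξ]
      exact lt_self_pow₀ hη1 (by norm_num)
    have hDw2 := congrArg (v.valuation K) hDw
    rw [map_mul, map_mul, hv, map_pow, ← hη, hηξ] at hDw2
    have hξ3 : ξ ^ 3 ≠ 0 := (zero_lt_one.trans (l1.trans l3)).ne'
    have hDw3 := mul_right_cancel₀ hξ3 hDw2
    rw [map_mul, hDw3, ← map_mul] at k
    have hΔ : v.valuation K W.Δ ≤ 1 := by
      have hd : W.Δ = W.a₁ ^ 4 * (W.a₁ ^ 2 * W.a₆ + W.a₁ * W.a₃ * W.a₄ + W.a₂ * W.a₃ ^ 2 + W.a₄ ^ 2)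
          + (W.a₃ ^ 4 + W.a₁ ^ 3 * W.a₃ ^ 3) := by
        simp only [WeierstrassCurve.Δ, WeierstrassCurve.b₂, WeierstrassCurve.b₄,
          WeierstrassCurve.b₆, WeierstrassCurve.b₈]
        rw [show (4 : K) = 2 * 2 by norm_num, show (8 : K) = 2 * 4 by norm_num,
          show (27 : K) = 2 * 13 + 1 by norm_num, show (9 : K) = 2 * 4 + 1 by norm_num, t2]
        linear_combination (-(W.a₁ ^ 4 * (W.a₁ ^ 2 * W.a₆ + W.a₂ * W.a₃ ^ 2)) - W.a₃ ^ 4) * t2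
      rw [hd]
      exact hadd (hmul (hpow 4 h1) (hadd (hadd (hadd (hmul (hpow 2 h1) h6) (hmul (hmul h1 h3) h4))
        (hmul h2 (hpow 2 h3))) (hpow 2 h4))) (hadd (hpow 4 h3) (hmul (hpow 3 h1) (hpow 3 h3)))
    rw [show g * W.Δ * m = W.Δ * (g * m) by ring]
    exact hmul hΔ k

end mlocal

end PartFD

section PartFD2

open IsDedekindDomain WeierstrassCurve.Affine

section mglobal

variable {K : Type*} [Field K]

lemma D_sq_mul [CharP K 2] (D : Derivation ℤ K K) (b y : K) : D (b ^ 2 * y) = b ^ 2 * D y := by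
  have t2 : (2 : K) = 0 := CharTwo.two_eq_zero
  rw [Derivation.leibniz, Derivation.leibniz_pow]
  simp [t2]

lemma m_bdd [CharP K 2] {O : Subring K} [IsDedekindDomain O] [IsFractionRing O K]
    (D : Derivation ℤ K K) {g : K} (hg0 : g ≠ 0) (hg : ∀ y ∈ O, g * D y ∈ O) (W : WeierstrassCurve K)
    (hΔ : W.Δ ≠ 0) : ∃ G : K, G ≠ 0 ∧ ∀ X Y m : K,
      Y ^ 2 + W.a₁ * X * Y + W.a₃ * Y = X ^ 3 + W.a₂ * X ^ 2 + W.a₄ * X + W.a₆ →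
      D X = m * (W.a₁ * X + W.a₃) → D Y = m * (X ^ 2 + W.a₄ + W.a₁ * Y) → G * m ∈ O := by
  classical
  obtain ⟨b, hb⟩ := IsLocalization.exist_integer_multiples_of_finset (nonZeroDivisors O)
    ({W.a₁, W.a₂, W.a₃, W.a₄, W.a₆} : Finset K)
  have hb0 : ((b : O) : K) ≠ 0 := by simpa using nonZeroDivisors.ne_zero b.2
  have hbO : ((b : O) : K) ∈ O := (b : O).2
  have hba : ∀ a ∈ ({W.a₁, W.a₂, W.a₃, W.a₄, W.a₆} : Finset K), ((b : O) : K) * a ∈ O := by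
    intro a ha
    obtain ⟨c, hc⟩ := hb a ha
    have : (c : K) = ((b : O) : K) * a := hc
    rw [← this]; exact c.2
  generalize ((b : O) : K) = h at hb0 hbO hba
  simp only [Finset.mem_insert, Finset.mem_singleton, forall_eq_or_imp, forall_eq] at hba
  obtain ⟨b1, b2, b3, b4, b6⟩ := hba
  let W' : WeierstrassCurve K := ⟨h ^ 2 * W.a₁, h ^ 4 * W.a₂, h ^ 6 * W.a₃, h ^ 8 * W.a₄, h ^ 12 * W.a₆⟩
  have hO : ∀ {a : K} (n : ℕ), h * a ∈ O → h ^ (n + 1) * a ∈ O := fun n ha => by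
    rw [pow_succ, mul_assoc]; exact mul_mem (pow_mem hbO n) ha
  have hd : W'.Δ = h ^ 24 * W.Δ := by
    simp only [WeierstrassCurve.Δ, WeierstrassCurve.b₂, WeierstrassCurve.b₄,
          WeierstrassCurve.b₆, WeierstrassCurve.b₈, W']
    ring
  refine ⟨g * W.Δ * h ^ 22, mul_ne_zero (mul_ne_zero hg0 hΔ) (pow_ne_zero _ hb0), fun X Y m e dX dY => ?_⟩
  obtain ⟨y, hy⟩ := HeightOneSpectrum.mem_integers_of_valuation_le_one (R := O) (K := K)
    (g * W.Δ * h ^ 22 * m) (fun v => by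
      have hv : ∀ z ∈ O, v.valuation K z ≤ 1 := fun z hz => v.valuation_le_one (K := K) (⟨z, hz⟩ : O)
      have := m_local v D hg W' (hv _ (hO 1 b1)) (hv _ (hO 3 b2)) (hv _ (hO 5 b3)) (hv _ (hO 7 b4))
        (hv _ (hO 11 b6)) (X := h ^ 4 * X) (Y := h ^ 6 * Y) (m := m / h ^ 2)
        (by simp only [W']; linear_combination h ^ 12 * e)
        (by
          rw [show h ^ 4 * X = (h ^ 2) ^ 2 * X by ring, D_sq_mul, dX]
          simp only [W']; field_simp)
        (by
          rw [show h ^ 6 * Y = (h ^ 3) ^ 2 * Y by ring, D_sq_mul, dY]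
          simp only [W']; field_simp)
      rw [hd] at this
      convert this using 2
      field_simp)
  rw [← hy]; exact y.2

end mglobal

/-- `H` has finite index. -/
def FinIdx {G : Type*} [AddCommGroup G] (H : Set G) : Prop :=
  ∃ s : Finset G, ∀ P, ∃ Q ∈ s, P - Q ∈ H

lemma FinIdx.of_label {G : Type*} [AddCommGroup G] {H : Set G} {ι : Type*} [Finite ι]
    (R : G → ι → Prop) (hR : ∀ P, ∃ i, R P i) (h : ∀ P Q i, R P i → R Q i → P - Q ∈ H) :
    FinIdx H := by
  classical
  have hrep : ∀ i, ∃ r : G, (∃ a, R a i) → R r i := by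
    intro i
    by_cases hi : ∃ a, R a i
    · obtain ⟨a, ha⟩ := hi; exact ⟨a, fun _ => ha⟩
    · exact ⟨0, fun h => (hi h).elim⟩
  choose rep hrep using hrep
  have := Fintype.ofFinite ι
  refine ⟨Finset.univ.image rep, fun P => ?_⟩
  obtain ⟨i, hi⟩ := hR P
  exact ⟨rep i, by simp, h P (rep i) i hi (hrep i ⟨P, hi⟩)⟩

lemma FinIdx.map {G G' : Type*} [AddCommGroup G] [AddCommGroup G'] {H : Set G} {H' : Set G'}
    (f : G →+ G') (hf : FinIdx (Set.range f)) (hH : FinIdx H) (h : ∀ x ∈ H, f x ∈ H') :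
    FinIdx H' := by
  classical
  obtain ⟨s, hs⟩ := hf
  obtain ⟨s', hs'⟩ := hH
  refine ⟨(s ×ˢ s').image fun q => q.1 + f q.2, fun P => ?_⟩
  obtain ⟨Q, hQ, x, hx⟩ := hs P
  obtain ⟨Q', hQ', hx'⟩ := hs' x
  refine ⟨Q + f Q', Finset.mem_image.2 ⟨(Q, Q'), by simp [hQ, hQ'], rfl⟩, ?_⟩
  have := h _ hx'
  rwa [map_sub, hx, sub_sub] at this

section mgroup

variable {K : Type*} [Field K] [DecidableEq K] {W : WeierstrassCurve K}

/-- `m` is the value of the invariant differential at `D`. -/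
def Mrel (D : Derivation ℤ K K) : W.toAffine.Point → K → Prop
  | .zero, m => m = 0
  | .some X Y _, m => D X = m * (W.a₁ * X + W.a₃) ∧ D Y = m * (X ^ 2 + W.a₄ + W.a₁ * Y)

lemma Mrel_exists [CharP K 2] (D : Derivation ℤ K K) (d1 : D W.a₁ = 0) (d2 : D W.a₂ = 0)
    (d3 : D W.a₃ = 0) (d4 : D W.a₄ = 0) (d6 : D W.a₆ = 0) (P : W.toAffine.Point) :
    ∃ m, Mrel D P m := by
  have t2 : (2 : K) = 0 := CharTwo.two_eq_zero
  rcases P with _ | ⟨X, Y, h⟩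
  · exact ⟨0, rfl⟩
  have e := (W.toAffine.equation_iff X Y).1 h.1
  have hn := ((W.toAffine.nonsingular_iff X Y).1 h).2
  have de := congrArg D e
  simp only [map_add, Derivation.leibniz, Derivation.leibniz_pow, d1, d2, d3, d4, d6, smul_eq_mul,
    nsmul_eq_mul, mul_zero, add_zero, Nat.cast_ofNat, Nat.add_one_sub_one, pow_one] at de
  have key : (W.a₁ * X + W.a₃) * D Y = (X ^ 2 + W.a₄ + W.a₁ * Y) * D X := by
    linear_combination de + (-Y * D Y + X ^ 2 * D X + W.a₂ * X * D X - W.a₁ * Y * D X) * t2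
  by_cases hA : W.a₁ * X + W.a₃ = 0
  · have hB : X ^ 2 + W.a₄ + W.a₁ * Y ≠ 0 := by
      intro hB
      rcases hn with hn | hn
      · apply hn; linear_combination hB + (-2 * X ^ 2 - W.a₂ * X - W.a₄) * t2
      · apply hn; linear_combination -hA + (Y + W.a₁ * X + W.a₃) * t2
    refine ⟨D Y / (X ^ 2 + W.a₄ + W.a₁ * Y), ?_, ?_⟩
    · rw [hA, mul_zero]
      rw [hA, zero_mul] at key
      rcases mul_eq_zero.1 key.symm with h | h
      · exact (hB h).elim
      · exact h
    · field_simp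
  · refine ⟨D X / (W.a₁ * X + W.a₃), ?_, ?_⟩
    · field_simp
    · field_simp
      linear_combination key

lemma Mrel_neg [CharP K 2] (D : Derivation ℤ K K) (d1 : D W.a₁ = 0)
    (d3 : D W.a₃ = 0) {P : W.toAffine.Point} {m : K} (h : Mrel D P m) : Mrel D (-P) m := by
  have t2 : (2 : K) = 0 := CharTwo.two_eq_zero
  rcases P with _ | ⟨X, Y, hP⟩
  · exact h
  obtain ⟨h1, h2⟩ := h
  rw [WeierstrassCurve.Affine.Point.neg_some]
  refine ⟨h1, ?_⟩
  simp only [negY, map_sub, map_neg, Derivation.leibniz, d1, d3, h1, h2, smul_eq_mul, mul_zero, sub_zero, add_zero]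
  linear_combination (-m * (X ^ 2 + W.a₄)) * t2

lemma Mrel_add [CharP K 2] (D : Derivation ℤ K K) (d1 : D W.a₁ = 0) (d2 : D W.a₂ = 0)
    (d3 : D W.a₃ = 0) (d4 : D W.a₄ = 0) {P Q : W.toAffine.Point} {m : K}
    (hP : Mrel D P m) (hQ : Mrel D Q m) : Mrel D (P + Q) 0 := by
  have t2 : (2 : K) = 0 := CharTwo.two_eq_zero
  rcases P with _ | ⟨X₁, Y₁, h₁⟩
  · obtain rfl : m = 0 := hP
    rwa [show (Point.zero : W.toAffine.Point) = 0 from rfl, zero_add]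
  rcases Q with _ | ⟨X₂, Y₂, h₂⟩
  · obtain rfl : m = 0 := hQ
    rwa [show (Point.zero : W.toAffine.Point) = 0 from rfl, add_zero]
  by_cases hxy : X₁ = X₂ ∧ Y₁ = W.toAffine.negY X₂ Y₂
  · rw [Point.add_of_Y_eq hxy.1 hxy.2]; exact rfl
  have e1 := (W.toAffine.equation_iff X₁ Y₁).1 h₁.1
  have e2 := (W.toAffine.equation_iff X₂ Y₂).1 h₂.1
  obtain ⟨dX1, dY1⟩ := hP
  obtain ⟨dX2, dY2⟩ := hQ
  rw [Point.add_some hxy]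
  set l := W.toAffine.slope X₁ X₂ Y₁ Y₂ with hl
  have d12 : ∀ a b : K, D a = 0 → D (a * b) = a * D b := fun a b h => by
    rw [Derivation.leibniz, h]; simp
  have hDX : ∀ x1 x2, D (W.toAffine.addX x1 x2 l) = W.a₁ * D l - D x1 - D x2 := by
    intro x1 x2
    simp only [addX, map_sub, map_add, d12 _ _ d1, d2, Derivation.leibniz_pow, smul_eq_mul,
      nsmul_eq_mul]
    push_cast
    linear_combination (l * D l) * t2
  have hDY : ∀ x1 x2 y1, D (W.toAffine.addX x1 x2 l) = 0 → D (W.toAffine.addY x1 x2 y1 l) =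
      - ((W.toAffine.addX x1 x2 l - x1) * D l - l * D x1 + D y1) := by
    intro x1 x2 y1 h
    simp only [addY, negY, negAddY, map_sub, map_add, map_neg, d12 _ _ d1, d3, h,
      Derivation.leibniz, smul_eq_mul]
    ring
  by_cases hX : X₁ = X₂
  · subst hX
    have hY' : Y₁ ≠ W.toAffine.negY X₁ Y₂ := fun h => hxy ⟨rfl, h⟩
    obtain rfl : Y₁ = Y₂ := WeierstrassCurve.Affine.Y_eq_of_Y_ne h₁.1 h₂.1 rfl hY'
    rw [slope_of_Y_ne rfl hY', eq_div_iff (sub_ne_zero.2 hY')] at hl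
    have hA : W.a₁ * X₁ + W.a₃ ≠ 0 := by
      intro h
      apply hY'
      simp only [negY]
      linear_combination Y₁ * t2 + h
    have hl2 : l * (W.a₁ * X₁ + W.a₃) = X₁ ^ 2 + W.a₄ + W.a₁ * Y₁ := by
      simp only [negY] at hl
      linear_combination hl + (- l * Y₁ + X₁ ^ 2 + W.a₂ * X₁ - W.a₁ * Y₁) * t2
    have hDl : D l = 0 := by
      have := congrArg D hl2
      rw [Derivation.leibniz] at this
      simp only [map_add, d12 _ _ d1, d3, d4, Derivation.leibniz_pow, smul_eq_mul,
        nsmul_eq_mul, dX1, dY1] at this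
      push_cast at this
      have h0 : (W.a₁ * X₁ + W.a₃) * D l = 0 := by
        linear_combination this - W.a₁ * m * hl2 + (X₁ ^ (2 - 1) * (m * (W.a₁ * X₁ + W.a₃))) * t2
      exact (mul_eq_zero.1 h0).resolve_left hA
    have hx0 : D (W.toAffine.addX X₁ X₁ l) = 0 := by
      rw [hDX, hDl]; linear_combination (-D X₁) * t2
    refine ⟨by rw [hx0]; ring, ?_⟩
    rw [hDY _ _ _ hx0, hDl, dX1, dY1]
    linear_combination m * hl2
  · rw [slope_of_X_ne hX, eq_div_iff (sub_ne_zero.2 hX)] at hl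
    have hX' : X₁ - X₂ ≠ 0 := sub_ne_zero.2 hX
    have star : l * (Y₁ + Y₂) + W.a₁ * (Y₁ + X₂ * l) + W.a₃ * l
        - (X₁ ^ 2 + X₁ * X₂ + X₂ ^ 2 + W.a₂ * (X₁ + X₂) + W.a₄) = 0 := by
      refine (mul_eq_zero.1 (?_ : (X₁ - X₂) * _ = 0)).resolve_left hX'
      linear_combination e1 - e2 + (Y₁ + Y₂ + W.a₁ * X₂ + W.a₃) * hl
    have hDl : D l = m * (X₁ + X₂) := by
      have := congrArg D hl
      rw [Derivation.leibniz] at this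
      simp only [map_sub, smul_eq_mul, dX1, dY1, dX2, dY2] at this
      refine mul_left_cancel₀ hX' ?_
      linear_combination this - W.a₁ * m * hl
    have hx0 : D (W.toAffine.addX X₁ X₂ l) = 0 := by
      rw [hDX, hDl, dX1, dX2]; linear_combination (-m * W.a₃) * t2
    refine ⟨by rw [hx0]; ring, ?_⟩
    rw [hDY _ _ _ hx0, hDl, dX1, dY1]
    simp only [addX]
    linear_combination m * star - m * l * hl - m * (X₂ * l ^ 2 + W.a₁ * l * X₂ - W.a₂ * (X₁ + X₂) - (X₁ + X₂) ^ 2 + W.a₁ * Y₁ + l * Y₁) * t2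

lemma Mrel_zero {D : Derivation ℤ K K} {P : W.toAffine.Point} (h : Mrel D P 0) :
    P = 0 ∨ ∃ X Y h, P = .some X Y h ∧ D X = 0 ∧ D Y = 0 := by
  rcases P with _ | ⟨X, Y, hP⟩
  · exact Or.inl rfl
  · exact Or.inr ⟨X, Y, hP, rfl, by simpa using h.1, by simpa using h.2⟩

theorem FFSetup.frob_finIdx [CharP K 2] (S : FFSetup K 2) (hΔ : W.Δ ≠ 0) (d1 : S.D W.a₁ = 0)
    (d2 : S.D W.a₂ = 0) (d3 : S.D W.a₃ = 0) (d4 : S.D W.a₄ = 0) (d6 : S.D W.a₆ = 0) :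
    FinIdx {P : W.toAffine.Point | Mrel S.D P 0} := by
  obtain ⟨g1, hg1, hg1'⟩ := S.bD1
  obtain ⟨g2, hg2, hg2'⟩ := S.bD2
  obtain ⟨G1, hG1, h1⟩ := m_bdd S.D hg1 hg1' W hΔ
  obtain ⟨G2, hG2, h2⟩ := m_bdd S.D hg2 hg2' W hΔ
  have hf := S.finite_of_bdd hG1 hG2
  have : Finite {m : K | G1 * m ∈ S.O1 ∧ G2 * m ∈ S.O2} := hf
  refine FinIdx.of_label (ι := {m : K | G1 * m ∈ S.O1 ∧ G2 * m ∈ S.O2})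
    (fun P m => Mrel S.D P m.1) ?_ ?_
  · intro P
    obtain ⟨m, hm⟩ := Mrel_exists S.D d1 d2 d3 d4 d6 P
    refine ⟨⟨m, ?_⟩, hm⟩
    rcases P with _ | ⟨X, Y, h⟩
    · obtain rfl : m = 0 := hm
      simp only [Set.mem_setOf_eq, mul_zero]
      exact ⟨zero_mem _, zero_mem _⟩
    · have e := (W.toAffine.equation_iff X Y).1 h.1
      exact ⟨h1 X Y m e hm.1 hm.2, h2 X Y m e hm.1 hm.2⟩
  · intro P Q m hP hQ
    rw [Set.mem_setOf_eq, sub_eq_add_neg]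
    exact Mrel_add S.D d1 d2 d3 d4 hP (Mrel_neg S.D d1 d3 hQ)

end mgroup

end PartFD2

section PartFD3

open IsDedekindDomain WeierstrassCurve.Affine

lemma ded_split {K : Type*} [Field K] (O : Subring K) [IsDedekindDomain O] [IsFractionRing O K] (x : K) :
    ∃ s ∈ O, s * x ∈ O ∧ x * (1 - s * x) ∈ O := by
  let I : FractionalIdeal (nonZeroDivisors O) K :=
    FractionalIdeal.spanSingleton _ 1 + FractionalIdeal.spanSingleton _ x
  have h1 : (1 : K) ∈ I := by
    have : FractionalIdeal.spanSingleton (nonZeroDivisors O) (1 : K) ≤ I := le_sup_left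
    exact this (FractionalIdeal.mem_spanSingleton_self _ _)
  have hx : x ∈ I := by
    have : FractionalIdeal.spanSingleton (nonZeroDivisors O) x ≤ I := le_sup_right
    exact this (FractionalIdeal.mem_spanSingleton_self _ _)
  have hI : I ≠ 0 := by
    intro h
    rw [h, FractionalIdeal.mem_zero_iff] at h1
    exact one_ne_zero h1
  have h := mul_inv_cancel₀ hI
  have h11 : (1 : K) ∈ I * I⁻¹ := by rw [h]; exact FractionalIdeal.one_mem_one _
  have hinv : ∀ z ∈ I⁻¹, ∀ y ∈ I, z * y ∈ O := by
    intro z hz y hy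
    have := (FractionalIdeal.mem_inv_iff hI).1 hz y hy
    obtain ⟨c, hc⟩ := (FractionalIdeal.mem_one_iff _).1 this
    rw [← hc]; exact c.2
  rw [show I * I⁻¹ = FractionalIdeal.spanSingleton _ 1 * I⁻¹ + FractionalIdeal.spanSingleton _ x * I⁻¹
    from add_mul _ _ _, ← FractionalIdeal.mem_coe, FractionalIdeal.coe_add, Submodule.add_eq_sup,
    Submodule.mem_sup] at h11
  obtain ⟨j, hj, i, hi, hij⟩ := h11
  obtain ⟨j, hj', rfl⟩ := FractionalIdeal.mem_singleton_mul.1 (FractionalIdeal.mem_coe.1 hj)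
  obtain ⟨i, hi', rfl⟩ := FractionalIdeal.mem_singleton_mul.1 (FractionalIdeal.mem_coe.1 hi)
  refine ⟨i, by simpa using hinv i hi' 1 h1, hinv i hi' x hx, ?_⟩
  rw [show x * (1 - i * x) = j * x by linear_combination (-x) * hij]
  exact hinv j hj' x hx

lemma alpha_local {K : Type*} [Field K] [CharP K 2] (O : Subring K) [IsDedekindDomain O] [IsFractionRing O K]
    (a b : K) : ∃ h : K, h ≠ 0 ∧ h ∈ O ∧ ∀ x y : K, y ^ 2 + x * y = x ^ 3 + a * x ^ 2 + b →
      ∃ z : K, h * (x + a + z ^ 2 + z) ∈ O := by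
  classical
  have t2 : (2 : K) = 0 := CharTwo.two_eq_zero
  obtain ⟨c, hc⟩ := IsLocalization.exist_integer_multiples_of_finset (nonZeroDivisors O)
    ({a, b} : Finset K)
  have hb0 : ((c : O) : K) ≠ 0 := by simp
  have hbO : ((c : O) : K) ∈ O := (c : O).2
  have hba : ∀ a' ∈ ({a, b} : Finset K), ((c : O) : K) * a' ∈ O := by
    intro a ha
    obtain ⟨d, hd⟩ := hc a ha
    have : (d : K) = ((c : O) : K) * a := hd
    rw [← this]; exact d.2
  generalize ((c : O) : K) = h at hb0 hbO hba
  simp only [Finset.mem_insert, Finset.mem_singleton, forall_eq_or_imp, forall_eq] at hba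
  obtain ⟨ha, hb⟩ := hba
  refine ⟨h, hb0, hbO, fun x y e => ?_⟩
  obtain ⟨s, hs, hsx, hx⟩ := ded_split O x
  have he1 : 1 - s * x ∈ O := sub_mem (one_mem _) hsx
  refine ⟨s * y, ?_⟩
  have hq : h * (y * s * (1 - s * x)) ∈ O := by
    refine FFSetup.mem_of_quad (e := h * (s * x * (1 - s * x))) (f := h * h * ((s * x) ^ 2 * (x * (1 - s * x)) * (1 - s * x)) + h * (h * a) * ((s * x) ^ 2 * (1 - s * x) ^ 2) + h * (h * b) * (s ^ 2 * (1 - s * x) ^ 2)) (mul_mem hbO (mul_mem hsx he1)) ?_ ?_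
    · refine add_mem (add_mem ?_ ?_) ?_
      · exact mul_mem (mul_mem hbO hbO) (mul_mem (mul_mem (pow_mem hsx _) hx) he1)
      · exact mul_mem (mul_mem hbO ha) (mul_mem (pow_mem hsx _) (pow_mem he1 _))
      · exact mul_mem (mul_mem hbO hb) (mul_mem (pow_mem hs _) (pow_mem he1 _))
    · linear_combination h ^ 2 * s ^ 2 * (1 - s * x) ^ 2 * e
  have : h * (x + a + (s * y) ^ 2 + s * y) = h * a + h * (y * s * (1 - s * x)) + h * (x * (1 - s * x) * (1 - s * x))
      + h * a * (s * x) ^ 2 + h * b * s ^ 2 := by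
    linear_combination h * s ^ 2 * e + (h * s * x^2) * t2
  rw [this]
  exact add_mem (add_mem (add_mem (add_mem ha hq) (mul_mem hbO (mul_mem hx he1)))
    (mul_mem ha (pow_mem hsx _))) (mul_mem hb (pow_mem hs _))

lemma FFSetup.alpha_finite {K : Type*} [Field K] [CharP K 2] (S : FFSetup K 2) (a b : K) :
    ∃ T : Set K, T.Finite ∧ ∀ x y : K, y ^ 2 + x * y = x ^ 3 + a * x ^ 2 + b →
      ∃ z : K, x + a + z ^ 2 + z ∈ T := by
  have t2 : (2 : K) = 0 := CharTwo.two_eq_zero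
  obtain ⟨h1, h10, h1O, H1⟩ := alpha_local S.O1 a b
  obtain ⟨h2, h20, h2O, H2⟩ := alpha_local S.O2 a b
  obtain ⟨C, hC⟩ := S.H1
  have ht := S.t_ne
  refine ⟨_, S.finite_of_bdd (G1 := h1) (G2 := h2 * S.t⁻¹ ^ (2 * C)) h10
    (mul_ne_zero h20 (pow_ne_zero _ (inv_ne_zero ht))), fun x y e => ?_⟩
  obtain ⟨z1, hz1⟩ := H1 x y e
  obtain ⟨z2, hz2⟩ := H2 x y e
  obtain ⟨r, hr, hr2⟩ := hC (z2 - z1)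
  refine ⟨z1 + r, ?_, ?_⟩
  · rw [show h1 * (x + a + (z1 + r) ^ 2 + (z1 + r)) = h1 * (x + a + z1 ^ 2 + z1) + h1 * (r ^ 2 + r) by
      linear_combination h1 * z1 * r * t2]
    exact add_mem hz1 (mul_mem h1O (add_mem (pow_mem hr 2) hr))
  · set d := z2 - z1 - r with hd
    have : h2 * S.t⁻¹ ^ (2 * C) * (x + a + (z1 + r) ^ 2 + (z1 + r)) =
        h2 * (x + a + z2 ^ 2 + z2) * S.t⁻¹ ^ (2 * C) + h2 * ((d * S.t⁻¹ ^ C) ^ 2 + d * S.t⁻¹ ^ C * S.t⁻¹ ^ C) := by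
      rw [show z1 + r = z2 - d by rw [hd]; ring, pow_mul']
      linear_combination (- h2 * (S.t⁻¹ ^ C) ^ 2 * (d + z2 * d)) * t2
    rw [this]
    exact add_mem (mul_mem hz2 (pow_mem S.tinv_mem _)) (mul_mem h2O (add_mem (pow_mem hr2 _)
      (mul_mem hr2 (pow_mem S.tinv_mem _))))

section maphom

variable {K L : Type*} [Field K] [Field L] [DecidableEq K] [DecidableEq L]

/-- functoriality of points -/
noncomputable def mapHom (W : WeierstrassCurve K) (f : K →+* L) :
    W.toAffine.Point →+ (W.map f).toAffine.Point where
  toFun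
    | .zero => .zero
    | .some x y h => .some (f x) (f y) ((W.toAffine.map_nonsingular f.injective x y).2 h)
  map_zero' := rfl
  map_add' := by
    rintro (_ | ⟨x₁, y₁, h₁⟩) (_ | ⟨x₂, y₂, h₂⟩)
    any_goals rfl
    have inj : Function.Injective f := f.injective
    by_cases hxy : x₁ = x₂ ∧ y₁ = W.toAffine.negY x₂ y₂
    · rw [Point.add_of_Y_eq hxy.1 hxy.2]
      exact (Point.add_of_Y_eq (congrArg f hxy.1) (by rw [hxy.2]; exact (map_negY f x₂ y₂).symm)).symm
    · rw [Point.add_some hxy]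
      have hxy' : ¬ (f x₁ = f x₂ ∧ f y₁ = (W.map f).toAffine.negY (f x₂) (f y₂)) := by
        rintro ⟨a, b⟩
        exact hxy ⟨inj a, inj (b.trans (map_negY f x₂ y₂))⟩
      refine Eq.trans ?_ (Point.add_some hxy').symm
      change Point.some _ _ _ = _
      simp only [Point.some.injEq]
      have hs : (W.map f).toAffine.slope (f x₁) (f x₂) (f y₁) (f y₂) = f (W.toAffine.slope x₁ x₂ y₁ y₂) :=
        map_slope f x₁ x₂ y₁ y₂
      rw [hs]
      exact ⟨(map_addX f _ _ _).symm, (map_addY f _ _ _ _).symm⟩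

lemma mapHom_injective (W : WeierstrassCurve K) (f : K →+* L) : Function.Injective (mapHom W f) := by
  rintro (_ | ⟨x₁, y₁, h₁⟩) (_ | ⟨x₂, y₂, h₂⟩) h
  · rfl
  · exact absurd h (by simp [mapHom])
  · exact absurd h (by simp [mapHom])
  · change Point.some _ _ _ = Point.some _ _ _ at h
    simp only [Point.some.injEq] at h ⊢
    exact ⟨f.injective h.1, f.injective h.2⟩

end maphom

end PartFD3

section PartFD4

open IsDedekindDomain WeierstrassCurve.Affine

section p2

variable {K : Type*} [Field K] [DecidableEq K] {W : WeierstrassCurve K}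

lemma D_frob [CharP K 2] (D : Derivation ℤ K K) (x : K) : D (frobenius K 2 x) = 0 := by
  have := D_sq_mul D x 1
  rwa [mul_one, Derivation.map_one_eq_zero, mul_zero] at this

/-- The range of Frobenius has finite index. -/
lemma FFSetup.frob_range [CharP K 2] (S : FFSetup K 2) (hΔ : W.Δ ≠ 0) :
    FinIdx (Set.range (mapHom W (frobenius K 2))) := by
  have h := FFSetup.frob_finIdx (W := W.map (frobenius K 2)) S
    (by rw [WeierstrassCurve.map_Δ]; exact (map_ne_zero _).2 hΔ)
    (D_frob _ _) (D_frob _ _) (D_frob _ _) (D_frob _ _) (D_frob _ _)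
  obtain ⟨s, hs⟩ := h
  refine ⟨s, fun P => ?_⟩
  obtain ⟨Q, hQ, hPQ⟩ := hs P
  refine ⟨Q, hQ, ?_⟩
  rcases Mrel_zero hPQ with h0 | ⟨X, Y, hXY, h, dX, dY⟩
  · exact ⟨0, by rw [map_zero, h0]⟩
  · obtain ⟨x, rfl⟩ := S.kerD _ dX
    obtain ⟨y, rfl⟩ := S.kerD _ dY
    refine ⟨Point.some x y ?_, h.symm⟩
    exact (W.toAffine.map_nonsingular (frobenius K 2).injective x y).1 hXY

lemma half_ord [CharP K 2] (hΔ : W.Δ ≠ 0) (a1 : W.a₁ = 1) (a3 : W.a₃ = 0) (a4 : W.a₄ = 0) {x y w : K}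
    (h : W.toAffine.Nonsingular x y) (hw : x + W.a₂ = w ^ 2 + w) :
    ∃ Q, mapHom W (frobenius K 2) (Point.some x y h) = Q + Q := by
  have t2 : (2 : K) = 0 := CharTwo.two_eq_zero
  have e := (W.toAffine.equation_iff x y).1 h.1
  have hb : W.a₆ ≠ 0 := by
    intro hb
    apply hΔ
    simp [WeierstrassCurve.Δ, WeierstrassCurve.b₂, WeierstrassCurve.b₄,
          WeierstrassCurve.b₆, WeierstrassCurve.b₈, a1, a3, a4, hb]
  rw [a1, a3, a4] at e
  set X := x * w + y with hX
  have hXb : X * (X + x) = W.a₆ := by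
    rw [hX]
    linear_combination e - x ^ 2 * hw + (x ^ 3 + x ^ 2 * W.a₂ + x * w * y) * t2
  have hX0 : X ≠ 0 := by
    intro h0; rw [h0, zero_mul] at hXb; exact hb hXb.symm
  let W' := W.map (frobenius K 2)
  have b1 : W'.a₁ = 1 := by change W.a₁ ^ 2 = 1; rw [a1, one_pow]
  have b3 : W'.a₃ = 0 := by change W.a₃ ^ 2 = 0; simp [a3]
  have b4 : W'.a₄ = 0 := by change W.a₄ ^ 2 = 0; simp [a4]
  have b2 : W'.a₂ = W.a₂ ^ 2 := rfl
  have b6 : W'.a₆ = W.a₆ ^ 2 := rfl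
  have hΔ' : W'.Δ ≠ 0 := by rw [WeierstrassCurve.map_Δ]; exact (map_ne_zero _).2 hΔ
  have hQ : W'.toAffine.Nonsingular X (X * (w ^ 2 + X)) := by
    rw [← WeierstrassCurve.Affine.equation_iff_nonsingular_of_Δ_ne_zero hΔ', equation_iff]
    rw [b1, b2, b3, b4, b6]
    have hw2 : x ^ 2 + W.a₂ ^ 2 = w ^ 4 + w ^ 2 := by
      linear_combination (x + W.a₂ + w ^ 2 + w) * hw + (w ^ 3 - x * W.a₂) * t2
    rw [← hXb]
    linear_combination (- X ^ 2) * hw2 + (w ^ 2 * X ^ 3 - x * X ^ 3) * t2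
  refine ⟨-Point.some X (X * (w ^ 2 + X)) hQ, ?_⟩
  rw [← neg_add, ← neg_eq_iff_eq_neg]
  have hY' : X * (w ^ 2 + X) ≠ W'.toAffine.negY X (X * (w ^ 2 + X)) := by
    simp only [negY, b1, b3]
    intro h'
    apply hX0
    linear_combination h' - (X * (w ^ 2 + X)) * t2
  rw [Point.add_self_of_Y_ne hY']
  have hs : W'.toAffine.slope X X (X * (w ^ 2 + X)) (X * (w ^ 2 + X)) = w ^ 2 := by
    rw [slope_of_Y_ne rfl hY', div_eq_iff (sub_ne_zero.2 hY')]
    simp only [negY, b1, b2, b3, b4]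
    linear_combination (X ^ 2 + W.a₂ ^ 2 * X - w ^ 2 * X - w ^ 2 * X * (w ^ 2 + X)) * t2
  have hN : W'.toAffine.Nonsingular (x ^ 2) (y ^ 2) :=
    (W.toAffine.map_nonsingular (frobenius K 2).injective x y).2 h
  have hP : mapHom W (frobenius K 2) (Point.some x y h) = Point.some (x ^ 2) (y ^ 2) hN := rfl
  rw [hP, Point.neg_some]
  have hx : x ^ 2 = W'.toAffine.addX X X (w ^ 2) := by
    simp only [addX, b1, b2]
    linear_combination (x + W.a₂ + w ^ 2 + w) * hw + (w ^ 3 - x * W.a₂ - W.a₂ ^ 2 + X) * t2 +(W.a₂ ^ 2) * t2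
  simp only [Point.some.injEq, hs]
  refine ⟨hx, ?_⟩
  simp only [addY, negAddY, ← hx, negY, b1, b3]
  rw [hX]
  linear_combination (w ^ 2 * x ^ 2 + x * w * y) * t2

lemma half_ss [CharP K 2] (hΔ : W.Δ ≠ 0) (a1 : W.a₁ = 0) (a2 : W.a₂ = 0)
    (P : W.toAffine.Point) :
    ∃ Q, mapHom (W.map (frobenius K 2)) (frobenius K 2) (mapHom W (frobenius K 2) P) = Q + Q := by
  have t2 : (2 : K) = 0 := CharTwo.two_eq_zero
  rcases P with _ | ⟨x, y, h⟩
  · refine ⟨0, ?_⟩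
    rw [show (Point.zero : W.toAffine.Point) = 0 from rfl]; simp
  have e := (W.toAffine.equation_iff x y).1 h.1
  have hc : W.a₃ ≠ 0 := by
    intro hc
    apply hΔ
    rw [show W.Δ = 2 * (- 32 * W.a₄ ^ 3 - 8 * 27 * W.a₆ ^ 2) by
      simp only [WeierstrassCurve.Δ, WeierstrassCurve.b₂, WeierstrassCurve.b₄,
          WeierstrassCurve.b₆, WeierstrassCurve.b₈, a1, a2, hc]; ring]
    rw [t2, zero_mul]
  rw [a1, a2] at e
  let W' := (W.map (frobenius K 2)).map (frobenius K 2)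
  have b1 : W'.a₁ = 0 := by change (W.a₁ ^ 2) ^ 2 = 0; simp [a1]
  have b2 : W'.a₂ = 0 := by change (W.a₂ ^ 2) ^ 2 = 0; simp [a2]
  have b3 : W'.a₃ = W.a₃ ^ 4 := by change (W.a₃ ^ 2) ^ 2 = _; ring
  have b4 : W'.a₄ = W.a₄ ^ 4 := by change (W.a₄ ^ 2) ^ 2 = _; ring
  have b6 : W'.a₆ = W.a₆ ^ 4 := by change (W.a₆ ^ 2) ^ 2 = _; ring
  have hΔ' : W'.Δ ≠ 0 := by
    rw [WeierstrassCurve.map_Δ, WeierstrassCurve.map_Δ]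
    exact (map_ne_zero _).2 ((map_ne_zero _).2 hΔ)
  change y ^ 2 + 0 * x * y + W.a₃ * y = x ^ 3 + 0 * x ^ 2 + W.a₄ * x + W.a₆ at e
  generalize W.a₃ = c at *
  generalize W.a₄ = a at *
  generalize W.a₆ = b at *
  set X := a ^ 2 + c ^ 2 * x with hX
  set Y := c ^ 3 * y + c ^ 2 * a * x + b ^ 2 + c ^ 2 * b with hY
  have hQ : W'.toAffine.Nonsingular X Y := by
    rw [← WeierstrassCurve.Affine.equation_iff_nonsingular_of_Δ_ne_zero hΔ', equation_iff]
    rw [b1, b2, b3, b4, b6, hX, hY]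
    linear_combination c ^ 6 * e + (((c ^ 3 * y) * (c ^ 2 * a * x) + (c ^ 3 * y) * b ^ 2 + (c ^ 3 * y) * (c ^ 2 * b) + (c ^ 2 * a * x) * b ^ 2 + (c ^ 2 * a * x) * (c ^ 2 * b) + b ^ 2 * (c ^ 2 * b)) - a ^ 2 * c ^ 4 * x ^ 2 + c ^ 4 * b ^ 2 + c ^ 6 * a * x + c ^ 6 * b - a ^ 6 - 2 * a ^ 4 * c ^ 2 * x) * t2
  have hN1 : (W.map (frobenius K 2)).toAffine.Nonsingular (x ^ 2) (y ^ 2) :=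
    (W.toAffine.map_nonsingular (frobenius K 2).injective x y).2 h
  have hN : W'.toAffine.Nonsingular ((x ^ 2) ^ 2) ((y ^ 2) ^ 2) :=
    ((W.map (frobenius K 2)).toAffine.map_nonsingular (frobenius K 2).injective (x ^ 2) (y ^ 2)).2 hN1
  have hP : mapHom (W.map (frobenius K 2)) (frobenius K 2) (mapHom W (frobenius K 2) (Point.some x y h))
    = Point.some ((x ^ 2) ^ 2) ((y ^ 2) ^ 2) hN := rfl
  refine ⟨-Point.some X Y hQ, ?_⟩
  rw [← neg_add, ← neg_eq_iff_eq_neg]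
  have hY' : Y ≠ W'.toAffine.negY X Y := by
    simp only [negY, b1, b3]
    intro h'
    apply pow_ne_zero 4 hc
    linear_combination h' - Y * t2
  rw [Point.add_self_of_Y_ne hY']
  have hs : W'.toAffine.slope X X Y Y = x ^ 2 := by
    rw [slope_of_Y_ne rfl hY', div_eq_iff (sub_ne_zero.2 hY')]
    simp only [negY, b1, b2, b3, b4, hX]
    linear_combination (2 * a ^ 4 + 3 * a ^ 2 * c ^ 2 * x + c ^ 4 * x ^ 2 - x ^ 2 * Y) * t2
  rw [hP, Point.neg_some]
  have hx : (x ^ 2) ^ 2 = W'.toAffine.addX X X (x ^ 2) := by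
    simp only [addX, b1, b2]
    linear_combination X * t2
  simp only [Point.some.injEq, hs]
  refine ⟨hx, ?_⟩
  simp only [addY, negAddY, ← hx, negY, b1, b3]
  rw [hX, hY]
  linear_combination (-(y ^ 2 + (x ^ 3 + a * x + b) - c * y + c ^ 2)) * e + (- a ^ 2 * x ^ 2 - c ^ 2 * x ^ 3 + c ^ 3 * y - (x ^ 3 * (a * x) + x ^ 3 * b + x ^ 3 * (- c * y) + (a * x) * b + (a * x) * (- c * y) + b * (- c * y))) * t2

lemma fg_of_inj {G H : Type*} [AddCommGroup G] [AddCommGroup H] (f : G →+ H)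
    (hf : Function.Injective f) (h : AddGroup.FG H) : AddGroup.FG G := by
  have hH : Module.Finite ℤ H := Module.Finite.iff_addGroup_fg.2 h
  have : Module.Finite ℤ G := Module.Finite.of_injective f.toIntLinearMap hf
  exact Module.Finite.iff_addGroup_fg.1 this

lemma FFSetup.fg_of_finIdx {p : ℕ} [Fact p.Prime] [CharP K p] (S : FFSetup K p) (hΔ : W.Δ ≠ 0)
    (h : FinIdx {P : W.toAffine.Point | ∃ Q, P = Q + Q}) : AddGroup.FG W.toAffine.Point := by
  refine S.fg_of_weak hΔ ?_
  obtain ⟨s, hs⟩ := h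
  refine ⟨s, fun P => ?_⟩
  obtain ⟨Q, hQ, P', hP'⟩ := hs P
  exact ⟨Q, hQ, P', by rw [← hP', sub_add_cancel]⟩

theorem FFSetup.fg_ss [CharP K 2] (S : FFSetup K 2) (hΔ : W.Δ ≠ 0) (a1 : W.a₁ = 0) (a2 : W.a₂ = 0) :
    AddGroup.FG W.toAffine.Point := by
  have hΔ1 : (W.map (frobenius K 2)).Δ ≠ 0 := by
    rw [WeierstrassCurve.map_Δ]; exact (map_ne_zero _).2 hΔ
  have hΔ2 : ((W.map (frobenius K 2)).map (frobenius K 2)).Δ ≠ 0 := by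
    rw [WeierstrassCurve.map_Δ]; exact (map_ne_zero _).2 hΔ1
  have h := FinIdx.map (H' := {P | ∃ Q, P = Q + Q}) (mapHom (W.map (frobenius K 2)) (frobenius K 2))
    (S.frob_range hΔ1) (S.frob_range hΔ) (by
      rintro _ ⟨P, rfl⟩
      exact half_ss hΔ a1 a2 P)
  have : Fact (Nat.Prime 2) := ⟨Nat.prime_two⟩
  exact fg_of_inj _ (mapHom_injective W (frobenius K 2))
    (fg_of_inj _ (mapHom_injective _ (frobenius K 2)) (S.fg_of_finIdx hΔ2 h))

theorem FFSetup.fg_ord [CharP K 2] (S : FFSetup K 2) (hΔ : W.Δ ≠ 0) (a1 : W.a₁ = 1) (a3 : W.a₃ = 0)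
    (a4 : W.a₄ = 0) : AddGroup.FG W.toAffine.Point := by
  have t2 : (2 : K) = 0 := CharTwo.two_eq_zero
  have hΔ1 : (W.map (frobenius K 2)).Δ ≠ 0 := by
    rw [WeierstrassCurve.map_Δ]; exact (map_ne_zero _).2 hΔ
  have : Fact (Nat.Prime 2) := ⟨Nat.prime_two⟩
  refine fg_of_inj _ (mapHom_injective W (frobenius K 2)) (S.fg_of_finIdx hΔ1 ?_)
  refine FinIdx.map (H := {P : W.toAffine.Point | P = 0 ∨ ∃ x y h w, P = .some x y h ∧ x + W.a₂ = w ^ 2 + w})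
    (mapHom W (frobenius K 2)) (S.frob_range hΔ) ?_ ?_
  · obtain ⟨T, hT, h⟩ := S.alpha_finite W.a₂ W.a₆
    have : Finite ↑(insert 0 T) := (hT.insert 0)
    refine FinIdx.of_label (ι := ↑(insert 0 T)) (fun P i => (P = 0 ∧ i.1 = 0) ∨ ∃ x y h w, P = .some x y h ∧
      x + W.a₂ + i.1 = w ^ 2 + w) ?_ ?_
    · rintro (_ | ⟨x, y, hxy⟩)
      · exact ⟨⟨0, by simp⟩, Or.inl ⟨rfl, rfl⟩⟩
      · have e := (W.toAffine.equation_iff x y).1 hxy.1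
        rw [a1, a3, a4] at e
        obtain ⟨z, hz⟩ := h x y (by linear_combination e)
        refine ⟨⟨_, Set.mem_insert_of_mem _ hz⟩, Or.inr ⟨x, y, hxy, z, rfl, ?_⟩⟩
        linear_combination (x + W.a₂) * t2
    · rintro P Q ⟨i, hi⟩ (⟨rfl, hi0⟩ | ⟨x₁, y₁, h₁, w₁, rfl, e₁⟩) (⟨rfl, hi0'⟩ | ⟨x₂, y₂, h₂, w₂, rfl, e₂⟩)
      · left; simp
      · right
        simp only at hi0 e₂
        exact ⟨x₂, _, (nonsingular_neg _ _).2 h₂, w₂, by rw [zero_sub, Point.neg_some], by rw [← e₂, hi0, add_zero]⟩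
      · right
        simp only at hi0' e₁
        exact ⟨x₁, y₁, h₁, w₁, by rw [sub_zero], by rw [← e₁, hi0', add_zero]⟩
      · simp only at e₁ e₂
        rw [sub_eq_add_neg, Point.neg_some]
        by_cases hxy : x₁ = x₂ ∧ y₁ = W.toAffine.negY x₂ (W.toAffine.negY x₂ y₂)
        · left; exact Point.add_of_Y_eq hxy.1 hxy.2
        · right
          rw [Point.add_some hxy]
          refine ⟨_, _, _, W.toAffine.slope x₁ x₂ y₁ (W.toAffine.negY x₂ y₂) + w₁ + w₂, rfl, ?_⟩
          generalize W.toAffine.slope x₁ x₂ y₁ (W.toAffine.negY x₂ y₂) = l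
          simp only [addX]
          change l ^ 2 + W.a₁ * l - W.a₂ - x₁ - x₂ + W.a₂ = _
          rw [a1]
          linear_combination e₁ + e₂ - (x₁ + x₂ + W.a₂ + i + l * w₁ + l * w₂ + w₁ * w₂) * t2
  · rintro P (rfl | ⟨x, y, h, w, rfl, hw⟩)
    · exact ⟨0, by simp⟩
    · exact half_ord hΔ a1 a3 a4 h hw

end p2

end PartFD4

section PartFE

open WeierstrassCurve.Affine

section vc

variable {K : Type*} [Field K] [DecidableEq K] (W : WeierstrassCurve K) (C : WeierstrassCurve.VariableChange K)

lemma vc_equation {x y : K} (e : W.toAffine.Equation x y) :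
    (C • W).toAffine.Equation ((C.u⁻¹ : Kˣ) ^ 2 * (x - C.r)) ((C.u⁻¹ : Kˣ) ^ 3 * (y - C.t - C.s * (x - C.r))) := by
  rw [equation_iff] at e ⊢
  simp only [WeierstrassCurve.variableChange_a₁,
          WeierstrassCurve.variableChange_a₂, WeierstrassCurve.variableChange_a₃,
          WeierstrassCurve.variableChange_a₄, WeierstrassCurve.variableChange_a₆]
  linear_combination ((C.u⁻¹ : Kˣ) : K) ^ 6 * e

lemma vc_negY (x y : K) : (C • W).toAffine.negY ((C.u⁻¹ : Kˣ) ^ 2 * (x - C.r))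
    ((C.u⁻¹ : Kˣ) ^ 3 * (y - C.t - C.s * (x - C.r))) =
    (C.u⁻¹ : Kˣ) ^ 3 * (W.toAffine.negY x y - C.t - C.s * (x - C.r)) := by
  simp only [negY, WeierstrassCurve.variableChange_a₁, WeierstrassCurve.variableChange_a₃]
  ring

lemma vc_slope {x₁ x₂ y₁ y₂ : K} (h₁ : W.toAffine.Equation x₁ y₁) (h₂ : W.toAffine.Equation x₂ y₂)
    (hxy : ¬ (x₁ = x₂ ∧ y₁ = W.toAffine.negY x₂ y₂)) :
    (C • W).toAffine.slope ((C.u⁻¹ : Kˣ) ^ 2 * (x₁ - C.r)) ((C.u⁻¹ : Kˣ) ^ 2 * (x₂ - C.r))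
      ((C.u⁻¹ : Kˣ) ^ 3 * (y₁ - C.t - C.s * (x₁ - C.r))) ((C.u⁻¹ : Kˣ) ^ 3 * (y₂ - C.t - C.s * (x₂ - C.r)))
    = (C.u⁻¹ : Kˣ) * (W.toAffine.slope x₁ x₂ y₁ y₂ - C.s) := by
  have hv : ((C.u⁻¹ : Kˣ) : K) ≠ 0 := Units.ne_zero _
  by_cases hX : x₁ = x₂
  · subst hX
    have hY' : y₁ ≠ W.toAffine.negY x₁ y₂ := fun h => hxy ⟨rfl, h⟩
    obtain rfl : y₁ = y₂ := Y_eq_of_Y_ne h₁ h₂ rfl hY'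
    have hY0 := sub_ne_zero.2 hY'
    rw [slope_of_Y_ne rfl hY', slope_of_Y_ne rfl, div_eq_iff, vc_negY]
    · rw [show (C.u⁻¹ : Kˣ) ^ 3 * (y₁ - C.t - C.s * (x₁ - C.r)) - (C.u⁻¹ : Kˣ) ^ 3 * (W.toAffine.negY x₁ y₁ - C.t - C.s * (x₁ - C.r)) = (C.u⁻¹ : Kˣ) ^ 3 * (y₁ - W.toAffine.negY x₁ y₁) by ring]
      field_simp
      simp only [negY, WeierstrassCurve.variableChange_a₁,
          WeierstrassCurve.variableChange_a₂,
          WeierstrassCurve.variableChange_a₄]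
      ring
    · rw [vc_negY, ← mul_sub]
      refine mul_ne_zero (pow_ne_zero _ hv) ?_
      rw [show y₁ - C.t - C.s * (x₁ - C.r) - (W.toAffine.negY x₁ y₁ - C.t - C.s * (x₁ - C.r)) = y₁ - W.toAffine.negY x₁ y₁ by ring]
      exact hY0
    · rw [vc_negY]
      intro h
      apply hY'
      have := mul_left_cancel₀ (pow_ne_zero _ hv) h
      linear_combination this
  · have hX0 := sub_ne_zero.2 hX
    rw [slope_of_X_ne hX, slope_of_X_ne, ← mul_sub, ← mul_sub]
    · rw [show x₁ - C.r - (x₂ - C.r) = x₁ - x₂ by ring]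
      field_simp
      ring
    · intro h
      apply hX
      have := mul_left_cancel₀ (pow_ne_zero _ hv) h
      linear_combination this

/-- change of variables on points -/
noncomputable def vcHom (hΔ : W.Δ ≠ 0) : W.toAffine.Point →+ (C • W).toAffine.Point :=
  have hΔ' : (C • W).Δ ≠ 0 := by
    rw [WeierstrassCurve.variableChange_Δ]; exact mul_ne_zero (pow_ne_zero _ (Units.ne_zero _)) hΔ
  { toFun := fun P => match P with
      | .zero => .zero
      | .some x y h => .some _ _
        ((equation_iff_nonsingular_of_Δ_ne_zero hΔ').1 (vc_equation W C h.1))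
    map_zero' := rfl
    map_add' := by
      rintro (_ | ⟨x₁, y₁, h₁⟩) (_ | ⟨x₂, y₂, h₂⟩)
      any_goals rfl
      have hv : ((C.u⁻¹ : Kˣ) : K) ≠ 0 := Units.ne_zero _
      by_cases hxy : x₁ = x₂ ∧ y₁ = W.toAffine.negY x₂ y₂
      · rw [Point.add_of_Y_eq hxy.1 hxy.2]
        refine (Point.add_of_Y_eq ?_ ?_).symm
        · rw [hxy.1]
        · rw [vc_negY, hxy.2, hxy.1]
      · rw [Point.add_some hxy]
        refine Eq.trans ?_ (Point.add_some ?_).symm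
        · simp only [Point.some.injEq]
          rw [vc_slope W C h₁.1 h₂.1 hxy]
          generalize W.toAffine.slope x₁ x₂ y₁ y₂ = l
          simp only [addX, addY, negAddY, negY, WeierstrassCurve.variableChange_a₁,
            WeierstrassCurve.variableChange_a₂, WeierstrassCurve.variableChange_a₃]
          constructor <;> ring
        · rintro ⟨a, b⟩
          have a' := mul_left_cancel₀ (pow_ne_zero _ hv) a
          obtain rfl : x₁ = x₂ := by linear_combination a'
          rw [vc_negY] at b
          have := mul_left_cancel₀ (pow_ne_zero _ hv) b
          exact hxy ⟨rfl, by linear_combination this⟩ }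

lemma vcHom_injective (hΔ : W.Δ ≠ 0) : Function.Injective (vcHom W C hΔ) := by
  have hv : ((C.u⁻¹ : Kˣ) : K) ≠ 0 := Units.ne_zero _
  rintro (_ | ⟨x₁, y₁, h₁⟩) (_ | ⟨x₂, y₂, h₂⟩) h
  · rfl
  · exact absurd h (by simp [vcHom])
  · exact absurd h (by simp [vcHom])
  · change Point.some _ _ _ = Point.some _ _ _ at h
    simp only [Point.some.injEq] at h ⊢
    have a' := mul_left_cancel₀ (pow_ne_zero _ hv) h.1
    have b' := mul_left_cancel₀ (pow_ne_zero _ hv) h.2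
    obtain rfl : x₁ = x₂ := by linear_combination a'
    exact ⟨rfl, by linear_combination b'⟩

lemma fg_of_vc (hΔ : W.Δ ≠ 0) (h : AddGroup.FG (C • W).toAffine.Point) : AddGroup.FG W.toAffine.Point :=
  fg_of_inj _ (vcHom_injective W C hΔ) h

end vc

section p2

theorem FFSetup.fg_two {K : Type*} [Field K] [DecidableEq K] [CharP K 2] (S : FFSetup K 2)
    (W : WeierstrassCurve K) (hΔ : W.Δ ≠ 0) : AddGroup.FG W.toAffine.Point := by
  obtain ⟨C, hC⟩ := W.exists_variableChange_isCharTwoNF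
  refine fg_of_vc W C hΔ ?_
  have hΔ' : (C • W).Δ ≠ 0 := by
    rw [WeierstrassCurve.variableChange_Δ]; exact mul_ne_zero (pow_ne_zero _ (Units.ne_zero _)) hΔ
  rcases hC with ⟨h⟩ | ⟨h⟩
  · exact S.fg_ord hΔ' (by simp) (by simp) (by simp)
  · exact S.fg_ss hΔ' (by simp) (by simp)

end p2

end PartFE

section PartFG

set_option linter.unusedSectionVars false

section powD

variable {K : Type*} [Field K] {p : ℕ} [Fact p.Prime] [CharP K p]

lemma D_pow_p (D : Derivation ℤ K K) (z : K) : D (z ^ p) = 0 := by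
  rw [Derivation.leibniz_pow, nsmul_eq_mul, CharP.cast_eq_zero, zero_mul]

lemma D_iter_mul (D : Derivation ℤ K K) (z y : K) (m : ℕ) :
    D^[m] (z ^ p * y) = z ^ p * D^[m] y := by
  induction m generalizing y with
  | zero => rfl
  | succ m ih =>
    rw [Function.iterate_succ_apply, Function.iterate_succ_apply, Derivation.leibniz, D_pow_p,
      smul_zero, add_zero, smul_eq_mul, ih]

lemma iterate_map_smul_aux (D : Derivation ℤ K K) (m n : ℕ) (y : K) :
    D^[m] (n • y) = n • D^[m] y := by
  induction m generalizing y with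
  | zero => rfl
  | succ m ih => rw [Function.iterate_succ_apply, Function.iterate_succ_apply, map_nsmul, ih]

lemma D_iter_t (D : Derivation ℤ K K) {t : K} (ht : D t = 1) (m : ℕ) :
    ∀ j, j ≤ m → D^[m] (t ^ j) = if j = m then (m.factorial : K) else 0 := by
  induction m with
  | zero => intro j hj; obtain rfl : j = 0 := by omega
            simp
  | succ m ih =>
    intro j hj
    rw [Function.iterate_succ_apply, Derivation.leibniz_pow, ht]
    rcases j with _ | j
    · simp only [zero_smul, iterate_map_zero]; simp
    · have h := ih j (by omega)
      have hc : ∀ (n : ℕ) (y : K), D^[m] (n • y) = n • D^[m] y := fun n y =>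
        iterate_map_smul_aux D m n y
      rw [hc]
      simp only [Nat.add_sub_cancel, smul_eq_mul, mul_one, h, Nat.add_right_cancel_iff]
      split_ifs with h1
      · subst h1; rw [Nat.factorial_succ]; push_cast; rw [nsmul_eq_mul]; push_cast; ring
      · simp

lemma natCast_pow_p (m : ℕ) : ((m : K)) ^ p = m := by
  have := congrArg (ZMod.castHom (dvd_refl p) K) (ZMod.pow_card (m : ZMod p))
  rwa [map_pow, map_natCast] at this

lemma powD_aux (D : Derivation ℤ K K) {t : K} (ht : D t = 1) (z : ℕ → K) (n : ℕ) (hn : n ≤ p)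
    (h0 : ∑ j ∈ Finset.range n, t ^ j * z j ^ p ≠ 0) : ∃ m < n, ∃ α : K, α ≠ 0 ∧
      D^[m] (∑ j ∈ Finset.range n, t ^ j * z j ^ p) = α ^ p := by
  induction n with
  | zero => simp at h0
  | succ n ih =>
    by_cases hz : z n = 0
    · rw [Finset.sum_range_succ, hz, zero_pow (Fact.out : p.Prime).ne_zero, mul_zero, add_zero] at h0 ⊢
      obtain ⟨m, hm, h⟩ := ih (by omega) h0
      exact ⟨m, by omega, h⟩
    · refine ⟨n, by omega, n.factorial * z n, mul_ne_zero ?_ hz, ?_⟩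
      · intro h
        rw [CharP.cast_eq_zero_iff K p, (Fact.out : p.Prime).dvd_factorial] at h
        omega
      · have key : ∀ (m : ℕ), m ≤ n → D^[n] (∑ j ∈ Finset.range m, t ^ j * z j ^ p) = 0 := by
          intro m hm
          induction m with
          | zero => simp [iterate_map_zero]
          | succ m ih =>
            rw [Finset.sum_range_succ, iterate_map_add, ih (by omega), mul_comm, D_iter_mul,
              D_iter_t D ht n m (by omega), if_neg (by omega)]; simp
        rw [Finset.sum_range_succ, iterate_map_add, key n le_rfl, mul_comm, D_iter_mul,
              D_iter_t D ht n n le_rfl, if_pos rfl, mul_pow, natCast_pow_p]; ring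

/-- `t`-expansions with `p`-th power coefficients. -/
def Expn (p : ℕ) (t : K) (y : K) : Prop := ∃ z : ℕ → K, y = ∑ j ∈ Finset.range p, t ^ j * z j ^ p

lemma Expn.add {t y y' : K} (h : Expn p t y) (h' : Expn p t y') : Expn p t (y + y') := by
  obtain ⟨z, rfl⟩ := h
  obtain ⟨z', rfl⟩ := h'
  refine ⟨fun j => z j + z' j, ?_⟩
  rw [← Finset.sum_add_distrib]
  exact Finset.sum_congr rfl fun j _ => by rw [add_pow_char]; ring

lemma Expn.zero (t : K) : Expn p t (0 : K) := ⟨0, by simp [(Fact.out : p.Prime).ne_zero]⟩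

lemma Expn.mul {t y : K} (h : Expn p t y) (c : K) : Expn p t (c ^ p * y) := by
  obtain ⟨z, rfl⟩ := h
  refine ⟨fun j => c * z j, ?_⟩
  rw [Finset.mul_sum]
  exact Finset.sum_congr rfl fun j _ => by ring

lemma Expn.pow (t : K) (n : ℕ) : Expn p t (t ^ n) := by
  have hp := (Fact.out : p.Prime)
  refine ⟨fun j => if j = n % p then t ^ (n / p) else 0, ?_⟩
  rw [Finset.sum_eq_single (n % p)]
  · beta_reduce; rw [if_pos rfl, ← pow_mul, ← pow_add]; congr 1
    rw [mul_comm, Nat.mod_add_div]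
  · intro j _ hj; beta_reduce; rw [if_neg hj, zero_pow hp.ne_zero, mul_zero]
  · intro h; exact absurd (Finset.mem_range.2 (Nat.mod_lt _ hp.pos)) h

lemma powD_of_expn (D : Derivation ℤ K K) {t : K} (ht : D t = 1) (he : ∀ y : K, Expn p t y) :
    ∀ μ : K, μ ≠ 0 → ∃ m < p, ∃ α : K, α ≠ 0 ∧ D^[m] μ = α ^ p := by
  intro μ hμ
  obtain ⟨z, rfl⟩ := he μ
  exact powD_aux D ht z p le_rfl hμ

lemma kerD_of_powD (D : Derivation ℤ K K)
   (h : ∀ μ : K, μ ≠ 0 → ∃ m < p, ∃ α : K, α ≠ 0 ∧ D^[m] μ = α ^ p) (y : K) (hy : D y = 0) :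
   ∃ z, y = z ^ p := by
  have hp := (Fact.out : p.Prime)
  by_cases h0 : y = 0
  · exact ⟨0, by rw [h0, zero_pow hp.ne_zero]⟩
  obtain ⟨m, _, α, hα, e⟩ := h y h0
  rcases m with _ | m
  · exact ⟨α, e⟩
  · rw [Function.iterate_succ_apply, hy, iterate_map_zero] at e
    exact absurd e.symm (pow_ne_zero _ hα)

end powD

section ratExp
open Polynomial

variable {F K : Type*} [Field F] [Finite F] [Field K] {p : ℕ} [Fact p.Prime] [CharP F p] [CharP K p]
  [Algebra F[X] K] [Algebra (RatFunc F) K] [IsScalarTower F[X] (RatFunc F) K]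

lemma expn_poly (f : F[X]) : Expn p (algebraMap F[X] K X) (algebraMap F[X] K f) := by
  induction f using Polynomial.induction_on' with
  | add f g hf hg => rw [map_add]; exact hf.add hg
  | monomial n a =>
    obtain ⟨b, rfl⟩ : ∃ b : F, b ^ p = a := by
      have : Function.Surjective (frobenius F p) :=
        Finite.surjective_of_injective (frobenius F p).injective
      obtain ⟨b, hb⟩ := this a
      exact ⟨b, by rw [← hb, frobenius_def]⟩
    rw [← C_mul_X_pow_eq_monomial, map_mul, map_pow, map_pow, map_pow]
    exact (Expn.pow _ n).mul _

lemma expn_ratFunc (f : RatFunc F) : Expn p (algebraMap F[X] K X) (algebraMap (RatFunc F) K f) := by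
  have hp := (Fact.out : p.Prime)
  obtain ⟨g, h, hh, rfl⟩ := IsFractionRing.div_surjective (A := F[X]) f
  have hh0 := nonZeroDivisors.ne_zero hh
  have h1 := (expn_poly (K := K) (p := p) (g * h ^ (p - 1))).mul (algebraMap F[X] K h)⁻¹
  convert h1 using 1
  have hinj : algebraMap F[X] K h ≠ 0 := by
    rw [IsScalarTower.algebraMap_apply F[X] (RatFunc F) K]
    simpa using hh0
  rw [map_div₀, ← IsScalarTower.algebraMap_apply, ← IsScalarTower.algebraMap_apply, map_mul,
    map_pow]
  rw [div_eq_iff hinj, inv_pow]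
  have e : algebraMap F[X] K h ^ (p - 1) * algebraMap F[X] K h = algebraMap F[X] K h ^ p := by
    rw [← pow_succ, Nat.sub_add_cancel hp.one_le]
  rw [mul_assoc, mul_assoc, e, mul_comm, mul_assoc, mul_inv_cancel₀ (pow_ne_zero _ hinj), mul_one]

lemma expn_all [FiniteDimensional (RatFunc F) K] [Algebra.IsSeparable (RatFunc F) K] (y : K) :
    Expn p (algebraMap F[X] K X) y := by
  have : CharP (RatFunc F) p := charP_of_injective_algebraMap (algebraMap F (RatFunc F)).injective p
  have : ExpChar (RatFunc F) p := ExpChar.prime Fact.out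
  let b := Module.finBasis (RatFunc F) K
  have h := Field.span_map_pow_expChar_pow_eq_top_of_isSeparable p 1 b.span_eq
  have hy : y ∈ Submodule.span (RatFunc F) (Set.range (b · ^ p ^ 1)) := by rw [h]; trivial
  rw [Submodule.mem_span_range_iff_exists_fun] at hy
  obtain ⟨c, rfl⟩ := hy
  refine Finset.sum_induction _ (fun y => Expn p (algebraMap F[X] K X) y) (fun _ _ => Expn.add)
    (Expn.zero _) ?_
  intro i _
  rw [Algebra.smul_def, pow_one, mul_comm]
  exact (expn_ratFunc (c i)).mul _

end ratExp

end PartFG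

section PartFH
open Polynomial

section gen
variable (A k K : Type*) [CommRing A] [IsDedekindDomain A] [Field k] [Field K] [Algebra A k]
  [IsFractionRing A k] [Algebra k K] [Algebra A K] [IsScalarTower A k K] [FiniteDimensional k K]
  [Algebra.IsSeparable k K]

/-- The integral closure as a subring. -/
def Ocl (A K : Type*) [CommRing A] [Field K] [Algebra A K] : Subring K :=
  (integralClosure A K).toSubring

lemma mem_Ocl {y : K} : y ∈ Ocl A K ↔ IsIntegral A y := Iff.rfl

include k in
lemma Ocl_ded : IsDedekindDomain (Ocl A K) := by
  have : IsDedekindDomain (integralClosure A K) := IsIntegralClosure.isDedekindDomain A k K _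
  exact this

include k in
lemma Ocl_frac : IsFractionRing (Ocl A K) K := by
  have : IsFractionRing (integralClosure A K) K :=
    integralClosure.isFractionRing_of_finite_extension k K
  exact this

include k in
lemma Ocl_bD (D : Derivation ℤ K K) (hD : ∀ a : A, IsIntegral A (D (algebraMap A K a))) :
    ∃ g : K, g ≠ 0 ∧ ∀ y ∈ Ocl A K, g * D y ∈ Ocl A K := by
  classical
  have : IsNoetherian A (integralClosure A K) := IsIntegralClosure.isNoetherian A k K _
  have : IsFractionRing (integralClosure A K) K :=
    integralClosure.isFractionRing_of_finite_extension k K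
  obtain ⟨s, hs⟩ := Module.Finite.fg_top (R := A) (M := integralClosure A K)
  obtain ⟨b, hb⟩ := IsLocalization.exist_integer_multiples_of_finset
    (nonZeroDivisors (integralClosure A K)) (s.image fun o : integralClosure A K => D (o : K))
  refine ⟨(b : integralClosure A K), ?_, ?_⟩
  · have := nonZeroDivisors.ne_zero b.2
    simpa using this
  · intro y hy
    have h1 : ∀ o : integralClosure A K, ((b : integralClosure A K) : K) * D (o : K) ∈ integralClosure A K := by
      intro o
      have ho : o ∈ Submodule.span A (s : Set (integralClosure A K)) := by rw [hs]; trivial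
      induction ho using Submodule.span_induction with
      | mem x hx =>
        obtain ⟨c, hc⟩ := hb (D (x : K)) (Finset.mem_image_of_mem _ hx)
        have : ((b : integralClosure A K) : K) * D (x : K) = c := by
          rw [show ((c : K)) = algebraMap (integralClosure A K) K c from rfl, hc]; rfl
        rw [this]; exact c.2
      | zero => simp
      | add x y _ _ h1 h2 => 
        rw [AddMemClass.coe_add, map_add, mul_add]; exact add_mem h1 h2
      | smul a x _ h =>
        rw [SetLike.val_smul, Algebra.smul_def, Derivation.leibniz, mul_add, smul_eq_mul, smul_eq_mul]
        refine add_mem ?_ ?_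
        · rw [mul_left_comm]; exact mul_mem (Subalgebra.algebraMap_mem _ a) h
        · exact mul_mem (b : integralClosure A K).2 (mul_mem x.2 (hD a))
    exact h1 ⟨y, hy⟩

end gen

section der
variable (F K : Type*) [Field F] [Field K] [Algebra F K] [Algebra F[X] K] [Algebra (RatFunc F) K]
  [IsScalarTower F[X] (RatFunc F) K] [IsScalarTower F F[X] K] [Algebra.IsSeparable (RatFunc F) K]

lemma exists_der : ∃ D : Derivation ℤ K K, ∀ f : F[X],
    D (algebraMap F[X] K f) = algebraMap F[X] K (derivative f) := by
  have h1 : Algebra.FormallyEtale F[X] (RatFunc F) :=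
    Algebra.FormallyEtale.of_isLocalization (nonZeroDivisors F[X])
  have h2 : Algebra.FormallyEtale (RatFunc F) K := Algebra.FormallyEtale.of_isSeparable _ _
  have h3 : Algebra.FormallyEtale F[X] K := Algebra.FormallyEtale.comp F[X] (RatFunc F) K
  let d : Derivation F F[X] K := mkDerivation F (1 : K)
  let l := (LinearMap.liftBaseChange K d.liftKaehlerDifferential) ∘ₗ
    (KaehlerDifferential.tensorKaehlerEquivOfFormallyEtale F F[X] K).symm.toLinearMap
  let D' : Derivation F K K := l.compDer (KaehlerDifferential.D F K)
  refine ⟨D'.restrictScalars ℤ, fun f => ?_⟩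
  change l (KaehlerDifferential.D F K (algebraMap F[X] K f)) = _
  simp only [l, LinearMap.comp_apply, LinearEquiv.coe_coe]
  rw [KaehlerDifferential.tensorKaehlerEquivOfFormallyEtale_symm_D_algebraMap]
  rw [LinearMap.liftBaseChange_tmul, one_smul, Derivation.liftKaehlerDifferential_comp_D]
  change derivative f • (1 : K) = _
  rw [Algebra.smul_def, mul_one]
end der

end PartFH

section PartFI
open Polynomial

set_option linter.unusedSectionVars false
section inf
variable (F K B : Type*) [Field F] [Finite F] [Field K] [Algebra F K] [Algebra F[X] K] [Algebra (RatFunc F) K]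
  [IsScalarTower F[X] (RatFunc F) K] [IsScalarTower F F[X] K]
  [FiniteDimensional (RatFunc F) K] [Algebra.IsSeparable (RatFunc F) K]
  [CommRing B] [IsDedekindDomain B] [Algebra B (RatFunc F)] [IsFractionRing B (RatFunc F)]
  [Algebra B K] [IsScalarTower B (RatFunc F) K]
  (hB : ∀ x : RatFunc F, (∃ b, algebraMap B (RatFunc F) b = x) ↔ x.intDegree ≤ 0)

include hB

lemma inf_mem {x : RatFunc F} (hx : x.intDegree ≤ 0) : algebraMap (RatFunc F) K x ∈ Ocl B K := by
  obtain ⟨b, rfl⟩ := (hB x).2 hx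
  rw [← IsScalarTower.algebraMap_apply]
  exact isIntegral_algebraMap

lemma inf_t_mem (L : ℕ) {x : RatFunc F} (hx : x.intDegree ≤ L) :
    algebraMap (RatFunc F) K x * (algebraMap F[X] K X)⁻¹ ^ L ∈ Ocl B K := by
  have h : algebraMap (RatFunc F) K x * (algebraMap F[X] K X)⁻¹ ^ L =
      algebraMap (RatFunc F) K (x / RatFunc.X ^ L) := by
    rw [IsScalarTower.algebraMap_apply F[X] (RatFunc F) K, RatFunc.algebraMap_X, map_div₀, map_pow,
      inv_pow, div_eq_mul_inv]
  rw [h]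
  refine inf_mem F K B hB ?_
  by_cases h0 : x = 0
  · simp [h0]
  rw [RatFunc.intDegree_div h0 (pow_ne_zero _ RatFunc.X_ne_zero), ← RatFunc.algebraMap_X, ← map_pow,
    RatFunc.intDegree_polynomial, natDegree_X_pow]
  omega

lemma inf_bdd2 (y : K) : ∃ L : ℕ, y * (algebraMap F[X] K X)⁻¹ ^ L ∈ Ocl B K := by
  have halg : Algebra.IsAlgebraic B K :=
    (IsFractionRing.comap_isAlgebraic_iff (A := B) (K := RatFunc F) (C := K)).2 inferInstance
  obtain ⟨d, hd, hi⟩ := (halg.isAlgebraic y).exists_integral_multiple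
  set x := algebraMap B (RatFunc F) d with hx
  have hx0 : x ≠ 0 := by simpa [hx] using hd
  have hxK : algebraMap (RatFunc F) K x ≠ 0 := by simpa using hx0
  refine ⟨(-x.intDegree).toNat, ?_⟩
  have h1 := inf_t_mem F K B hB (-x.intDegree).toNat (x := x⁻¹) (by
    rw [RatFunc.intDegree_inv]; exact Int.self_le_toNat _)
  have h2 := mul_mem h1 (show d • y ∈ Ocl B K from hi)
  convert h2 using 1
  rw [Algebra.smul_def, IsScalarTower.algebraMap_apply B (RatFunc F) K, ← hx, map_inv₀]
  field_simp

lemma inf_H1 : ∃ C : ℕ, ∀ y : K, ∃ r ∈ Ocl F[X] K, (y - r) * (algebraMap F[X] K X)⁻¹ ^ C ∈ Ocl B K := by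
  obtain ⟨s, b, hb⟩ := FiniteDimensional.exists_is_basis_integral F[X] (RatFunc F) K
  choose L hL using fun i => inf_bdd2 F K B hB (b i)
  have hTinv : (algebraMap F[X] K X)⁻¹ ∈ Ocl B K := by
    have := inf_t_mem F K B hB 1 (x := 1) (by simp)
    simpa using this
  refine ⟨∑ i, L i, fun y => ?_⟩
  have key : ∀ f : RatFunc F, ∃ (q : F[X]) (c : RatFunc F), c.intDegree ≤ 0 ∧
      f = algebraMap F[X] _ q + c := by
    intro f
    obtain ⟨g, h, hh, rfl⟩ := IsFractionRing.div_surjective (A := F[X]) f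
    have hh0 := nonZeroDivisors.ne_zero hh
    have hh1 : algebraMap F[X] (RatFunc F) h ≠ 0 := by simpa using hh0
    refine ⟨g / h, algebraMap F[X] _ (g % h) / algebraMap F[X] _ h, ?_, ?_⟩
    · by_cases h0 : g % h = 0
      · simp [h0]
      · rw [RatFunc.intDegree_div (by simpa using h0) hh1, RatFunc.intDegree_polynomial,
          RatFunc.intDegree_polynomial]
        have := natDegree_le_natDegree (EuclideanDomain.mod_lt g hh0 : degree (g % h) < degree h).le
        omega
    · rw [eq_comm, ← sub_eq_zero]
      field_simp
      rw [← map_mul, ← map_add, mul_comm (g / h), EuclideanDomain.div_add_mod, sub_self, mul_zero]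
  choose q c hc hq using key
  refine ⟨∑ i, algebraMap F[X] K (q (b.repr y i)) * b i, ?_, ?_⟩
  · exact sum_mem fun i _ => mul_mem (show IsIntegral _ _ from isIntegral_algebraMap) (hb i)
  · have : y - ∑ i, algebraMap F[X] K (q (b.repr y i)) * b i =
      ∑ i, algebraMap (RatFunc F) K (c (b.repr y i)) * b i := by
      conv_lhs => rw [← b.sum_repr y]
      rw [← Finset.sum_sub_distrib]
      refine Finset.sum_congr rfl fun i _ => ?_
      rw [b.sum_repr, Algebra.smul_def]
      have h3 := congrArg (algebraMap (RatFunc F) K) (hq (b.repr y i))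
      rw [map_add, ← IsScalarTower.algebraMap_apply] at h3
      linear_combination b i * h3
    rw [this, Finset.sum_mul]
    refine sum_mem fun i _ => ?_
    rw [mul_assoc]
    refine mul_mem (inf_mem F K B hB (hc _)) ?_
    obtain ⟨k, hk⟩ := Nat.exists_eq_add_of_le (Finset.single_le_sum (f := L) (fun _ _ => Nat.zero_le _) (Finset.mem_univ i))
    rw [hk, pow_add, ← mul_assoc]
    exact mul_mem (hL i) (pow_mem hTinv _)

lemma inf_fin (L : ℕ) : {y : K | y ∈ Ocl F[X] K ∧ y * (algebraMap F[X] K X)⁻¹ ^ L ∈ Ocl B K}.Finite := by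
  classical
  set N := Module.finrank (RatFunc F) K
  have hU : {f : F[X] | f.natDegree ≤ L * N}.Finite := by
    have : {f : F[X] | f.natDegree ≤ L * N} = ((degreeLT F (L * N + 1) : Submodule F F[X]) : Set F[X]) := by
      ext f
      rw [SetLike.mem_coe, mem_degreeLT, Set.mem_ofPred_eq]
      by_cases hf : f = 0
      · simp [hf]; exact WithBot.bot_lt_coe _
      · rw [degree_eq_natDegree hf]; norm_cast; omega
    rw [this]
    have e := (degreeLTEquiv F (L * N + 1)).toEquiv
    have : Finite (degreeLT F (L * N + 1)) := Finite.of_equiv _ e.symm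
    exact Set.toFinite _
  refine (bUnion_roots_finite (algebraMap F[X] K) N hU).subset ?_
  rintro y ⟨h1, h2⟩
  rw [mem_Ocl] at h1 h2
  have hm := minpoly.isIntegrallyClosed_eq_field_fractions' (RatFunc F) h1
  have hmB := minpoly.isIntegrallyClosed_eq_field_fractions' (RatFunc F) h2
  have hk : IsIntegral (RatFunc F) y := Algebra.IsIntegral.isIntegral y
  have hX : (RatFunc.X : RatFunc F)⁻¹ ^ L ≠ 0 := pow_ne_zero _ (inv_ne_zero RatFunc.X_ne_zero)
  have hs := IsIntegrallyClosed.minpoly_smul hX hk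
  have hy : (RatFunc.X : RatFunc F)⁻¹ ^ L • y = y * (algebraMap F[X] K X)⁻¹ ^ L := by
    rw [Algebra.smul_def, map_pow, map_inv₀, ← RatFunc.algebraMap_X, ← IsScalarTower.algebraMap_apply, mul_comm]
  rw [hy, hmB, hm] at hs
  have hdeg : (minpoly F[X] y).natDegree ≤ N := by
    have := minpoly.natDegree_le (A := RatFunc F) y
    rw [hm, natDegree_map_eq_of_injective (IsFractionRing.injective F[X] (RatFunc F))] at this
    exact this
  simp only [Set.mem_iUnion]
  refine ⟨minpoly F[X] y, ⟨hdeg, fun i => ?_⟩, ?_⟩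
  · have hc := congrArg (fun f => coeff f i) hs
    simp only [coeff_map, coeff_scaleRoots] at hc
    rw [natDegree_map_eq_of_injective (IsFractionRing.injective F[X] (RatFunc F))] at hc
    have hd := (hB _).1 ⟨_, hc⟩
    rw [Set.mem_ofPred_eq]
    by_cases h0 : (minpoly F[X] y).coeff i = 0
    · rw [h0]; simp
    rw [RatFunc.intDegree_mul (by simpa using h0) (pow_ne_zero _ hX), RatFunc.intDegree_polynomial,
      ← pow_mul, inv_pow, RatFunc.intDegree_inv, ← RatFunc.algebraMap_X, ← map_pow,
      RatFunc.intDegree_polynomial, natDegree_X_pow] at hd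
    have h3 : L * ((minpoly F[X] y).natDegree - i) ≤ L * N := Nat.mul_le_mul_left _ (by omega)
    omega
  · rw [Finset.mem_coe, Multiset.mem_toFinset, mem_roots', IsRoot.def, eval_map_algebraMap]
    exact ⟨((minpoly.monic h1).map _).ne_zero, minpoly.aeval _ _⟩

lemma inf_D (D : Derivation ℤ K K) (hD : ∀ f : F[X],
    D (algebraMap F[X] K f) = algebraMap F[X] K (derivative f)) (b : B) :
    IsIntegral B (D (algebraMap B K b)) := by
  set x := algebraMap B (RatFunc F) b with hx
  have hxd := (hB x).1 ⟨b, rfl⟩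
  rw [IsScalarTower.algebraMap_apply B (RatFunc F) K, ← hx]
  obtain ⟨g, h, hh, e⟩ := IsFractionRing.div_surjective (A := F[X]) x
  have hh0 := nonZeroDivisors.ne_zero hh
  have hh1 : algebraMap F[X] (RatFunc F) h ≠ 0 := by simpa using hh0
  have hhK : algebraMap F[X] K h ≠ 0 := by
    rw [IsScalarTower.algebraMap_apply F[X] (RatFunc F) K]; simpa using hh0
  have e1 : algebraMap (RatFunc F) K x * algebraMap F[X] K h = algebraMap F[X] K g := by
    rw [← e, map_div₀, ← IsScalarTower.algebraMap_apply, ← IsScalarTower.algebraMap_apply,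
      div_mul_cancel₀ _ hhK]
  have e2 := congrArg D e1
  rw [Derivation.leibniz, hD, hD, smul_eq_mul, smul_eq_mul] at e2
  have e3 : D (algebraMap (RatFunc F) K x) =
      algebraMap (RatFunc F) K (algebraMap F[X] _ (derivative g) / algebraMap F[X] _ h) -
      algebraMap (RatFunc F) K x *
      algebraMap (RatFunc F) K (algebraMap F[X] _ (derivative h) / algebraMap F[X] _ h) := by
    rw [map_div₀, map_div₀, ← IsScalarTower.algebraMap_apply F[X] (RatFunc F) K,
      ← IsScalarTower.algebraMap_apply F[X] (RatFunc F) K,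
      ← IsScalarTower.algebraMap_apply F[X] (RatFunc F) K]
    field_simp
    linear_combination e2
  have hfrac : ∀ f : F[X], f.natDegree ≤ h.natDegree →
      (algebraMap F[X] (RatFunc F) (derivative f) / algebraMap F[X] _ h).intDegree ≤ 0 := by
    intro f hf
    by_cases h0 : derivative f = 0
    · simp [h0]
    · rw [RatFunc.intDegree_div (by simpa using h0) hh1, RatFunc.intDegree_polynomial,
          RatFunc.intDegree_polynomial]
      have := natDegree_derivative_le f
      omega
  have hgh : g.natDegree ≤ h.natDegree := by
    by_cases h0 : g = 0
    · simp [h0]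
    · rw [← e, RatFunc.intDegree_div (by simpa using h0) hh1, RatFunc.intDegree_polynomial,
          RatFunc.intDegree_polynomial] at hxd
      omega
  rw [e3]
  exact sub_mem (S := Subring K) (inf_mem F K B hB (hfrac g hgh)) (mul_mem (inf_mem F K B hB hxd)
    (inf_mem F K B hB (hfrac h le_rfl)))

lemma exists_setup_aux (p : ℕ) [Fact p.Prime] [CharP F p] [CharP K p] : Nonempty (FFSetup K p) := by
  obtain ⟨D, hD⟩ := exists_der F K
  have hDt : D (algebraMap F[X] K X) = 1 := by rw [hD]; simp
  have hpow := powD_of_expn (p := p) D hDt (fun y => expn_all (F := F) y)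
  have hFt : Fintype F := Fintype.ofFinite F
  exact ⟨{
    O1 := Ocl F[X] K
    O2 := Ocl B K
    t := algebraMap F[X] K X
    t_ne := by
      rw [IsScalarTower.algebraMap_apply F[X] (RatFunc F) K]; simpa using RatFunc.X_ne_zero
    t_mem := isIntegral_algebraMap
    tinv_mem := by
      have := inf_t_mem F K B hB 1 (x := 1) (by simp)
      simpa using this
    ded1 := Ocl_ded F[X] (RatFunc F) K
    ded2 := Ocl_ded B (RatFunc F) K
    frac1 := Ocl_frac F[X] (RatFunc F) K
    frac2 := Ocl_frac B (RatFunc F) K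
    fin := inf_fin F K B hB
    bdd2 := inf_bdd2 F K B hB
    D := D
    bD1 := Ocl_bD F[X] (RatFunc F) K D (fun f => by rw [hD]; exact isIntegral_algebraMap)
    bD2 := Ocl_bD B (RatFunc F) K D (inf_D F K B hB D hD)
    powD := hpow
    kerD := kerD_of_powD D hpow
    H1 := inf_H1 F K B hB
    cl := by
      have : FunctionField F K := inferInstance
      have : Finite (ClassGroup (FunctionField.ringOfIntegers F K)) := inferInstance
      exact this }⟩

end inf

open scoped Classical in
/-- The valuation ring at infinity. -/
noncomputable abbrev A2 (F : Type*) [Field F] := (RatFunc.inftyValuation F).valuationSubring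

lemma mem_A2 {F : Type*} [Field F] {x : RatFunc F} : x ∈ A2 F ↔ x.intDegree ≤ 0 := by
  classical
  rw [Valuation.mem_valuationSubring_iff]
  by_cases h : x = 0
  · simp [h]
  · rw [RatFunc.inftyValuation_apply, RatFunc.inftyValuation_of_nonzero _ h, ← WithZero.exp_zero,
      WithZero.exp_le_exp]

theorem exists_setup (F K : Type*) [Field F] [Finite F] [Field K] [Algebra (RatFunc F) K]
    [FiniteDimensional (RatFunc F) K] [Algebra.IsSeparable (RatFunc F) K]
    (p : ℕ) [Fact p.Prime] [CharP F p] [CharP K p] : Nonempty (FFSetup K p) := by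
  letI : Algebra F[X] K := ((algebraMap (RatFunc F) K).comp (algebraMap F[X] (RatFunc F))).toAlgebra
  haveI : IsScalarTower F[X] (RatFunc F) K := IsScalarTower.of_algebraMap_eq' rfl
  letI : Algebra F K := ((algebraMap F[X] K).comp (algebraMap F F[X])).toAlgebra
  haveI : IsScalarTower F F[X] K := IsScalarTower.of_algebraMap_eq' rfl
  letI : Algebra (A2 F) K := ((algebraMap (RatFunc F) K).comp (algebraMap (A2 F) (RatFunc F))).toAlgebra
  haveI : IsScalarTower (A2 F) (RatFunc F) K := IsScalarTower.of_algebraMap_eq' rfl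
  exact exists_setup_aux F K (A2 F) (fun x => ⟨fun ⟨b, hb⟩ => hb ▸ mem_A2.1 b.2,
    fun h => ⟨⟨x, mem_A2.2 h⟩, rfl⟩⟩) p

end PartFI


lemma fg_split {K : Type*} [Field K] [DecidableEq K] {p : ℕ} [Fact p.Prime] [CharP K p]
    (S : FFSetup K p) (W : WeierstrassCurve K) (hΔ : W.Δ ≠ 0) (h2 : (2 : K) ≠ 0) {x y z : K}
    (hxy : x ≠ y) (hxz : x ≠ z) (hyz : y ≠ z) (hb : W.b₂ = 4 * -(x + y + z))
    (hc : 2 * W.b₄ = 4 * (x * y + x * z + y * z)) (hd : W.b₆ = 4 * -(x * y * z)) :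
    AddGroup.FG W.toAffine.Point := by
  let C : WeierstrassCurve.VariableChange K := ⟨1, 0, -W.a₁ / 2, -W.a₃ / 2⟩
  refine fg_of_vc W C hΔ ?_
  have hΔ' : (C • W).Δ ≠ 0 := by
    rw [WeierstrassCurve.variableChange_Δ]
    simpa [C] using hΔ
  have h4 : (4 : K) ≠ 0 := by
    rw [show (4 : K) = 2 * 2 by norm_num]; exact mul_ne_zero h2 h2
  simp only [WeierstrassCurve.b₂, WeierstrassCurve.b₄, WeierstrassCurve.b₆] at hb hc hd
  refine S.fg_of_weak hΔ' (weak_split S hΔ' h2 hxy hxz hyz ?_ ?_ ?_ ?_ ?_)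
  · simp only [WeierstrassCurve.variableChange_a₁, C, inv_one, Units.val_one]
    field_simp; ring
  · simp only [WeierstrassCurve.variableChange_a₃, C, inv_one, Units.val_one]
    field_simp; ring
  · simp only [WeierstrassCurve.variableChange_a₂, C, inv_one, Units.val_one]
    apply mul_left_cancel₀ h4
    field_simp
    linear_combination hb
  · simp only [WeierstrassCurve.variableChange_a₄, C, inv_one, Units.val_one]
    apply mul_left_cancel₀ h4
    field_simp
    apply mul_left_cancel₀ h2
    linear_combination hc
  · simp only [WeierstrassCurve.variableChange_a₆, C, inv_one, Units.val_one]
    apply mul_left_cancel₀ h4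
    field_simp
    linear_combination hd

open Polynomial in
lemma fg_sep (F K : Type*) [Field F] [Finite F] [Field K] [DecidableEq K] [Algebra (RatFunc F) K]
    [FiniteDimensional (RatFunc F) K] [Algebra.IsSeparable (RatFunc F) K]
    (p : ℕ) [Fact p.Prime] [CharP F p] [CharP K p] (W : WeierstrassCurve K) (hΔ : W.Δ ≠ 0) :
    AddGroup.FG W.toAffine.Point := by
  classical
  by_cases hp2 : p = 2
  · subst hp2
    obtain ⟨S⟩ := exists_setup F K 2
    exact S.fg_two W hΔ
  have h2 : (2 : K) ≠ 0 := by
    intro h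
    have h' : ((2 : ℕ) : K) = 0 := by exact_mod_cast h
    rw [CharP.cast_eq_zero_iff K p] at h'
    exact hp2 ((Nat.prime_dvd_prime_iff_eq Fact.out Nat.prime_two).1 h')
  have h4 : (4 : K) ≠ 0 := by
    rw [show (4 : K) = 2 * 2 by norm_num]; exact mul_ne_zero h2 h2
  have hd : W.twoTorsionPolynomial.discr ≠ 0 := by
    rw [WeierstrassCurve.twoTorsionPolynomial_discr, show (16 : K) = 4 * 4 by norm_num]
    exact mul_ne_zero (mul_ne_zero h4 h4) hΔ
  have ha : W.twoTorsionPolynomial.a ≠ 0 := h4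
  set f := W.twoTorsionPolynomial.toPoly with hf
  let L := f.SplittingField
  have hs : (f.map (algebraMap K L)).Splits := SplittingField.splits f
  have hsep : f.Separable := by
    have h := (Cubic.discr_ne_zero_iff_roots_nodup ha hs).1 hd
    rw [Cubic.map_roots] at h
    rw [← separable_map (algebraMap K L), ← nodup_roots_iff_of_splits _ hs]
    · exact h
    · rw [Polynomial.map_ne_zero_iff (algebraMap K L).injective]
      exact Cubic.ne_zero_of_a_ne_zero ha
  have : IsGalois K L := IsGalois.of_separable_splitting_field hsep
  have : Algebra.IsSeparable (RatFunc F) L := Algebra.IsSeparable.trans (RatFunc F) K L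
  have : FiniteDimensional (RatFunc F) L := FiniteDimensional.trans (RatFunc F) K L
  have : CharP L p := charP_of_injective_algebraMap (algebraMap K L).injective p
  obtain ⟨S⟩ := exists_setup F L p
  obtain ⟨x, y, z, hr⟩ := (Cubic.splits_iff_roots_eq_three ha).1 hs
  obtain ⟨hxy, hxz, hyz⟩ := (Cubic.discr_ne_zero_iff_roots_ne ha hr).1 hd
  have hb := Cubic.b_eq_three_roots ha hr
  have hc := Cubic.c_eq_three_roots ha hr
  have hd := Cubic.d_eq_three_roots ha hr
  simp only [WeierstrassCurve.twoTorsionPolynomial, map_mul, map_ofNat] at hb hc hd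
  refine fg_of_inj (mapHom W (algebraMap K L)) (mapHom_injective W _) ?_
  refine fg_split S _ ?_ ?_ hxy hxz hyz ?_ ?_ ?_
  · rw [WeierstrassCurve.map_Δ]; simpa using hΔ
  · have := (map_ne_zero (algebraMap K L)).2 h2
    simpa only [map_ofNat] using this
  · rw [WeierstrassCurve.map_b₂, hb]
  · rw [WeierstrassCurve.map_b₄, hc]
  · rw [WeierstrassCurve.map_b₆, hd]

open scoped Classical in
/-- **Mordell–Weil–Lang–Néron theorem**: if `K` is a function field over a finite field `Fq`
(i.e. a finite extension of the rational function field `Fq(t)`) and `E` is an elliptic curve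
over `K` (a Weierstrass curve with nonzero discriminant), then the group `E(K)` of `K`-rational
points is a finitely generated abelian group. -/
theorem mordell_weil_lang_neron
    (Fq K : Type*) [Field Fq] [Fintype Fq] [Field K]
    [Algebra (RatFunc Fq) K] (hK : FunctionField Fq K)
    (W : WeierstrassCurve K) (hΔ : W.Δ ≠ 0) :
    AddGroup.FG W.toAffine.Point := by
  obtain ⟨p, hchar⟩ := CharP.exists Fq
  have hp : Fact p.Prime := ⟨CharP.char_is_prime Fq p⟩
  let K' := separableClosure (RatFunc Fq) K
  have : CharP (RatFunc Fq) p := charP_of_injective_algebraMap (algebraMap Fq (RatFunc Fq)).injective p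
  have : CharP K' p := charP_of_injective_algebraMap (algebraMap (RatFunc Fq) K').injective p
  have : ExpChar K' p := ExpChar.prime hp.out
  let φ : K →+* K' := IsPurelyInseparable.iterateFrobenius K' K p le_rfl
  refine fg_of_inj (mapHom W φ) (mapHom_injective W φ) ?_
  refine fg_sep Fq K' p _ ?_
  rw [WeierstrassCurve.map_Δ]; simpa using hΔ
end

section
/- Let E₀ be an elliptic curve over a finite field 𝔽_q and let E = E₀ ×_{𝔽_q} K be its base change to the rational function field K = 𝔽_q(t) (i.e., E is defined by the same Weierstrass equation, with coefficients viewed in K). Then the natural inclusion E₀(𝔽_q) → E(K) induced by the embedding 𝔽_q ⊂ K is a bijection; that is, every K-rational point of E has coordinates in 𝔽_q, so E(K) = E₀(𝔽_q). -/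
open WeierstrassCurve

namespace CCP
open Polynomial

section
variable {R S : Type*} [CommRing R] [CommRing S]

def G (V : WeierstrassCurve R) (a b c : R) : R :=
  b^2 + V.a₁*a*b*c + V.a₃*b*c^3 - (a^3 + V.a₂*a^2*c^2 + V.a₄*a*c^4 + V.a₆*c^6)
def P (V : WeierstrassCurve R) (a b c : R) : R := 2*b + V.a₁*a*c + V.a₃*c^3
def Q (V : WeierstrassCurve R) (a b c : R) : R :=
  3*a^2 + 2*V.a₂*a*c^2 + V.a₄*c^4 - V.a₁*b*c

lemma map_G (f : R →+* S) (V : WeierstrassCurve R) (a b c : R) :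
    f (G V a b c) = G (V.map f) (f a) (f b) (f c) := by simp [G]
lemma map_P (f : R →+* S) (V : WeierstrassCurve R) (a b c : R) :
    f (P V a b c) = P (V.map f) (f a) (f b) (f c) := by simp [P, map_ofNat f]
lemma map_Q (f : R →+* S) (V : WeierstrassCurve R) (a b c : R) :
    f (Q V a b c) = Q (V.map f) (f a) (f b) (f c) := by simp [Q, map_ofNat f]
end

lemma sing {L : Type*} [Field L] (V : WeierstrassCurve L) (hΔ : V.Δ ≠ 0) (a b c : L)
    (hG : G V a b c = 0) (hP : P V a b c = 0) (hQ : Q V a b c = 0) :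
    a = 0 ∧ b = 0 ∧ c = 0 := by
  have hc : c = 0 := by
    by_contra hc
    have h1 : V.toAffine.Equation (a/c^2) (b/c^3) := by
      rw [Affine.equation_iff']
      have : b ^ 2 * c^0 + V.a₁*a*b*c + V.a₃*b*c^3 - (a^3 + V.a₂*a^2*c^2 + V.a₄*a*c^4 + V.a₆*c^6) = 0 := by
        rw [← hG, G]; ring
      field_simp
      linear_combination this
    rw [Affine.equation_iff_nonsingular_of_Δ_ne_zero hΔ, Affine.nonsingular_iff'] at h1
    rcases h1.2 with h | h
    · apply h
      unfold Q at hQ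
      field_simp
      linear_combination -hQ
    · apply h
      unfold P at hP
      field_simp
      linear_combination hP
  subst hc
  simp only [G, P, Q] at hG hP hQ
  have ha : a = 0 := by
    have : a^4 = 0 := by linear_combination (-4*a) * hG + (2*b*a)*hP - a^2*hQ
    simpa using this
  subst ha
  refine ⟨rfl, ?_, rfl⟩
  have : b^2 = 0 := by linear_combination hG
  simpa using this

section
variable {F : Type*} [Field F]

/-- top coefficient -/
def T (n : ℕ) (p : F[X]) (c : F) : Prop := p.natDegree ≤ n ∧ p.coeff n = c

lemma T.mul {m n : ℕ} {p q : F[X]} {a b : F} (hp : T m p a) (hq : T n q b) :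
    T (m+n) (p*q) (a*b) := by
  refine ⟨natDegree_mul_le_of_le hp.1 hq.1, ?_⟩
  rw [← hp.2, ← hq.2]
  exact coeff_mul_add_eq_of_natDegree_le hp.1 hq.1
lemma T.pow {n : ℕ} {p : F[X]} {a : F} (hp : T n p a) (m : ℕ) :
    T (m*n) (p^m) (a^m) :=
  ⟨natDegree_pow_le_of_le m hp.1, by rw [← hp.2]; exact coeff_pow_of_natDegree_le hp.1⟩
lemma T.add {n : ℕ} {p q : F[X]} {a b : F} (hp : T n p a) (hq : T n q b) :
    T n (p+q) (a+b) :=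
  ⟨natDegree_add_le_of_degree_le hp.1 hq.1, by rw [coeff_add, hp.2, hq.2]⟩
lemma T.sub {n : ℕ} {p q : F[X]} {a b : F} (hp : T n p a) (hq : T n q b) :
    T n (p-q) (a-b) :=
  ⟨natDegree_sub_le_of_le hp.1 hq.1 |>.trans (by simp), by rw [coeff_sub, hp.2, hq.2]⟩
lemma T.C (a : F) : T 0 (C a) a := ⟨by simp, by simp⟩
lemma T.cast {m n : ℕ} {p : F[X]} {a : F} (hp : T m p a) (h : m = n) : T n p a := h ▸ hp

lemma T_G (W : WeierstrassCurve F) {d : ℕ} {A B D : F[X]} {a b c : F}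
    (hA : T (2*d) A a) (hB : T (3*d) B b) (hD : T d D c) :
    T (6*d) (G (W.map C) A B D) (G W a b c) := by
  simp only [G, map_a₁, map_a₂, map_a₃, map_a₄, map_a₆]
  exact ((((hB.pow 2).cast (by ring)).add
    (((((T.C _).mul hA).mul hB).mul hD).cast (by ring))).add
    ((((T.C _).mul hB).mul (hD.pow 3)).cast (by ring))).sub
    (((((hA.pow 3).cast (by ring)).add
    ((((T.C _).mul (hA.pow 2)).mul (hD.pow 2)).cast (by ring))).add
    ((((T.C _).mul hA).mul (hD.pow 4)).cast (by ring))).add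
    (((T.C _).mul (hD.pow 6)).cast (by ring)))

lemma T_P (W : WeierstrassCurve F) {d : ℕ} {A B D : F[X]} {a b c : F}
    (hA : T (2*d) A a) (hB : T (3*d) B b) (hD : T d D c) :
    T (3*d) (P (W.map C) A B D) (P W a b c) := by
  simp only [P, map_a₁, map_a₂, map_a₃, map_a₄, map_a₆]
  have h2 : T (F := F) 0 2 2 := T.C 2
  exact (((h2.mul hB).cast (by ring)).add
    ((((T.C _).mul hA).mul hD).cast (by ring))).add
    (((T.C _).mul (hD.pow 3)).cast (by ring))

lemma T_Q (W : WeierstrassCurve F) {d : ℕ} {A B D : F[X]} {a b c : F}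
    (hA : T (2*d) A a) (hB : T (3*d) B b) (hD : T d D c) :
    T (4*d) (Q (W.map C) A B D) (Q W a b c) := by
  simp only [Q, map_a₁, map_a₂, map_a₃, map_a₄, map_a₆]
  have h2 : T (F := F) 0 2 2 := T.C 2
  have h3 : T (F := F) 0 3 3 := T.C 3
  exact ((((h3.mul (hA.pow 2)).cast (by ring)).add
    ((((h2.mul (T.C _)).mul hA).mul (hD.pow 2)).cast (by ring))).add
    (((T.C _).mul (hD.pow 4)).cast (by ring))).sub
    ((((T.C _).mul hB).mul hD).cast (by ring))

lemma term_lt (a : F) (A B D : F[X]) (i j k n : ℕ)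
    (h : i * A.natDegree + j * B.natDegree + k * D.natDegree < n) :
    (C a * A^i * B^j * D^k).coeff n = 0 := by
  apply coeff_eq_zero_of_natDegree_lt
  refine lt_of_le_of_lt ?_ h
  refine natDegree_mul_le_of_le (natDegree_mul_le_of_le ?_ natDegree_pow_le) natDegree_pow_le
  exact (natDegree_C_mul_le _ _).trans natDegree_pow_le

lemma G_expand (W : WeierstrassCurve F) (A B D : F[X]) (h : G (W.map C) A B D = 0) :
    B^2 + C W.a₁ * A^1 * B^1 * D^1 + C W.a₃ * A^0 * B^1 * D^3 =
     A^3 + C W.a₂ * A^2 * B^0 * D^2 + C W.a₄ * A^1 * B^0 * D^4 + C W.a₆ * A^0 * B^0 * D^6 := by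
  simp only [G, map_a₁, map_a₂, map_a₃, map_a₄, map_a₆] at h
  linear_combination h

lemma coeff_sq_ne {B : F[X]} (hB : B ≠ 0) (k : ℕ) : (B^k).coeff (k * B.natDegree) ≠ 0 := by
  rw [← natDegree_pow, coeff_natDegree]
  simp [hB]

lemma deg_bounds (W : WeierstrassCurve F) (A B D : F[X]) (hD : D ≠ 0)
    (h : G (W.map C) A B D = 0) : ∃ d, A.natDegree ≤ 2*d ∧ B.natDegree ≤ 3*d ∧ D.natDegree ≤ d ∧
      (A.coeff (2*d) ≠ 0 ∨ D.coeff d ≠ 0) := by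
  have h := G_expand W A B D h
  by_cases hA : A.natDegree ≤ 2 * D.natDegree
  · refine ⟨D.natDegree, hA, ?_, le_rfl, Or.inr (by simpa using hD)⟩
    by_contra hB
    push Not at hB
    have hB0 : B ≠ 0 := by rintro rfl; simp at hB
    apply coeff_sq_ne hB0 2
    have := congrArg (fun p => p.coeff (2 * B.natDegree)) h
    simp only [coeff_add] at this
    have e : A^3 = C 1 * A^3 * B^0 * D^0 := by simp
    rw [e] at this
    repeat rw [term_lt (n := 2 * B.natDegree) _ _ _ _ _ _ _ (by omega)] at this
    simpa using this
  · push Not at hA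
    have hA0 : A ≠ 0 := by rintro rfl; simp at hA
    have key : 2 * B.natDegree = 3 * A.natDegree := by
      rcases lt_trichotomy (2 * B.natDegree) (3 * A.natDegree) with hl | hl | hl
      · exfalso
        apply coeff_sq_ne hA0 3
        have := congrArg (fun p => p.coeff (3 * A.natDegree)) h
        simp only [coeff_add] at this
        have e : B^2 = C 1 * A^0 * B^2 * D^0 := by simp
        rw [e] at this
        repeat rw [term_lt (n := 3 * A.natDegree) _ _ _ _ _ _ _ (by omega)] at this
        simpa using this.symm
      · exact hl
      · exfalso
        have hB0 : B ≠ 0 := by rintro rfl; simp at hl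
        apply coeff_sq_ne hB0 2
        have := congrArg (fun p => p.coeff (2 * B.natDegree)) h
        simp only [coeff_add] at this
        have e : A^3 = C 1 * A^3 * B^0 * D^0 := by simp
        rw [e] at this
        repeat rw [term_lt (n := 2 * B.natDegree) _ _ _ _ _ _ _ (by omega)] at this
        simpa using this
    refine ⟨A.natDegree / 2, by omega, by omega, by omega, Or.inl ?_⟩
    rw [show 2 * (A.natDegree / 2) = A.natDegree by omega]
    simpa using hA0

lemma coprime_PQ (W : WeierstrassCurve F) (hΔ : W.Δ ≠ 0) (A B D : F[X]) (hAD : IsCoprime A D)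
    (h : G (W.map C) A B D = 0) : IsCoprime (P (W.map C) A B D) (Q (W.map C) A B D) := by
  by_contra hn
  have : ∃ π : F[X], Prime π ∧ π ∣ P (W.map C) A B D ∧ π ∣ Q (W.map C) A B D := by
    by_cases h0 : P (W.map C) A B D = 0 ∧ Q (W.map C) A B D = 0
    · exact ⟨X, prime_X, by simp [h0.1], by simp [h0.2]⟩
    · by_contra hc
      push Not at hc
      exact hn (isCoprime_of_prime_dvd h0 fun z hz h1 h2 => hc z hz h1 h2)
  obtain ⟨π, hπ, h1, h2⟩ := this
  have : Fact (Irreducible π) := ⟨hπ.irreducible⟩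
  let f := AdjoinRoot.mk π
  have hs := sing ((W.map C).map f) (by
    rw [map_Δ, map_Δ]
    have hu : IsUnit (f (C W.Δ)) := ((isUnit_iff_ne_zero.2 hΔ).map C).map f
    exact hu.ne_zero) (f A) (f B) (f D) (by rw [← map_G, h, map_zero])
    (by rw [← map_P]; exact AdjoinRoot.mk_eq_zero.2 h1)
    (by rw [← map_Q]; exact AdjoinRoot.mk_eq_zero.2 h2)
  exact hπ.not_isUnit (hAD.isUnit_of_dvd' (AdjoinRoot.mk_eq_zero.1 hs.1) (AdjoinRoot.mk_eq_zero.1 hs.2.2))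

lemma coprime_BD (W : WeierstrassCurve F) (A B D : F[X]) (hAD : IsCoprime A D)
    (h : G (W.map C) A B D = 0) : IsCoprime B D := by
  have h3 : IsCoprime (A^3) D := hAD.pow_left
  simp only [G] at h
  set V := W.map (C : F →+* F[X])
  have : A^3 = B * (B + V.a₁*A*D + V.a₃*D^3) + D * (-(V.a₂*A^2*D + V.a₄*A*D^3 + V.a₆*D^5)) := by
    linear_combination -h
  rw [this, IsCoprime.add_mul_left_left_iff] at h3
  exact h3.of_mul_left_left

lemma deriv_zero (W : WeierstrassCurve F) (hΔ : W.Δ ≠ 0) (A B D : F[X]) (hD : D ≠ 0)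
    (hAD : IsCoprime A D) (h : G (W.map C) A B D = 0) :
    derivative A = 0 ∧ derivative B = 0 ∧ derivative D = 0 := by
  have hPQ := coprime_PQ W hΔ A B D hAD h
  have hBD := coprime_BD W A B D hAD h
  obtain ⟨d, dA, dB, dD, htop⟩ := deg_bounds W A B D hD h
  have hrel : (derivative A * D - 2 * A * derivative D) * Q (W.map C) A B D =
      (derivative B * D - 3 * B * derivative D) * P (W.map C) A B D := by
    have h' := congrArg derivative h
    simp only [G, P, Q, map_a₁, map_a₂, map_a₃, map_a₄, map_a₆] at h h' ⊢
    simp only [derivative_sub, derivative_add, derivative_mul, derivative_pow, derivative_C,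
      derivative_zero, Nat.cast_ofNat, map_ofNat] at h'
    linear_combination (-D) * h' + (6 * derivative D) * h
  obtain ⟨u, v, huv⟩ := hPQ
  obtain ⟨k, hk, hN2⟩ : ∃ k, derivative A * D - 2 * A * derivative D = P (W.map C) A B D * k ∧
      derivative B * D - 3 * B * derivative D = Q (W.map C) A B D * k := by
    refine ⟨u * (derivative A * D - 2 * A * derivative D) +
      v * (derivative B * D - 3 * B * derivative D), ?_, ?_⟩
    · linear_combination v * hrel - (derivative A * D - 2 * A * derivative D) * huv
    · linear_combination -u * hrel - (derivative B * D - 3 * B * derivative D) * huv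
  rcases Nat.eq_zero_or_pos d with rfl | hd
  · rw [derivative_of_natDegree_zero (by omega), derivative_of_natDegree_zero (by omega),
      derivative_of_natDegree_zero (by omega)]
    simp
  have eA := natDegree_derivative_le A
  have eB := natDegree_derivative_le B
  have eD := natDegree_derivative_le D
  have n2 : natDegree (2 : F[X]) ≤ 0 := by compute_degree
  have n3 : natDegree (3 : F[X]) ≤ 0 := by compute_degree
  have hk0 : k = 0 := by
    by_contra hk0
    have tA : T (2*d) A _ := ⟨dA, rfl⟩
    have tB : T (3*d) B _ := ⟨dB, rfl⟩
    have tD : T d D _ := ⟨dD, rfl⟩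
    have hGt := (T_G W tA tB tD).2
    rw [h, coeff_zero] at hGt
    have : P W (A.coeff (2*d)) (B.coeff (3*d)) (D.coeff d) ≠ 0 ∨
        Q W (A.coeff (2*d)) (B.coeff (3*d)) (D.coeff d) ≠ 0 := by
      by_contra hc
      push Not at hc
      obtain ⟨s1, -, s2⟩ := sing W hΔ _ _ _ hGt.symm hc.1 hc.2
      simp [s1, s2] at htop
    rcases this with hc | hc
    · rw [← (T_P W tA tB tD).2] at hc
      have l1 := le_natDegree_of_ne_zero hc
      have l2 := congrArg natDegree hk
      rw [natDegree_mul (by rintro h0; simp [h0] at hc) hk0] at l2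
      have l3 : natDegree (derivative A * D - 2 * A * derivative D) ≤ 3*d-1 := by
        refine (natDegree_sub_le_of_le (m := 3*d-1) (n := 3*d-1) ?_ ?_).trans (by simp)
        · exact (natDegree_mul_le).trans (by omega)
        · exact (natDegree_mul_le_of_le (natDegree_mul_le_of_le n2 dA) eD).trans (by omega)
      omega
    · rw [← (T_Q W tA tB tD).2] at hc
      have l1 := le_natDegree_of_ne_zero hc
      have l2 := congrArg natDegree hN2
      rw [natDegree_mul (by rintro h0; simp [h0] at hc) hk0] at l2
      have l3 : natDegree (derivative B * D - 3 * B * derivative D) ≤ 4*d-1 := by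
        refine (natDegree_sub_le_of_le (m := 4*d-1) (n := 4*d-1) ?_ ?_).trans (by simp)
        · exact (natDegree_mul_le).trans (by omega)
        · exact (natDegree_mul_le_of_le (natDegree_mul_le_of_le n3 dB) eD).trans (by omega)
      omega
  rw [hk0, mul_zero] at hk hN2
  have small : ∀ c : F[X], natDegree c ≤ 0 → D ∣ c * derivative D → c * derivative D = 0 := by
    intro c hc hdv
    by_cases hDd : D.natDegree = 0
    · rw [derivative_of_natDegree_zero hDd, mul_zero]
    · refine eq_zero_of_dvd_of_natDegree_lt hdv ?_
      have := natDegree_mul_le_of_le hc eD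
      omega
  have s2 : 2 * derivative D = 0 := small 2 n2
    (hAD.symm.dvd_of_dvd_mul_left ⟨derivative A, by linear_combination -hk⟩)
  have s3 : 3 * derivative D = 0 := small 3 n3
    (hBD.symm.dvd_of_dvd_mul_left ⟨derivative B, by linear_combination -hN2⟩)
  refine ⟨?_, ?_, by linear_combination s3 - s2⟩
  · apply mul_right_cancel₀ hD
    linear_combination hk + A * s2
  · apply mul_right_cancel₀ hD
    linear_combination hN2 + B * s3

lemma const_of (p : ℕ) [CharP F p] (hp : p.Prime) (W : WeierstrassCurve F) (hΔ : W.Δ ≠ 0) (n : ℕ) :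
    ∀ (A B D : F[X]), A.natDegree + B.natDegree + D.natDegree = n → D ≠ 0 →
    IsCoprime A D → G (W.map C) A B D = 0 →
    A.natDegree = 0 ∧ B.natDegree = 0 ∧ D.natDegree = 0 := by
  induction n using Nat.strong_induction_on with
  | _ n ih =>
    intro A B D hn hD hAD h
    by_cases h0 : n = 0
    · omega
    obtain ⟨hA', hB', hD'⟩ := deriv_zero W hΔ A B D hD hAD h
    have hA := expand_contract p hA' hp.ne_zero
    have hB := expand_contract p hB' hp.ne_zero
    have hDD := expand_contract p hD' hp.ne_zero
    generalize contract p A = A1 at hA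
    generalize contract p B = B1 at hB
    generalize contract p D = D1 at hDD
    subst hA hB hDD
    rw [isCoprime_expand hp.ne_zero] at hAD
    rw [expand_ne_zero hp.pos] at hD
    simp only [natDegree_expand] at hn ⊢
    have hG : G (W.map C) A1 B1 D1 = 0 := by
      apply expand_injective hp.pos
      rw [map_zero, ← h]
      simp [G]
    have := hp.two_le
    have hlt : A1.natDegree + B1.natDegree + D1.natDegree < n := by
      rw [← hn, ← add_mul, ← add_mul]
      refine lt_mul_of_one_lt_right (Nat.pos_of_ne_zero fun hz => h0 ?_) hp.one_lt
      rw [← hn, ← add_mul, ← add_mul, hz, zero_mul]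
    obtain ⟨r1, r2, r3⟩ := ih (A1.natDegree + B1.natDegree + D1.natDegree)
      hlt A1 B1 D1 rfl hD hAD hG
    simp [r1, r2, r3]

/-- numerators and denominators -/
lemma param (W : WeierstrassCurve F) (n m u v : F[X]) (hm : m.Monic) (hv : v.Monic)
    (hnm : IsCoprime n m) (huv : IsCoprime u v)
    (h : u^2*m^3 + C W.a₁*n*u*v*m^2 + C W.a₃*u*v*m^3 =
      v^2*(n^3 + C W.a₂*n^2*m + C W.a₄*n*m^2 + C W.a₆*m^3)) :
    ∃ w : F[X], w ≠ 0 ∧ m = w^2 ∧ v = w^3 := by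
  set S := n^3 + C W.a₂*n^2*m + C W.a₄*n*m^2 + C W.a₆*m^3 with hS
  have hSm : IsCoprime S m := by
    have : S = n^3 + m * (C W.a₂*n^2 + C W.a₄*n*m + C W.a₆*m^2) := by rw [hS]; ring
    rw [this, IsCoprime.add_mul_left_left_iff]
    exact hnm.pow_left
  have hm0 := hm.ne_zero
  have hmv : m ∣ v := by
    have : m^2 ∣ v^2 := by
      refine (hSm.symm.pow_left (m := 2)).dvd_of_dvd_mul_right (z := S)
        ⟨u^2*m + C W.a₁*n*u*v + C W.a₃*u*v*m, ?_⟩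
      rw [← h]; ring
    exact (IsIntegrallyClosed.pow_dvd_pow_iff two_ne_zero).1 this
  obtain ⟨w, rfl⟩ := hmv
  have hw : w.Monic := hm.of_mul_monic_left hv
  have hw0 := hw.ne_zero
  have huw : IsCoprime u w := huv.of_mul_right_right
  have h2 : u^2*m + C W.a₁*n*u*w*m + C W.a₃*u*w*m^2 = w^2*S := by
    apply mul_left_cancel₀ (pow_ne_zero 2 hm0)
    linear_combination h
  have hwm : w ∣ m := by
    refine (huw.symm.pow_right (n := 2)).dvd_of_dvd_mul_left
      ⟨w * S - C W.a₁*n*u*m - C W.a₃*u*m^2, ?_⟩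
    linear_combination h2
  obtain ⟨k, rfl⟩ := hwm
  have hk : k.Monic := hw.of_mul_monic_left hm
  have h3 : k*(u^2 + C W.a₁*n*u*w + C W.a₃*u*w^2*k) = w*S := by
    apply mul_left_cancel₀ hw0
    linear_combination h2
  have hwk : w ∣ k := by
    refine (huw.symm.pow_right (n := 2)).dvd_of_dvd_mul_left
      ⟨S - C W.a₁*n*u*k - C W.a₃*u*w*k^2, ?_⟩
    linear_combination h3
  have hkw : k ∣ w := by
    have hSk : IsCoprime S k := hSm.of_mul_right_right
    exact hSk.symm.dvd_of_dvd_mul_right ⟨_, h3.symm⟩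
  have : k = w := eq_of_monic_of_associated hk hw (associated_of_dvd_dvd hkw hwk)
  subst this
  exact ⟨k, hw0, by ring, by ring⟩

lemma coords (p : ℕ) [CharP F p] (hp : p.Prime) (W : WeierstrassCurve F) (hΔ : W.Δ ≠ 0)
    (x y : RatFunc F) (h : (W.map (algebraMap F (RatFunc F))).toAffine.Equation x y) :
    ∃ x0 y0 : F, algebraMap F (RatFunc F) x0 = x ∧ algebraMap F (RatFunc F) y0 = y := by
  rw [Affine.equation_iff] at h
  simp only [map_a₁, map_a₂, map_a₃, map_a₄, map_a₆] at h
  let φ := algebraMap F[X] (RatFunc F)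
  have hφ : Function.Injective φ := RatFunc.algebraMap_injective F
  have hC : ∀ a : F, algebraMap F (RatFunc F) a = φ (C a) := fun a => by
    rw [IsScalarTower.algebraMap_apply F F[X] (RatFunc F)]; rfl
  have hx : φ x.num / φ x.denom = x := RatFunc.num_div_denom x
  have hy : φ y.num / φ y.denom = y := RatFunc.num_div_denom y
  have cx := RatFunc.isCoprime_num_denom x
  have cy := RatFunc.isCoprime_num_denom y
  have mx := RatFunc.monic_denom x
  have my := RatFunc.monic_denom y
  generalize x.num = n at *
  generalize x.denom = m at *
  generalize y.num = u at *
  generalize y.denom = v at *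
  have hm0 : φ m ≠ 0 := (map_ne_zero_iff φ hφ).2 mx.ne_zero
  have hv0 : φ v ≠ 0 := (map_ne_zero_iff φ hφ).2 my.ne_zero
  subst hx hy
  simp only [hC] at h ⊢
  have hpoly : u^2*m^3 + C W.a₁*n*u*v*m^2 + C W.a₃*u*v*m^3 =
      v^2*(n^3 + C W.a₂*n^2*m + C W.a₄*n*m^2 + C W.a₆*m^3) := by
    apply hφ
    simp only [map_add, map_mul, map_pow]
    field_simp at h
    linear_combination h
  obtain ⟨w, hw, rfl, rfl⟩ := param W n m u v mx my cx cy hpoly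
  have hG : G (W.map C) n u w = 0 := by
    simp only [G, map_a₁, map_a₂, map_a₃, map_a₄, map_a₆]
    apply mul_left_cancel₀ (pow_ne_zero 6 hw)
    linear_combination hpoly
  have cnw : IsCoprime n w := cx.of_isCoprime_of_dvd_right (dvd_pow_self w two_ne_zero)
  obtain ⟨dn, du, dw⟩ := const_of p hp W hΔ _ n u w rfl hw cnw hG
  rw [natDegree_eq_zero] at dn du dw
  obtain ⟨n, rfl⟩ := dn
  obtain ⟨u, rfl⟩ := du
  obtain ⟨w, rfl⟩ := dw
  refine ⟨n / w^2, u / w^3, ?_, ?_⟩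
  · simp only [← hC, map_pow, map_div₀]
  · simp only [← hC, map_pow, map_div₀]
end
end CCP

open scoped Classical in
/-- If `E₀` is an elliptic curve over a finite field `Fq` and `E` is its base change to the
rational function field `K = Fq(t)`, then the natural inclusion `E₀(Fq) → E(K)` is a bijection:
every `K`-rational point of `E` has coordinates in `Fq`. -/
theorem constant_curve_points
    (Fq : Type*) [Field Fq] [Fintype Fq]
    (W : WeierstrassCurve Fq) (hΔ : W.Δ ≠ 0) :
    Function.Bijective (WeierstrassCurve.Affine.Point.baseChange (W' := W) Fq (RatFunc Fq)) := by
  refine ⟨Affine.Point.map_injective _, ?_⟩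
  rintro (_ | ⟨x, y, h⟩)
  · exact ⟨0, rfl⟩
  · obtain ⟨p, hp⟩ := CharP.exists Fq
    have hpp : p.Prime := CharP.char_is_prime Fq p
    obtain ⟨x0, y0, rfl, rfl⟩ := CCP.coords p hpp W hΔ x y h.1
    exact ⟨.some x0 y0 ((Affine.baseChange_nonsingular (W := W) (f := Algebra.ofId Fq (RatFunc Fq))
      (Algebra.ofId Fq (RatFunc Fq)).injective x0 y0).1 h), rfl⟩
end

section
/- Let K be a function field over a finite field of characteristic p and let E be an elliptic curve over K. Then the j-invariant j(E) is a p-th power in K if and only if there exists an elliptic curve E′ over K such that E is isomorphic over K to E′^{(p)}, the elliptic curve obtained from E′ by raising each of its Weierstrass coefficients to the p-th power. -/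
open WeierstrassCurve

/-- Some change of variables makes all coefficients `p`-th powers. -/
def FrobGood {K : Type*} [Field K] (p : ℕ) (W : WeierstrassCurve K) : Prop :=
  ∃ (C : VariableChange K) (W' : WeierstrassCurve K),
    C • W = ⟨W'.a₁ ^ p, W'.a₂ ^ p, W'.a₃ ^ p, W'.a₄ ^ p, W'.a₆ ^ p⟩

lemma FrobGood.of_smul {K : Type*} [Field K] {p : ℕ} {W : WeierstrassCurve K}
    (C : VariableChange K) (h : FrobGood p (C • W)) : FrobGood p W := by
  obtain ⟨D, W', h⟩ := h
  exact ⟨D * C, W', by rw [mul_smul, h]⟩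

lemma jquot_smul {K : Type*} [Field K] (W : WeierstrassCurve K) (C : VariableChange K) :
    (C • W).c₄ ^ 3 / (C • W).Δ = W.c₄ ^ 3 / W.Δ := by
  rw [variableChange_c₄, variableChange_Δ, mul_pow, ← pow_mul]
  exact mul_div_mul_left _ _ (pow_ne_zero _ (Units.ne_zero _))

lemma Δ_smul_ne {K : Type*} [Field K] (W : WeierstrassCurve K) (C : VariableChange K)
    (h : W.Δ ≠ 0) : (C • W).Δ ≠ 0 := by
  rw [variableChange_Δ]
  exact mul_ne_zero (pow_ne_zero _ (Units.ne_zero _)) h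

lemma exists_pow_mul_pow {K : Type*} [Field K] {p n : ℕ} (h : Nat.Coprime p n) (a : K)
    (ha : a ≠ 0) : ∃ α w : K, w ≠ 0 ∧ (w⁻¹) ^ n * a = α ^ p := by
  refine ⟨a ^ (Nat.gcdA p n), a ^ (Nat.gcdB p n), zpow_ne_zero _ ha, ?_⟩
  have h1 : (1 : ℤ) = p * Nat.gcdA p n + n * Nat.gcdB p n := by
    rw [← Nat.gcd_eq_gcd_ab, h]; rfl
  have h2 : a = (a ^ (Nat.gcdA p n)) ^ p * (a ^ (Nat.gcdB p n)) ^ n := by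
    rw [← zpow_natCast, ← zpow_natCast, ← zpow_mul, ← zpow_mul, ← zpow_add₀ ha,
      mul_comm _ (p : ℤ), mul_comm _ (n : ℤ), ← h1, zpow_one]
  have h3 : a ^ (Nat.gcdB p n) ≠ 0 := zpow_ne_zero _ ha
  rw [inv_pow, inv_mul_eq_iff_eq_mul₀ (pow_ne_zero _ h3), mul_comm]
  exact h2

lemma good_two {K : Type*} [Field K] [CharP K 2] (W : WeierstrassCurve K) (hΔ : W.Δ ≠ 0)
    (g : K) (hg : W.c₄ ^ 3 / W.Δ = g ^ 2) : FrobGood 2 W := by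
  have two : (2 : K) = 0 := CharP.cast_eq_zero K 2
  have three : (3 : K) = 1 := by linear_combination two
  obtain ⟨C, hC⟩ := W.exists_variableChange_isCharTwoNF
  apply FrobGood.of_smul C
  rw [← jquot_smul W C] at hg
  replace hΔ := Δ_smul_ne W C hΔ
  generalize C • W = E at *
  clear C W
  rcases hC with h | h
  · rw [c₄_of_isCharTwoJNeZeroNF_of_char_two, Δ_of_isCharTwoJNeZeroNF_of_char_two] at hg
    rw [Δ_of_isCharTwoJNeZeroNF_of_char_two] at hΔ
    have h6 : E.a₆ = g⁻¹ ^ 2 := by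
      rw [inv_pow, ← hg]; simp
    refine ⟨⟨1, 0, E.a₂, 0⟩, ⟨1, E.a₂, 0, 0, g⁻¹⟩, ?_⟩
    ext
    · simp [variableChange_a₁, two]
    · simp [variableChange_a₂]
      linear_combination -E.a₂ ^ 2 * two
    · simp [variableChange_a₃]
    · simp [variableChange_a₄]
    · simp [variableChange_a₆, h6]
  · rw [Δ_of_isCharTwoJEqZeroNF_of_char_two] at hΔ
    have h3 : E.a₃ ≠ 0 := fun h => hΔ (by rw [h]; ring)
    refine ⟨⟨Units.mk0 E.a₃ h3, 0, E.a₄ / E.a₃, E.a₆ / E.a₃⟩,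
      ⟨0, E.a₃⁻¹ * (E.a₄ / E.a₃), E.a₃⁻¹, 0, E.a₃⁻¹ ^ 3 * (E.a₆ / E.a₃)⟩, ?_⟩
    ext
    · simp [variableChange_a₁, two]
    · simp [variableChange_a₂]
      linear_combination -(E.a₃⁻¹ * (E.a₄ / E.a₃)) ^ 2 * two
    · simp [variableChange_a₃, two]
      field_simp
    · simp [variableChange_a₄, two]
      right
      field_simp
      ring
    · simp [variableChange_a₆]
      field_simp
      linear_combination - E.a₆ ^ 2 * two

lemma good_three {K : Type*} [Field K] [CharP K 3] (W : WeierstrassCurve K) (hΔ : W.Δ ≠ 0)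
    (g : K) (hg : W.c₄ ^ 3 / W.Δ = g ^ 3) : FrobGood 3 W := by
  have three : (3 : K) = 0 := CharP.cast_eq_zero K 3
  obtain ⟨C, hC⟩ := W.exists_variableChange_isCharThreeNF
  apply FrobGood.of_smul C
  rw [← jquot_smul W C] at hg
  replace hΔ := Δ_smul_ne W C hΔ
  generalize C • W = E at *
  clear C W
  rcases hC with h | h
  · rw [c₄_of_isCharThreeJNeZeroNF_of_char_three, Δ_of_isCharThreeJNeZeroNF_of_char_three] at hg
    rw [Δ_of_isCharThreeJNeZeroNF_of_char_three] at hΔ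
    have h2 : E.a₂ ≠ 0 := fun h => hΔ (by rw [h]; ring)
    have h6 : E.a₆ ≠ 0 := fun h => hΔ (by rw [h]; ring)
    have hg' : - E.a₂ ^ 3 = g ^ 3 * E.a₆ := by
      rw [← hg]; field_simp
    have hg0 : g ≠ 0 := by
      rintro rfl
      apply h2
      simpa using hg'
    have h6' : E.a₆ = (-E.a₂ / g) ^ 3 := by
      field_simp
      linear_combination -hg'
    refine ⟨⟨Units.mk0 E.a₂⁻¹ (inv_ne_zero h2), 0, 0, 0⟩,
      ⟨0, E.a₂, 0, 0, E.a₂ ^ 2 * (-E.a₂ / g)⟩, ?_⟩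
    ext
    · simp [variableChange_a₁]
    · simp [variableChange_a₂]
      ring
    · simp [variableChange_a₃]
    · simp [variableChange_a₄]
    · simp [variableChange_a₆]
      rw [h6']
      ring
  · rw [Δ_of_isShortNF_of_char_three] at hΔ
    have h4 : E.a₄ ≠ 0 := fun h => hΔ (by rw [h]; ring)
    refine ⟨⟨Units.mk0 E.a₄ h4, -E.a₆ / E.a₄, 0, 0⟩,
      ⟨0, 0, 0, E.a₄⁻¹, E.a₄⁻¹ ^ 2 * (-E.a₆ / E.a₄)⟩, ?_⟩
    ext
    · simp [variableChange_a₁]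
    · simp [variableChange_a₂, three]
    · simp [variableChange_a₃]
    · simp [variableChange_a₄, three]
      field_simp
    · simp [variableChange_a₆]
      field_simp
      ring

lemma good_ge {K : Type*} [Field K] (p : ℕ) [Fact p.Prime] [CharP K p] (p2 : p ≠ 2) (p3 : p ≠ 3)
    (W : WeierstrassCurve K) (hΔ : W.Δ ≠ 0)
    (g : K) (hg : W.c₄ ^ 3 / W.Δ = g ^ p) : FrobGood p W := by
  have hp : p.Prime := Fact.out
  have hp0 : p ≠ 0 := hp.ne_zero
  have two : (2 : K) ≠ 0 := CharP.cast_ne_zero_of_ne_of_prime K Nat.prime_two p2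
  have three : (3 : K) ≠ 0 := CharP.cast_ne_zero_of_ne_of_prime K Nat.prime_three p3
  have c2 : p.Coprime 2 := (Nat.coprime_primes hp Nat.prime_two).2 p2
  have c3 : p.Coprime 3 := (Nat.coprime_primes hp Nat.prime_three).2 p3
  have c4 : p.Coprime 4 := Nat.Coprime.mul_right c2 c2
  have c6 : p.Coprime 6 := Nat.Coprime.mul_right c2 c3
  let : Invertible (2 : K) := invertibleOfNonzero two
  let : Invertible (3 : K) := invertibleOfNonzero three
  obtain ⟨C, hC⟩ := W.exists_variableChange_isShortNF
  apply FrobGood.of_smul C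
  rw [← jquot_smul W C] at hg
  replace hΔ := Δ_smul_ne W C hΔ
  generalize C • W = E at *
  clear C W
  -- it suffices to scale
  suffices H : ∃ u α β : K, u ≠ 0 ∧ u⁻¹ ^ 4 * E.a₄ = α ^ p ∧ u⁻¹ ^ 6 * E.a₆ = β ^ p by
    obtain ⟨u, α, β, hu, h4, h6⟩ := H
    refine ⟨⟨Units.mk0 u hu, 0, 0, 0⟩, ⟨0, 0, 0, α, β⟩, ?_⟩
    ext
    · simp [variableChange_a₁, hp0]
    · simp [variableChange_a₂, hp0]
    · simp [variableChange_a₃, hp0]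
    · simp [variableChange_a₄, ← h4]
    · simp [variableChange_a₆, ← h6]
  by_cases h4 : E.a₄ = 0
  · have h6 : E.a₆ ≠ 0 := fun h => hΔ (by rw [Δ_of_isShortNF, h, h4]; ring)
    obtain ⟨β, u, hu, hβ⟩ := exists_pow_mul_pow c6 _ h6
    exact ⟨u, 0, β, hu, by simp [h4, hp0], hβ⟩
  by_cases h6 : E.a₆ = 0
  · obtain ⟨α, u, hu, hα⟩ := exists_pow_mul_pow c4 _ h4
    exact ⟨u, α, 0, hu, hα, by simp [h6, hp0]⟩
  -- the constants are `p`-th powers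
  have hn (n : ℕ) : (n : K) ^ p = n := by
    have := map_natCast (frobenius K p) n
    rwa [frobenius_def] at this
  have hg1 : (E.a₆ ^ 2 / E.a₄ ^ 3) * 27 * g ^ p = 1728 * 4 - 4 * g ^ p := by
    have hD : g ^ p * E.Δ = E.c₄ ^ 3 := by
      rw [← hg, div_mul_cancel₀ _ hΔ]
    rw [c₄_of_isShortNF, Δ_of_isShortNF] at hD
    have h16 : (16 : K) ≠ 0 := by
      have := pow_ne_zero 4 two
      norm_num1 at this
      exact this
    field_simp
    apply mul_left_cancel₀ h16
    linear_combination -hD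
  have hg0 : g ≠ 0 := by
    rintro rfl
    rw [zero_pow hp0] at hg1
    have : (2 ^ 8 * 3 ^ 3 : K) ≠ 0 := mul_ne_zero (pow_ne_zero _ two) (pow_ne_zero _ three)
    apply this
    linear_combination -hg1
  have h27 : (27 : K) ≠ 0 := by
    have := pow_ne_zero 3 three
    norm_num1 at this
    exact this
  obtain ⟨c, hc⟩ : ∃ c : K, E.a₆ ^ 2 / E.a₄ ^ 3 = c ^ p := by
    refine ⟨(1728 * 4 - 4 * g) / (27 * g), ?_⟩
    have e1 := hn 1728
    have e2 := hn 4
    have e3 := hn 27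
    push_cast at e1 e2 e3
    rw [div_pow, sub_pow_char, mul_pow, mul_pow, mul_pow, e1, e2, e3, ← hg1]
    field_simp
  have hd : E.a₆ / E.a₄ ≠ 0 := div_ne_zero h6 h4
  obtain ⟨δ, v, hv, hδ⟩ := exists_pow_mul_pow c2 _ hd
  refine ⟨v, δ ^ 2 * c⁻¹, δ ^ 3 * c⁻¹, hv, ?_, ?_⟩
  · rw [mul_pow, inv_pow c, ← hc, ← pow_mul, mul_comm 2 p, pow_mul, ← hδ]
    field_simp
  · rw [mul_pow, inv_pow c, ← hc, ← pow_mul, mul_comm 3 p, pow_mul, ← hδ]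
    field_simp

/-- Let `K` be a function field over a finite field of characteristic `p` and `E` an elliptic
curve over `K`.  Then `j(E) = c₄³/Δ` is a `p`-th power in `K` if and only if there is an
elliptic curve `E'` over `K` such that `E` is isomorphic over `K` (via an admissible change of
variables) to `E'⁽ᵖ⁾`, the curve obtained from `E'` by raising each Weierstrass coefficient
to the `p`-th power. -/
theorem j_pth_power_iff_frobenius_descent
    (Fq K : Type*) [Field Fq] [Fintype Fq] [Field K]
    (p : ℕ) [Fact p.Prime] [CharP Fq p] [CharP K p]
    [Algebra (RatFunc Fq) K] (hK : FunctionField Fq K)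
    (W : WeierstrassCurve K) (hΔ : W.Δ ≠ 0) :
    (∃ g : K, W.c₄ ^ 3 / W.Δ = g ^ p) ↔
      ∃ (W' : WeierstrassCurve K), W'.Δ ≠ 0 ∧
        ∃ C : VariableChange K, W = (C • (W'.map (frobenius K p))) := by
  constructor
  · rintro ⟨g, hg⟩
    have H : FrobGood p W := by
      by_cases p2 : p = 2
      · subst p2; exact good_two W hΔ g hg
      by_cases p3 : p = 3
      · subst p3; exact good_three W hΔ g hg
      exact good_ge p p2 p3 W hΔ g hg
    obtain ⟨C, W', h⟩ := H
    have h' : C • W = W'.map (frobenius K p) := by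
      rw [h]; rfl
    refine ⟨W', ?_, C⁻¹, ?_⟩
    · intro h0
      apply Δ_smul_ne W C hΔ
      rw [h', map_Δ, h0, map_zero]
    · rw [← h', inv_smul_smul]
  · rintro ⟨W', h0, C, rfl⟩
    refine ⟨W'.c₄ ^ 3 / W'.Δ, ?_⟩
    rw [jquot_smul, map_c₄, map_Δ, ← map_pow, ← map_div₀, frobenius_def]
end
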